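/- Let P = A ∪ B be an ℓ-divided set with A not in convex position, |A| ≥ 5 and |B| ≥ 6, with ℓ vertical, A to the left of ℓ, and all points of P having distinct x-coordinates. Let W_i, …, W_j be consecutive a*-wedges with 1 ≤ i < j ≤ t, w_i = 2 = w_j, and w_k = 1 for every k with i < k < j. Then there is an ℓ-divided 5-hole in P. -/

import Mathlib

noncomputable section

/-- Points of the plane. -/
abbrev Pt : Type := ℝ × ℝ

/-- The cross product (signed area) of two planar vectors. -/
def cross2 (u v : Pt) : ℝ := u.1 * v.2 - u.2 * v.1

/-- The dot product of two planar vectors. -/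
def dotp (v p : Pt) : ℝ := v.1 * p.1 + v.2 * p.2

/-- A set of points in the plane is in general position if no three of its points
are collinear. -/
def GenPos (P : Set Pt) : Prop :=
  ∀ p ∈ P, ∀ q ∈ P, ∀ r ∈ P, p ≠ q → p ≠ r → q ≠ r →
    ¬ Collinear ℝ ({p, q, r} : Set Pt)

/-- A set of points is in convex position if no point of the set lies in the convex
hull of the other points. -/
def ConvexPos (S : Set Pt) : Prop :=
  ∀ p ∈ S, p ∉ convexHull ℝ (S \ {p})

/-- `H` is a `k`-hole in `P`: a subset of `P` of size `k` in convex position whose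
convex hull contains no point of `P \ H`. -/
def IsKHole (k : ℕ) (P H : Finset Pt) : Prop :=
  H ⊆ P ∧ H.card = k ∧ ConvexPos (↑H : Set Pt) ∧
    ∀ p ∈ P, p ∉ H → p ∉ convexHull ℝ (↑H : Set Pt)

/-- The number of `k`-holes in `P`. -/
def numKHoles (k : ℕ) (P : Finset Pt) : ℕ :=
  Set.ncard {H : Finset Pt | IsKHole k P H}

/-- For an `ℓ`-divided set `P = A ∪ B`, an `ℓ`-divided 5-hole is a 5-hole in `A ∪ B`
containing points of both `A` and `B`. -/
def DividedFiveHole (A B H : Finset Pt) : Prop :=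
  IsKHole 5 (A ∪ B) H ∧ (↑H ∩ ↑A : Set Pt).Nonempty ∧ (↑H ∩ ↑B : Set Pt).Nonempty

/-- `x` is an extremal point of `P`: it lies on the boundary of the convex hull of `P`. -/
def OnHullBoundary (P : Finset Pt) (x : Pt) : Prop :=
  x ∈ frontier (convexHull ℝ (↑P : Set Pt))

/-- An `ℓ`-divided set `C = A ∪ B` is `ℓ`-critical if neither part is in convex position
and, for every extremal point `x` of `C`, one of the sets `(C \ {x}) ∩ A` and
`(C \ {x}) ∩ B` is in convex position. -/
def LCritical (A B : Finset Pt) : Prop :=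
  ¬ ConvexPos (↑A : Set Pt) ∧ ¬ ConvexPos (↑B : Set Pt) ∧
    ∀ x ∈ A ∪ B, OnHullBoundary (A ∪ B) x →
      (ConvexPos (↑(A.erase x) : Set Pt) ∨ ConvexPos (↑(B.erase x) : Set Pt))

/-- The closed wedge with apex `a` swept clockwise from the ray `a→p` to the ray `a→q`.
If the clockwise angle from `a→p` to `a→q` is at most `π` the wedge is convex, otherwise
it is the corresponding reflex region. -/
def Wedge (a p q : Pt) : Set Pt :=
  if cross2 (p - a) (q - a) ≤ 0 then
    {x | cross2 (p - a) (x - a) ≤ 0 ∧ 0 ≤ cross2 (q - a) (x - a)}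
  else
    {x | cross2 (p - a) (x - a) ≤ 0 ∨ 0 ≤ cross2 (q - a) (x - a)}

/-- `W` is an `a`-wedge of `A`: one of the closed regions into which the rays from `a`
through the other points of `A` partition the plane, i.e. a wedge spanned by two
points of `A \ {a}` that are angularly consecutive around `a` (no other point of `A`
lies in the wedge). -/
def IsAWedge (A : Finset Pt) (a : Pt) (W : Set Pt) : Prop :=
  ∃ p ∈ A.erase a, ∃ q ∈ A.erase a, p ≠ q ∧ W = Wedge a p q ∧
    (↑A : Set Pt) ∩ Wedge a p q ⊆ {a, p, q}

/-- The combinatorial data of the `a*`-wedges of an `ℓ`-divided set `P = A ∪ B`, where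
`ℓ` is the vertical line `x = x0` and `A` lies to its left: `aStar` is the rightmost
interior point `a*` of `A`; `lbl` is the clockwise cyclic labeling `a_0, a_1, …` of
`A \ {a*}` (period `|A| - 1`), so that the `k`-th wedge `W_k` is swept clockwise from
the ray through `lbl (k-1)` to the ray through `lbl k` and contains no other point
of `A`; the wedges `W_1, …, W_t` are exactly those meeting `ℓ`, in top-to-bottom
order along `ℓ`. -/
structure StarSetup (x0 : ℝ) (A : Finset Pt) where
  aStar : Pt
  lbl : ℕ → Pt
  t : ℕ
  aStar_mem : aStar ∈ A
  aStar_interior : aStar ∈ interior (convexHull ℝ (↑A : Set Pt))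
  aStar_rightmost : ∀ p ∈ A, p ∈ interior (convexHull ℝ (↑A : Set Pt)) → p.1 ≤ aStar.1
  lbl_mem : ∀ k, lbl k ∈ A.erase aStar
  lbl_periodic : ∀ k, lbl (k + (A.card - 1)) = lbl k
  lbl_bij : ∀ p ∈ A.erase aStar, ∃! k, k ∈ Finset.Icc 1 (A.card - 1) ∧ lbl k = p
  consec : ∀ k ∈ Finset.Icc 1 (A.card - 1),
    (↑A : Set Pt) ∩ Wedge aStar (lbl (k - 1)) (lbl k) ⊆ {aStar, lbl (k - 1), lbl k}
  t_pos : 1 ≤ t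
  t_le : t ≤ A.card - 1
  inter_iff : ∀ k ∈ Finset.Icc 1 (A.card - 1),
    ((Wedge aStar (lbl (k - 1)) (lbl k)) ∩ {p : Pt | p.1 = x0}).Nonempty ↔ k ≤ t
  ordered : ∀ k ∈ Finset.Icc 1 t, ∀ k' ∈ Finset.Icc 1 t, k < k' →
    ∀ p ∈ (Wedge aStar (lbl (k - 1)) (lbl k)) ∩ {q : Pt | q.1 = x0},
    ∀ p' ∈ (Wedge aStar (lbl (k' - 1)) (lbl k')) ∩ {q : Pt | q.1 = x0},
      p'.2 ≤ p.2

/-- The `k`-th `a*`-wedge `W_k`. -/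
def StarSetup.W {x0 : ℝ} {A : Finset Pt} (S : StarSetup x0 A) (k : ℕ) : Set Pt :=
  Wedge S.aStar (S.lbl (k - 1)) (S.lbl k)

/-- `w_k`, the number of points of `B` in the `k`-th `a*`-wedge. -/
def StarSetup.w {x0 : ℝ} {A : Finset Pt} (S : StarSetup x0 A) (B : Finset Pt) (k : ℕ) : ℕ :=
  Set.ncard ((↑B : Set Pt) ∩ S.W k)

/-! ### Orientation determinants -/

/-- Orientation determinant of three points. -/
def ori (p q r : Pt) : ℝ := (q.1 - p.1) * (r.2 - p.2) - (q.2 - p.2) * (r.1 - p.1)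

/-- Homogeneous coordinates; index `0` is the point at infinity in the upward direction. -/
def hom (pts : List Pt) (i : ℕ) : ℝ × ℝ × ℝ :=
  if i = 0 then (0, 1, 0) else ((pts.getD (i - 1) 0).1, (pts.getD (i - 1) 0).2, 1)

/-- The 3 by 3 determinant. -/
def det3 (u v w : ℝ × ℝ × ℝ) : ℝ :=
  u.1 * (v.2.1 * w.2.2 - v.2.2 * w.2.1) - u.2.1 * (v.1 * w.2.2 - v.2.2 * w.1)
    + u.2.2 * (v.1 * w.2.1 - v.2.1 * w.1)

def DD (pts : List Pt) (i j k : ℕ) : ℝ := det3 (hom pts i) (hom pts j) (hom pts k)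

def pt (pts : List Pt) (i : ℕ) : Pt := pts.getD (i - 1) 0

lemma DD_ori (pts : List Pt) {i j k : ℕ} (hi : i ≠ 0) (hj : j ≠ 0) (hk : k ≠ 0) :
    DD pts i j k = ori (pt pts i) (pt pts j) (pt pts k) := by
  simp only [DD, det3, hom, ori, pt, hi, hj, hk, if_false]; ring

lemma DD_zero (pts : List Pt) {j k : ℕ} (hj : j ≠ 0) (hk : k ≠ 0) :
    DD pts 0 j k = (pt pts k).1 - (pt pts j).1 := by
  simp only [DD, det3, hom, pt, hj, hk, if_false, if_true]; ring

lemma DD_rot (pts : List Pt) (i j k : ℕ) : DD pts i j k = DD pts j k i := by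
  simp only [DD, det3]; ring

lemma DD_swap (pts : List Pt) (i j k : ℕ) : DD pts j i k = - DD pts i j k := by
  simp only [DD, det3]; ring

lemma DD_gp (pts : List Pt) (t s p q r : ℕ) :
    DD pts t s p * DD pts t q r + DD pts t s q * DD pts t r p + DD pts t s r * DD pts t p q = 0 := by
  simp only [DD, det3]; ring

lemma DD_four (pts : List Pt) (t s p q : ℕ) :
    (hom pts t).2.2 * DD pts s p q = (hom pts s).2.2 * DD pts t p q
      + (hom pts p).2.2 * DD pts s t q + (hom pts q).2.2 * DD pts s p t := by
  simp only [DD, det3]; ring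

/-! ### The certificate checker -/

/-- Canonical code of a triple of indices up to rotation. -/
def c3 (a b c : ℕ) : ℕ :=
  bif Nat.blt a b then
    (bif Nat.blt a c then a * 256 + b * 16 + c else c * 256 + a * 16 + b)
  else (bif Nat.blt b c then b * 256 + c * 16 + a else c * 256 + a * 16 + b)

def memN (x : ℕ) : List ℕ → Bool
  | [] => false
  | y :: l => Nat.beq x y || memN x l

/-- Triples that cannot all be positively oriented. -/
def nogood (k t s p q r : ℕ) : List (ℕ × ℕ × ℕ) :=
  bif Nat.blt k 8 then [(t,s,p), (t,s,q), (t,s,r), (t,p,q), (t,q,r), (t,r,p)]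
  else [(t,p,q), (s,t,q), (s,p,t), (q,p,s)]

/-- All entries of the list but the one in position `k` are known facts. -/
def allBut (l : List ℕ) : ℕ → List (ℕ × ℕ × ℕ) → Bool
  | _, [] => true
  | 0, _ :: g => g.all (fun x => memN (c3 x.1 x.2.1 x.2.2) l)
  | k + 1, x :: g => memN (c3 x.1 x.2.1 x.2.2) l && allBut l k g

/-- hexadecimal digit -/
def dg (st i : ℕ) : ℕ := st / 16 ^ i % 16

def stepLits (st : ℕ) : List (ℕ × ℕ × ℕ) :=
  nogood (dg st 0) (dg st 5) (dg st 4) (dg st 3) (dg st 2) (dg st 1)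

def stepPos (st : ℕ) : ℕ := dg st 0 % 8

def stepOk (l : List ℕ) (st : ℕ) : Bool :=
  (Nat.blt (dg st 0) 8 ||
    (Nat.blt 0 (dg st 5) && Nat.blt 0 (dg st 3) && Nat.blt 0 (dg st 2))) &&
  allBut l (stepPos st) (stepLits st)

def stepTrip (st : ℕ) : ℕ × ℕ × ℕ := (stepLits st).getD (stepPos st) (0, 0, 0)

def stepNew (st : ℕ) : ℕ := c3 (stepTrip st).2.1 (stepTrip st).1 (stepTrip st).2.2

def runSteps (l : List ℕ) : List ℕ → Option (List ℕ)
  | [] => some l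
  | st :: ss => bif stepOk l st then runSteps (stepNew st :: l) ss else none

/-- Refutation trees. -/
inductive Cert
  | con : List ℕ → ℕ → Cert
  | hole : List ℕ → ℕ → ℕ → Cert
  | split : List ℕ → ℕ → Cert → Cert → Cert

/-- evidence that two indices denote different points -/
def sep (ds : List (ℕ × ℕ)) (l : List ℕ) (n a b : ℕ) : Bool :=
  ds.any (fun d => Nat.blt 0 d.1 && Nat.blt 0 d.2 && ((Nat.beq d.1 a && Nat.beq d.2 b) ||
    (Nat.beq d.1 b && Nat.beq d.2 a))) ||
  (List.range n).any (fun k => memN (c3 a b k) l || memN (c3 b a k) l)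

def splitOk (ds : List (ℕ × ℕ)) (l : List ℕ) (n a b c : ℕ) : Bool :=
  Nat.blt a n && Nat.blt b n && Nat.blt c n && sep ds l n a b && sep ds l n a c && sep ds l n b c

def holeOk' (n nA : ℕ) (K : List (ℕ × ℕ)) (l : List ℕ) (h0 h1 h2 h3 h4 : ℕ) : Bool :=
  [h0, h1, h2, h3, h4].all (fun x => Nat.blt 0 x && Nat.blt x n) &&
  ([(h0,h1,h2), (h0,h1,h3), (h0,h1,h4), (h0,h2,h3), (h0,h2,h4), (h0,h3,h4), (h1,h2,h3),
    (h1,h2,h4), (h1,h3,h4), (h2,h3,h4)].all (fun x => memN (c3 x.1 x.2.1 x.2.2) l)) &&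
  [h0, h1, h2, h3, h4].any (fun x => Nat.ble x nA) &&
  [h0, h1, h2, h3, h4].any (fun x => Nat.blt nA x) &&
  (K.all (fun K => Nat.blt 0 K.1 && Nat.blt K.1 n && Nat.blt 0 K.2 && Nat.blt K.2 n &&
    [h0, h1, h2, h3, h4].all (fun x => Nat.beq x K.1 || Nat.beq x K.2 || memN (c3 K.1 K.2 x) l))) &&
  ((List.range n).all (fun q => Nat.beq q 0 || memN q [h0, h1, h2, h3, h4] ||
    memN (c3 h1 h0 q) l || memN (c3 h2 h1 q) l || memN (c3 h3 h2 q) l || memN (c3 h4 h3 q) l ||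
    memN (c3 h0 h4 q) l))

def holeOk (n nA : ℕ) (regs : List (List (ℕ × ℕ))) (l : List ℕ) (h r : ℕ) : Bool :=
  match regs[r]? with
  | none => false
  | some K => holeOk' n nA K l (dg h 4) (dg h 3) (dg h 2) (dg h 1) (dg h 0)

def chk (ds : List (ℕ × ℕ)) (n nA : ℕ) (regs : List (List (ℕ × ℕ))) : List ℕ → Cert → Bool
  | l, .con ss st => match runSteps l ss with
    | none => false
    | some l' => stepOk l' st &&
        memN (c3 (stepTrip st).1 (stepTrip st).2.1 (stepTrip st).2.2) l'
  | l, .hole ss h r => match runSteps l ss with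
    | none => false
    | some l' => holeOk n nA regs l' h r
  | l, .split ss tr L R => match runSteps l ss with
    | none => false
    | some l' => splitOk ds l' n (dg tr 2) (dg tr 1) (dg tr 0) &&
        chk ds n nA regs (c3 (dg tr 2) (dg tr 1) (dg tr 0) :: l') L &&
        chk ds n nA regs (c3 (dg tr 1) (dg tr 2) (dg tr 0) :: l') R

/-- the facts `A` left of `B` -/
def leftFacts (n nA : ℕ) : List ℕ :=
  (List.range n).flatMap (fun i => (List.range n).flatMap (fun j =>
    bif Nat.blt 0 i && Nat.ble i nA && Nat.blt nA j then [i * 16 + j] else []))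

/-! ### Soundness of the checker -/

def Dc (pts : List Pt) (x : ℕ) : ℝ := DD pts (x / 256) (x / 16 % 16) (x % 16)

def FInv (pts : List Pt) (l : List ℕ) : Prop := ∀ x, memN x l = true → 0 < Dc pts x

lemma blt_dec (a b : ℕ) : Nat.blt a b = decide (a < b) := by
  rw [Bool.eq_iff_iff, Nat.blt_eq]; simp

lemma ble_dec (a b : ℕ) : Nat.ble a b = decide (a ≤ b) := by
  rw [Bool.eq_iff_iff, Nat.ble_eq]; simp

lemma beq_dec (a b : ℕ) : Nat.beq a b = decide (a = b) := by
  rw [Bool.eq_iff_iff, Nat.beq_eq]; simp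

lemma memN_iff (x : ℕ) (l : List ℕ) : memN x l = true ↔ x ∈ l := by
  induction l with
  | nil => simp [memN]
  | cons y l ih => simp [memN, ih, beq_dec]

lemma Dc_c3 (pts : List Pt) {a b c : ℕ} (ha : a < 16) (hb : b < 16) (hc : c < 16) :
    Dc pts (c3 a b c) = DD pts a b c := by
  have key : ∀ {a b c : ℕ}, a < 16 → b < 16 → c < 16 →
      Dc pts (a * 256 + b * 16 + c) = DD pts a b c := by
    intro a b c ha hb hc
    unfold Dc
    have h1 : (a * 256 + b * 16 + c) / 256 = a := by omega
    have h2 : (a * 256 + b * 16 + c) / 16 % 16 = b := by omega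
    have h3 : (a * 256 + b * 16 + c) % 16 = c := by omega
    rw [h1, h2, h3]
  unfold c3
  cases h1 : Nat.blt a b <;> cases h2 : Nat.blt a c <;> cases h3 : Nat.blt b c <;>
    simp only [cond_true, cond_false] <;> rw [key (by assumption) (by assumption) (by assumption)] <;>
    first | rfl | exact DD_rot .. | exact (DD_rot ..).symm

lemma dg_lt (st i : ℕ) : dg st i < 16 := Nat.mod_lt _ (by norm_num)

lemma FInv.get {pts : List Pt} {l : List ℕ} (h : FInv pts l) {a b c : ℕ} (ha : a < 16) (hb : b < 16)
    (hc : c < 16) (hm : memN (c3 a b c) l = true) : 0 < DD pts a b c := by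
  rw [← Dc_c3 pts ha hb hc]; exact h _ hm

lemma FInv.cons {pts : List Pt} {l : List ℕ} (h : FInv pts l) {a b c : ℕ} (ha : a < 16) (hb : b < 16)
    (hc : c < 16) (hm : 0 < DD pts a b c) : FInv pts (c3 a b c :: l) := by
  intro x hx
  simp only [memN, Bool.or_eq_true, beq_dec, decide_eq_true_eq] at hx
  rcases hx with rfl | hx
  · rwa [Dc_c3 pts ha hb hc]
  · exact h _ hx

lemma neg_of_sum {a b c d e f : ℝ} (h : a * b + c * d + e * f = 0) (ha : 0 < a) (hc : 0 < c)
    (hd : 0 < d) (he : 0 < e) (hf : 0 < f) : b < 0 := by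
  by_contra hb
  push Not at hb
  have := mul_nonneg ha.le hb
  have := mul_pos hc hd
  have := mul_pos he hf
  linarith

lemma hom_w (pts : List Pt) {i : ℕ} (h : 0 < i) : (hom pts i).2.2 = 1 := by
  simp [hom, h.ne']

lemma hom_w01 (pts : List Pt) (i : ℕ) : (hom pts i).2.2 = 1 ∨ (hom pts i).2.2 = 0 := by
  unfold hom; split <;> simp

lemma step_sound {pts : List Pt} {l : List ℕ} (h : FInv pts l) {st : ℕ} (hs : stepOk l st = true) :
    (stepTrip st).1 < 16 ∧ (stepTrip st).2.1 < 16 ∧ (stepTrip st).2.2 < 16 ∧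
    DD pts (stepTrip st).1 (stepTrip st).2.1 (stepTrip st).2.2 < 0 := by
  unfold stepOk at hs
  unfold stepTrip
  unfold stepLits stepPos at *
  have d0 := dg_lt st 0
  have d1 := dg_lt st 1
  have d2 := dg_lt st 2
  have d3 := dg_lt st 3
  have d4 := dg_lt st 4
  have d5 := dg_lt st 5
  generalize dg st 0 = k at *
  generalize dg st 1 = r at *
  generalize dg st 2 = q at *
  generalize dg st 3 = p at *
  generalize dg st 4 = s at *
  generalize dg st 5 = t at *
  have G := DD_gp pts t s p q r
  have F := DD_four pts t s p q
  have sw := DD_swap pts s p q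
  have sw' := DD_rot pts q p s
  have sw'' := DD_rot pts p s q
  interval_cases k <;>
    simp [allBut, nogood, blt_dec, d1, d2, d3, d4, d5] at hs ⊢
  · obtain ⟨h1, h2, h3, h4, h5⟩ := hs
    have h1 := h.get d5 d4 d2 h1
    have h2 := h.get d5 d4 d1 h2
    have h3 := h.get d5 d3 d2 h3
    have h4 := h.get d5 d2 d1 h4
    have h5 := h.get d5 d1 d3 h5
    exact neg_of_sum (a := DD pts t q r) (b := DD pts t s p) (c := DD pts t s q)
      (d := DD pts t r p) (e := DD pts t s r) (f := DD pts t p q) (by linarith) h4 h1 h5 h2 h3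
  · obtain ⟨h0, h2, h3, h4, h5⟩ := hs
    have h0 := h.get d5 d4 d3 h0
    have h2 := h.get d5 d4 d1 h2
    have h3 := h.get d5 d3 d2 h3
    have h4 := h.get d5 d2 d1 h4
    have h5 := h.get d5 d1 d3 h5
    exact neg_of_sum (a := DD pts t r p) (b := DD pts t s q) (c := DD pts t s p)
      (d := DD pts t q r) (e := DD pts t s r) (f := DD pts t p q) (by linarith) h5 h0 h4 h2 h3
  · obtain ⟨h0, h1, h3, h4, h5⟩ := hs
    have h0 := h.get d5 d4 d3 h0
    have h1 := h.get d5 d4 d2 h1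
    have h3 := h.get d5 d3 d2 h3
    have h4 := h.get d5 d2 d1 h4
    have h5 := h.get d5 d1 d3 h5
    exact neg_of_sum (a := DD pts t p q) (b := DD pts t s r) (c := DD pts t s p)
      (d := DD pts t q r) (e := DD pts t s q) (f := DD pts t r p) (by linarith) h3 h0 h4 h1 h5
  · obtain ⟨h0, h1, h2, h4, h5⟩ := hs
    have h0 := h.get d5 d4 d3 h0
    have h1 := h.get d5 d4 d2 h1
    have h2 := h.get d5 d4 d1 h2
    have h4 := h.get d5 d2 d1 h4
    have h5 := h.get d5 d1 d3 h5
    exact neg_of_sum (a := DD pts t s r) (b := DD pts t p q) (c := DD pts t s p)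
      (d := DD pts t q r) (e := DD pts t s q) (f := DD pts t r p) (by linarith) h2 h0 h4 h1 h5
  · obtain ⟨h0, h1, h2, h3, h5⟩ := hs
    have h0 := h.get d5 d4 d3 h0
    have h1 := h.get d5 d4 d2 h1
    have h2 := h.get d5 d4 d1 h2
    have h3 := h.get d5 d3 d2 h3
    have h5 := h.get d5 d1 d3 h5
    exact neg_of_sum (a := DD pts t s p) (b := DD pts t q r) (c := DD pts t s q)
      (d := DD pts t r p) (e := DD pts t s r) (f := DD pts t p q) (by linarith) h0 h1 h5 h2 h3
  · obtain ⟨h0, h1, h2, h3, h4⟩ := hs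
    have h0 := h.get d5 d4 d3 h0
    have h1 := h.get d5 d4 d2 h1
    have h2 := h.get d5 d4 d1 h2
    have h3 := h.get d5 d3 d2 h3
    have h4 := h.get d5 d2 d1 h4
    exact neg_of_sum (a := DD pts t s q) (b := DD pts t r p) (c := DD pts t s p)
      (d := DD pts t q r) (e := DD pts t s r) (f := DD pts t p q) (by linarith) h1 h0 h4 h2 h3
  · obtain ⟨h0, h1, h2, h3, h4, h5⟩ := hs
    have h0 := h.get d5 d4 d3 h0
    have h1 := h.get d5 d4 d2 h1
    have h2 := h.get d5 d4 d1 h2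
    have h3 := h.get d5 d3 d2 h3
    have h4 := h.get d5 d2 d1 h4
    have h5 := h.get d5 d1 d3 h5
    have := mul_pos h0 h4
    have := mul_pos h1 h5
    have := mul_pos h2 h3
    linarith
  · obtain ⟨h0, h1, h2, h3, h4, h5⟩ := hs
    have h0 := h.get d5 d4 d3 h0
    have h1 := h.get d5 d4 d2 h1
    have h2 := h.get d5 d4 d1 h2
    have h3 := h.get d5 d3 d2 h3
    have h4 := h.get d5 d2 d1 h4
    have h5 := h.get d5 d1 d3 h5
    have := mul_pos h0 h4
    have := mul_pos h1 h5
    have := mul_pos h2 h3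
    linarith
  · obtain ⟨⟨⟨ht, hp⟩, hq⟩, h1, h2, h3⟩ := hs
    have h1 := h.get d4 d5 d2 h1
    have h2 := h.get d4 d3 d5 h2
    have h3 := h.get d2 d3 d4 h3
    rw [hom_w pts ht, hom_w pts hp, hom_w pts hq] at F
    rcases hom_w01 pts s with hw | hw <;> rw [hw] at F <;> linarith
  · obtain ⟨⟨⟨ht, hp⟩, hq⟩, h0, h2, h3⟩ := hs
    have h0 := h.get d5 d3 d2 h0
    have h2 := h.get d4 d3 d5 h2
    have h3 := h.get d2 d3 d4 h3
    rw [hom_w pts ht, hom_w pts hp, hom_w pts hq] at F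
    rcases hom_w01 pts s with hw | hw <;> rw [hw] at F <;> linarith
  · obtain ⟨⟨⟨ht, hp⟩, hq⟩, h0, h1, h3⟩ := hs
    have h0 := h.get d5 d3 d2 h0
    have h1 := h.get d4 d5 d2 h1
    have h3 := h.get d2 d3 d4 h3
    rw [hom_w pts ht, hom_w pts hp, hom_w pts hq] at F
    rcases hom_w01 pts s with hw | hw <;> rw [hw] at F <;> linarith
  · obtain ⟨⟨⟨ht, hp⟩, hq⟩, h0, h1, h2⟩ := hs
    have h0 := h.get d5 d3 d2 h0
    have h1 := h.get d4 d5 d2 h1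
    have h2 := h.get d4 d3 d5 h2
    rw [hom_w pts ht, hom_w pts hp, hom_w pts hq] at F
    rcases hom_w01 pts s with hw | hw <;> rw [hw] at F <;> linarith
  · obtain ⟨⟨⟨ht, hp⟩, hq⟩, h0, h1, h2, h3⟩ := hs
    have h0 := h.get d5 d3 d2 h0
    have h1 := h.get d4 d5 d2 h1
    have h2 := h.get d4 d3 d5 h2
    have h3 := h.get d2 d3 d4 h3
    rw [hom_w pts ht, hom_w pts hp, hom_w pts hq] at F
    exfalso
    rcases hom_w01 pts s with hw | hw <;> rw [hw] at F <;> linarith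
  · obtain ⟨⟨⟨ht, hp⟩, hq⟩, h0, h1, h2, h3⟩ := hs
    have h0 := h.get d5 d3 d2 h0
    have h1 := h.get d4 d5 d2 h1
    have h2 := h.get d4 d3 d5 h2
    have h3 := h.get d2 d3 d4 h3
    rw [hom_w pts ht, hom_w pts hp, hom_w pts hq] at F
    exfalso
    rcases hom_w01 pts s with hw | hw <;> rw [hw] at F <;> linarith
  · obtain ⟨⟨⟨ht, hp⟩, hq⟩, h0, h1, h2, h3⟩ := hs
    have h0 := h.get d5 d3 d2 h0
    have h1 := h.get d4 d5 d2 h1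
    have h2 := h.get d4 d3 d5 h2
    have h3 := h.get d2 d3 d4 h3
    rw [hom_w pts ht, hom_w pts hp, hom_w pts hq] at F
    exfalso
    rcases hom_w01 pts s with hw | hw <;> rw [hw] at F <;> linarith
  · obtain ⟨⟨⟨ht, hp⟩, hq⟩, h0, h1, h2, h3⟩ := hs
    have h0 := h.get d5 d3 d2 h0
    have h1 := h.get d4 d5 d2 h1
    have h2 := h.get d4 d3 d5 h2
    have h3 := h.get d2 d3 d4 h3
    rw [hom_w pts ht, hom_w pts hp, hom_w pts hq] at F
    exfalso
    rcases hom_w01 pts s with hw | hw <;> rw [hw] at F <;> linarith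

lemma ori_rot (p q r : Pt) : ori p q r = ori q r p := by unfold ori; ring
lemma ori_swap (p q r : Pt) : ori q p r = - ori p q r := by unfold ori; ring
lemma ori_self (p q : Pt) : ori p p q = 0 := by unfold ori; ring
lemma ori_self' (p q : Pt) : ori p q q = 0 := by unfold ori; ring
lemma ori_self'' (p q : Pt) : ori p q p = 0 := by unfold ori; ring

lemma convex_half (u w : Pt) : Convex ℝ {x : Pt | 0 ≤ ori u w x} := by
  intro x hx y hy a b ha hb hab
  simp only [Set.mem_ofPred_eq] at *
  have : ori u w (a • x + b • y) = a * ori u w x + b * ori u w y := by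
    have hb' : b = 1 - a := by linarith
    subst hb'
    simp only [ori, Prod.fst_add, Prod.snd_add, Prod.smul_fst, Prod.smul_snd, smul_eq_mul]
    ring
  rw [this]; positivity

lemma hull_half {S : Set Pt} {u w : Pt} (h : ∀ x ∈ S, 0 ≤ ori u w x) {x : Pt}
    (hx : x ∈ convexHull ℝ S) : 0 ≤ ori u w x :=
  convexHull_min (fun x hx => h x hx) (convex_half u w) hx

/-- Basic hypotheses together with the absence of divided 5-holes. -/
structure Base (x0 : ℝ) (A B : Finset Pt) : Prop where
  hA : ∀ p ∈ A, p.1 < x0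
  hB : ∀ p ∈ B, x0 < p.1
  gp : ∀ p ∈ A ∪ B, ∀ q ∈ A ∪ B, ∀ r ∈ A ∪ B, p ≠ q → p ≠ r → q ≠ r → ori p q r ≠ 0
  inj : ∀ p ∈ A ∪ B, ∀ q ∈ A ∪ B, p.1 = q.1 → p = q
  nohole : ∀ H, ¬ DividedFiveHole A B H

lemma five_hole {A B : Finset Pt} {h0 h1 h2 h3 h4 : Pt}
    (m0 : h0 ∈ A ∪ B) (m1 : h1 ∈ A ∪ B) (m2 : h2 ∈ A ∪ B) (m3 : h3 ∈ A ∪ B) (m4 : h4 ∈ A ∪ B)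
    (o012 : 0 < ori h0 h1 h2) (o013 : 0 < ori h0 h1 h3) (o014 : 0 < ori h0 h1 h4)
    (o023 : 0 < ori h0 h2 h3) (o024 : 0 < ori h0 h2 h4) (o034 : 0 < ori h0 h3 h4)
    (o123 : 0 < ori h1 h2 h3) (o124 : 0 < ori h1 h2 h4) (o134 : 0 < ori h1 h3 h4)
    (o234 : 0 < ori h2 h3 h4)
    (hA : ∃ x ∈ ({h0, h1, h2, h3, h4} : Finset Pt), x ∈ A)
    (hB : ∃ x ∈ ({h0, h1, h2, h3, h4} : Finset Pt), x ∈ B)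
    (hemp : ∀ r ∈ A ∪ B, r ∉ ({h0, h1, h2, h3, h4} : Finset Pt) →
      (∀ u w : Pt, (∀ x ∈ ({h0, h1, h2, h3, h4} : Finset Pt), 0 ≤ ori u w x) → 0 ≤ ori u w r) →
      False) :
    DividedFiveHole A B {h0, h1, h2, h3, h4} := by
  have n01 : h0 ≠ h1 := by rintro rfl; simp [ori_self] at o012
  have n02 : h0 ≠ h2 := by rintro rfl; simp [ori_self] at o023
  have n03 : h0 ≠ h3 := by rintro rfl; simp [ori_self] at o034
  have n04 : h0 ≠ h4 := by rintro rfl; simp [ori_self''] at o034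
  have n12 : h1 ≠ h2 := by rintro rfl; simp [ori_self] at o123
  have n13 : h1 ≠ h3 := by rintro rfl; simp [ori_self] at o134
  have n14 : h1 ≠ h4 := by rintro rfl; simp [ori_self''] at o134
  have n23 : h2 ≠ h3 := by rintro rfl; simp [ori_self] at o234
  have n24 : h2 ≠ h4 := by rintro rfl; simp [ori_self''] at o234
  have n34 : h3 ≠ h4 := by rintro rfl; simp [ori_self'] at o234
  refine ⟨⟨?_, ?_, ?_, ?_⟩, ?_, ?_⟩
  · intro x hx
    simp only [Finset.mem_insert, Finset.mem_singleton] at hx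
    rcases hx with rfl | rfl | rfl | rfl | rfl <;> assumption
  · simp [Finset.card_insert_of_notMem, n01, n02, n03, n04, n12, n13, n14, n23, n24, n34]
  · have key : ∀ (p u w : Pt), ori u w p < 0 →
        (∀ x ∈ ({h0, h1, h2, h3, h4} : Finset Pt), x ≠ p → 0 ≤ ori u w x) →
        p ∉ convexHull ℝ ((↑({h0, h1, h2, h3, h4} : Finset Pt) : Set Pt) \ {p}) := by
      intro p u w hlt h hp
      have := hull_half (u := u) (w := w) (fun x hx => h x hx.1 hx.2) hp
      linarith
    have R : ∀ p q r : Pt, ori q r p = ori p q r := fun p q r => (ori_rot p q r).symm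
    have R' : ∀ p q r : Pt, ori r p q = ori p q r := fun p q r => (ori_rot r p q)
    intro p hp
    simp only [Finset.coe_insert, Finset.coe_singleton, Set.mem_insert_iff,
      Set.mem_singleton_iff] at hp
    rcases hp with rfl | rfl | rfl | rfl | rfl
    · refine key _ h4 h1 ?_ ?_
      · rw [ori_swap h1 h4, R]; linarith
      · intro x hx hne
        simp only [Finset.mem_insert, Finset.mem_singleton] at hx
        rcases hx with rfl | rfl | rfl | rfl | rfl
        · exact absurd rfl hne
        · rw [ori_self']
        · rw [R']; exact o124.le
        · rw [R']; exact o134.le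
        · rw [ori_self'']
    · refine key _ h0 h2 ?_ ?_
      · rw [ori_swap h2 h0, R']; linarith
      · intro x hx hne
        simp only [Finset.mem_insert, Finset.mem_singleton] at hx
        rcases hx with rfl | rfl | rfl | rfl | rfl
        · rw [ori_self'']
        · exact absurd rfl hne
        · rw [ori_self']
        · exact o023.le
        · exact o024.le
    · refine key _ h1 h3 ?_ ?_
      · rw [ori_swap h3 h1, R']; linarith
      · intro x hx hne
        simp only [Finset.mem_insert, Finset.mem_singleton] at hx
        rcases hx with rfl | rfl | rfl | rfl | rfl
        · rw [R]; exact o013.le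
        · rw [ori_self'']
        · exact absurd rfl hne
        · rw [ori_self']
        · exact o134.le
    · refine key _ h2 h4 ?_ ?_
      · rw [ori_swap h4 h2, R']; linarith
      · intro x hx hne
        simp only [Finset.mem_insert, Finset.mem_singleton] at hx
        rcases hx with rfl | rfl | rfl | rfl | rfl
        · rw [R]; exact o024.le
        · rw [R]; exact o124.le
        · rw [ori_self'']
        · exact absurd rfl hne
        · rw [ori_self']
    · refine key _ h3 h0 ?_ ?_
      · rw [ori_swap h0 h3]; linarith
      · intro x hx hne
        simp only [Finset.mem_insert, Finset.mem_singleton] at hx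
        rcases hx with rfl | rfl | rfl | rfl | rfl
        · rw [ori_self']
        · rw [ori_rot]; exact o013.le
        · rw [ori_rot]; exact o023.le
        · rw [ori_self'']
        · exact absurd rfl hne
  · intro p hp hpn hh
    refine hemp p hp hpn (fun u w h => hull_half (u := u) (w := w) (fun x hx => h x ?_) hh)
    exact_mod_cast hx
  · obtain ⟨x, h1, h2⟩ := hA
    exact ⟨x, by exact_mod_cast h1, by exact_mod_cast h2⟩
  · obtain ⟨x, h1, h2⟩ := hB
    exact ⟨x, by exact_mod_cast h1, by exact_mod_cast h2⟩

/-- Geometric context of a certificate. -/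
structure Good (x0 : ℝ) (A B : Finset Pt) (pts : List Pt) (n nA : ℕ)
    (ds : List (ℕ × ℕ)) (regs : List (List (ℕ × ℕ))) : Prop where
  base : Base x0 A B
  n16 : n ≤ 16
  dis : ∀ d ∈ ds, pt pts d.1 ≠ pt pts d.2
  mA : ∀ i, 0 < i → i ≤ nA → pt pts i ∈ A
  mB : ∀ i, nA < i → i < n → pt pts i ∈ B
  reg : ∀ K ∈ regs, ∀ r ∈ A ∪ B, (∀ k ∈ K, 0 ≤ ori (pt pts k.1) (pt pts k.2) r) →
    ∃ i, 0 < i ∧ i < n ∧ pt pts i = r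

lemma Good.mem {x0 : ℝ} {A B : Finset Pt} {pts : List Pt} {n nA : ℕ}
    {ds : List (ℕ × ℕ)} {regs : List (List (ℕ × ℕ))}
    (G : Good x0 A B pts n nA ds regs) {i : ℕ} (h0 : 0 < i) (h1 : i < n) :
    pt pts i ∈ A ∪ B := by
  rcases le_or_gt i nA with h | h
  · exact Finset.mem_union_left _ (G.mA i h0 h)
  · exact Finset.mem_union_right _ (G.mB i h h1)

lemma hole_sound {x0 : ℝ} {A B : Finset Pt} {pts : List Pt} {n nA : ℕ}
    {ds : List (ℕ × ℕ)} {regs : List (List (ℕ × ℕ))}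
    (G : Good x0 A B pts n nA ds regs) {K : List (ℕ × ℕ)} (hK : K ∈ regs)
    {l : List ℕ} (h : FInv pts l) {h0 h1 h2 h3 h4 : ℕ}
    (hc : holeOk' n nA K l h0 h1 h2 h3 h4 = true) : False := by
  have n16 := G.n16
  simp only [holeOk', Bool.and_eq_true, Bool.or_eq_true, List.all_eq_true, List.any_eq_true, blt_dec,
    ble_dec, beq_dec, decide_eq_true_eq, List.mem_range] at hc
  obtain ⟨⟨⟨⟨⟨b, o⟩, eA⟩, eB⟩, hr⟩, hq⟩ := hc
  simp only [List.forall_mem_cons, List.forall_mem_nil, and_true] at b o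
  simp only [List.not_mem_nil, false_imp_iff, implies_true, and_true] at b o
  obtain ⟨⟨p0, q0⟩, ⟨p1, q1⟩, ⟨p2, q2⟩, ⟨p3, q3⟩, ⟨p4, q4⟩⟩ := b
  have g : ∀ {a b c : ℕ}, 0 < a → a < n → 0 < b → b < n → 0 < c → c < n →
      memN (c3 a b c) l = true → 0 < ori (pt pts a) (pt pts b) (pt pts c) := by
    intro a b c ha ha' hb hb' hc hc' hm
    rw [← DD_ori pts ha.ne' hb.ne' hc.ne']
    exact h.get (by omega) (by omega) (by omega) hm
  obtain ⟨o1, o2, o3, o4, o5, o6, o7, o8, o9, o10⟩ := o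
  have o1 := g p0 q0 p1 q1 p2 q2 o1
  have o2 := g p0 q0 p1 q1 p3 q3 o2
  have o3 := g p0 q0 p1 q1 p4 q4 o3
  have o4 := g p0 q0 p2 q2 p3 q3 o4
  have o5 := g p0 q0 p2 q2 p4 q4 o5
  have o6 := g p0 q0 p3 q3 p4 q4 o6
  have o7 := g p1 q1 p2 q2 p3 q3 o7
  have o8 := g p1 q1 p2 q2 p4 q4 o8
  have o9 := g p1 q1 p3 q3 p4 q4 o9
  have o10 := g p2 q2 p3 q3 p4 q4 o10
  refine G.base.nohole _ (five_hole (G.mem p0 q0) (G.mem p1 q1) (G.mem p2 q2) (G.mem p3 q3)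
    (G.mem p4 q4) o1 o2 o3 o4 o5 o6 o7 o8 o9 o10 ?_ ?_ ?_)
  · obtain ⟨x, hx, hx'⟩ := eA
    simp only [List.mem_cons, List.not_mem_nil, or_false] at hx
    refine ⟨pt pts x, ?_, G.mA x ?_ hx'⟩
    · rcases hx with rfl | rfl | rfl | rfl | rfl <;> simp
    · rcases hx with rfl | rfl | rfl | rfl | rfl <;> assumption
  · obtain ⟨x, hx, hx'⟩ := eB
    simp only [List.mem_cons, List.not_mem_nil, or_false] at hx
    refine ⟨pt pts x, ?_, G.mB x hx' ?_⟩
    · rcases hx with rfl | rfl | rfl | rfl | rfl <;> simp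
    · rcases hx with rfl | rfl | rfl | rfl | rfl <;> assumption
  · intro r hr' hrn hh
    obtain ⟨i, hi0, hin, rfl⟩ := G.reg K hK r hr' (by
      intro k hk
      apply hh
      obtain ⟨⟨⟨⟨k1, k2⟩, k3⟩, k4⟩, k5⟩ := hr k hk
      have aux : ∀ x : ℕ, 0 < x → x < n → (x = k.1 ∨ x = k.2) ∨ memN (c3 k.1 k.2 x) l = true →
          0 ≤ ori (pt pts k.1) (pt pts k.2) (pt pts x) := by
        rintro x hx0 hxn ((rfl | rfl) | hm)
        · rw [ori_self'']
        · rw [ori_self']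
        · exact (g k1 k2 k3 k4 hx0 hxn hm).le
      intro x hx
      simp only [Finset.mem_insert, Finset.mem_singleton] at hx
      rcases hx with rfl | rfl | rfl | rfl | rfl
      · exact aux _ p0 q0 (k5 _ (by simp))
      · exact aux _ p1 q1 (k5 _ (by simp))
      · exact aux _ p2 q2 (k5 _ (by simp))
      · exact aux _ p3 q3 (k5 _ (by simp))
      · exact aux _ p4 q4 (k5 _ (by simp)))
    have R : ∀ p q r : Pt, ori q r p = ori p q r := fun p q r => (ori_rot p q r).symm
    have R' : ∀ p q r : Pt, ori r p q = ori p q r := fun p q r => (ori_rot r p q)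
    have E : ∀ {a b : ℕ}, 0 < a → a < n → 0 < b → b < n → memN (c3 b a i) l = true →
        (∀ x ∈ ({pt pts h0, pt pts h1, pt pts h2, pt pts h3, pt pts h4} : Finset Pt),
          0 ≤ ori (pt pts a) (pt pts b) x) → False := by
      intro a b ha ha' hb hb' hm hx
      have h1 := g hb hb' ha ha' hi0 hin hm
      have h2 := hh _ _ hx
      rw [ori_swap] at h1
      linarith
    rcases hq i hin with ((((((hq | hq) | hq) | hq) | hq) | hq) | hq)
    · omega
    · · rw [memN_iff] at hq
        simp only [List.mem_cons, List.not_mem_nil, or_false] at hq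
        apply hrn
        rcases hq with rfl | rfl | rfl | rfl | rfl <;> simp
    · refine E p0 q0 p1 q1 hq ?_
      simp only [Finset.mem_insert, Finset.mem_singleton]
      rintro x (rfl | rfl | rfl | rfl | rfl)
      · rw [ori_self'']
      · rw [ori_self']
      · exact o1.le
      · exact o2.le
      · exact o3.le
    · refine E p1 q1 p2 q2 hq ?_
      simp only [Finset.mem_insert, Finset.mem_singleton]
      rintro x (rfl | rfl | rfl | rfl | rfl)
      · rw [R]; exact o1.le
      · rw [ori_self'']
      · rw [ori_self']
      · exact o7.le
      · exact o8.le
    · refine E p2 q2 p3 q3 hq ?_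
      simp only [Finset.mem_insert, Finset.mem_singleton]
      rintro x (rfl | rfl | rfl | rfl | rfl)
      · rw [R]; exact o4.le
      · rw [R]; exact o7.le
      · rw [ori_self'']
      · rw [ori_self']
      · exact o10.le
    · refine E p3 q3 p4 q4 hq ?_
      simp only [Finset.mem_insert, Finset.mem_singleton]
      rintro x (rfl | rfl | rfl | rfl | rfl)
      · rw [R]; exact o6.le
      · rw [R]; exact o9.le
      · rw [R]; exact o10.le
      · rw [ori_self'']
      · rw [ori_self']
    · refine E p4 q4 p0 q0 hq ?_
      simp only [Finset.mem_insert, Finset.mem_singleton]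
      rintro x (rfl | rfl | rfl | rfl | rfl)
      · rw [ori_self']
      · rw [ori_rot]; exact o3.le
      · rw [ori_rot]; exact o5.le
      · rw [ori_rot]; exact o6.le
      · rw [ori_self'']

lemma run_sound {pts : List Pt} : ∀ (ss : List ℕ) {l l' : List ℕ}, FInv pts l →
    runSteps l ss = some l' → FInv pts l'
  | [], l, l', h, e => by
    simp only [runSteps, Option.some.injEq] at e
    exact e ▸ h
  | st :: ss, l, l', h, e => by
    simp only [runSteps] at e
    cases hs : stepOk l st with
    | false => simp [hs] at e
    | true =>
      simp only [hs, cond_true] at e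
      obtain ⟨h1, h2, h3, h4⟩ := step_sound h hs
      refine run_sound ss (h.cons h2 h1 h3 ?_) e
      rw [DD_swap]; linarith

lemma sep_sound {x0 : ℝ} {A B : Finset Pt} {pts : List Pt} {n nA : ℕ}
    {ds : List (ℕ × ℕ)} {regs : List (List (ℕ × ℕ))}
    (G : Good x0 A B pts n nA ds regs) {l : List ℕ} (h : FInv pts l)
    {a b : ℕ} (ha : a < n) (hb : b < n) (hs : sep ds l n a b = true) : hom pts a ≠ hom pts b := by
  have n16 := G.n16
  intro e
  simp only [sep, List.any_eq_true, List.mem_range, Bool.or_eq_true, Bool.and_eq_true, blt_dec,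
    beq_dec, decide_eq_true_eq] at hs
  rcases hs with ⟨d, hd, ⟨h1, h2⟩, hh⟩ | ⟨k, hk, hm | hm⟩
  · apply G.dis d hd
    have e' : hom pts d.1 = hom pts d.2 := by
      rcases hh with ⟨rfl, rfl⟩ | ⟨rfl, rfl⟩
      · exact e
      · exact e.symm
    simp only [hom, h1.ne', h2.ne', if_false, Prod.mk.injEq, and_true] at e'
    exact Prod.ext e'.1 e'.2
  · have := h.get (by omega) (by omega) (by omega) hm
    rw [DD, e, det3] at this
    ring_nf at this
    exact lt_irrefl _ this
  · have := h.get (by omega) (by omega) (by omega) hm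
    rw [DD, e, det3] at this
    ring_nf at this
    exact lt_irrefl _ this

lemma DD_ne {x0 : ℝ} {A B : Finset Pt} {pts : List Pt} {n nA : ℕ}
    {ds : List (ℕ × ℕ)} {regs : List (List (ℕ × ℕ))}
    (G : Good x0 A B pts n nA ds regs) {a b c : ℕ}
    (ha : a < n) (hb : b < n) (hc : c < n) (hab : hom pts a ≠ hom pts b)
    (hac : hom pts a ≠ hom pts c) (hbc : hom pts b ≠ hom pts c) : DD pts a b c ≠ 0 := by
  have P : ∀ {i j : ℕ}, i ≠ 0 → j ≠ 0 → hom pts i ≠ hom pts j → pt pts i ≠ pt pts j := by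
    intro i j hi hj h e
    apply h
    unfold pt at e
    simp only [hom, hi, hj, if_false, e]
  have Z : ∀ {i j : ℕ}, i < n → j < n → hom pts 0 ≠ hom pts i → hom pts 0 ≠ hom pts j →
      hom pts i ≠ hom pts j → DD pts 0 i j ≠ 0 := by
    intro i j hi hj h1 h2 h3
    have hi0 : i ≠ 0 := by rintro rfl; exact h1 rfl
    have hj0 : j ≠ 0 := by rintro rfl; exact h2 rfl
    rw [DD_zero pts hi0 hj0]
    intro e
    exact P hi0 hj0 h3 (G.base.inj _ (G.mem (by omega) hi) _ (G.mem (by omega) hj) (by linarith))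
  rcases Nat.eq_zero_or_pos a with rfl | ha0
  · exact Z hb hc hab hac hbc
  rcases Nat.eq_zero_or_pos b with rfl | hb0
  · rw [DD_rot]; exact Z hc ha hbc hab.symm hac.symm
  rcases Nat.eq_zero_or_pos c with rfl | hc0
  · rw [← DD_rot]; exact Z ha hb hac.symm hbc.symm hab
  rw [DD_ori pts ha0.ne' hb0.ne' hc0.ne']
  exact G.base.gp _ (G.mem ha0 ha) _ (G.mem hb0 hb) _ (G.mem hc0 hc) (P ha0.ne' hb0.ne' hab)
    (P ha0.ne' hc0.ne' hac) (P hb0.ne' hc0.ne' hbc)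

lemma chk_sound {x0 : ℝ} {A B : Finset Pt} {pts : List Pt} {n nA : ℕ}
    {ds : List (ℕ × ℕ)} {regs : List (List (ℕ × ℕ))}
    (G : Good x0 A B pts n nA ds regs) :
    ∀ (C : Cert) {l : List ℕ}, FInv pts l → chk ds n nA regs l C = true → False
  | .con ss st, l, h, e => by
    simp only [chk] at e
    cases hr : runSteps l ss with
    | none => simp [hr] at e
    | some l' =>
      simp only [hr, Bool.and_eq_true] at e
      have h' := run_sound ss h hr
      obtain ⟨h1, h2, h3, h4⟩ := step_sound h' e.1
      exact absurd (h'.get h1 h2 h3 e.2) (not_lt.mpr h4.le)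
  | .hole ss hh r, l, h, e => by
    simp only [chk] at e
    cases hr : runSteps l ss with
    | none => simp [hr] at e
    | some l' =>
      simp only [hr, holeOk] at e
      cases hk : regs[r]? with
      | none => simp [hk] at e
      | some K =>
        simp only [hk] at e
        exact hole_sound G (List.mem_of_getElem? hk) (run_sound ss h hr) e
  | .split ss tr L R, l, h, e => by
    simp only [chk] at e
    cases hr : runSteps l ss with
    | none => simp [hr] at e
    | some l' =>
      have h' := run_sound ss h hr
      simp only [hr, splitOk, Bool.and_eq_true, blt_dec, decide_eq_true_eq] at e
      obtain ⟨⟨⟨⟨⟨⟨⟨a, b⟩, c⟩, s1⟩, s2⟩, s3⟩, eL⟩, eR⟩ := e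
      have ne := DD_ne G a b c (sep_sound G h' a b s1) (sep_sound G h' a c s2)
        (sep_sound G h' b c s3)
      rcases lt_or_gt_of_ne ne with hlt | hgt
      · refine chk_sound G R (h'.cons (dg_lt _ _) (dg_lt _ _) (dg_lt _ _) ?_) eR
        rw [DD_swap]; linarith
      · exact chk_sound G L (h'.cons (dg_lt _ _) (dg_lt _ _) (dg_lt _ _) hgt) eL

/-- The explicit facts. -/
def FP (pts : List Pt) : List ℕ → Prop
  | [] => True
  | x :: l => (bif Nat.blt x 256 then (pt pts (x / 16 % 16)).1 < (pt pts (x % 16)).1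
      else 0 < ori (pt pts (x / 256)) (pt pts (x / 16 % 16)) (pt pts (x % 16))) ∧ FP pts l

def wfF (l : List ℕ) : Bool :=
  l.all (fun x => Nat.blt 0 (x / 16 % 16) && Nat.blt 0 (x % 16))

lemma FP_sound {pts : List Pt} : ∀ (l : List ℕ), FP pts l → wfF l = true → FInv pts l
  | [], _, _ => by intro x hx; simp [memN] at hx
  | y :: l, h, w => by
    simp only [wfF, List.all_cons, Bool.and_eq_true, blt_dec, decide_eq_true_eq] at w
    intro x hx
    simp only [memN, Bool.or_eq_true, beq_dec, decide_eq_true_eq] at hx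
    rcases hx with rfl | hx
    · have h := h.1
      unfold Dc
      cases hb : Nat.blt x 256 with
      | true =>
        rw [hb, cond_true] at h
        rw [blt_dec, decide_eq_true_eq] at hb
        rw [Nat.div_eq_of_lt hb, DD_zero pts w.1.1.ne' w.1.2.ne']
        linarith
      | false =>
        rw [hb, cond_false] at h
        rw [blt_dec, decide_eq_false_iff_not] at hb
        rw [DD_ori pts (by omega) w.1.1.ne' w.1.2.ne']
        exact h
    · exact FP_sound l h.2 (by simpa [wfF, blt_dec] using w.2) x hx

/-- Main soundness theorem of the checker. -/
theorem cert_sound {x0 : ℝ} {A B : Finset Pt} (hb : Base x0 A B) (pA pB : List Pt)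
    (ds : List (ℕ × ℕ)) (regs : List (List (ℕ × ℕ))) (facts : List ℕ) (C : Cert)
    (hd : ∀ d ∈ ds, pt (pA ++ pB) d.1 ≠ pt (pA ++ pB) d.2)
    (hA : ∀ p ∈ pA, p ∈ A) (hB : ∀ p ∈ pB, p ∈ B)
    (hf : FP (pA ++ pB) facts)
    (hreg : ∀ K ∈ regs, ∀ r ∈ A ∪ B,
      (∀ k ∈ K, 0 ≤ ori (pt (pA ++ pB) k.1) (pt (pA ++ pB) k.2) r) → r ∈ pA ∨ r ∈ pB)
    (hn : pA.length + pB.length < 16)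
    (hc : (wfF facts && chk ds (pA.length + pB.length + 1) pA.length regs
      (facts ++ leftFacts (pA.length + pB.length + 1) pA.length) C) = true) : False := by
  rw [Bool.and_eq_true] at hc
  have mA : ∀ i, 0 < i → i ≤ pA.length → pt (pA ++ pB) i ∈ A := by
    intro i h0 h1
    have : i - 1 < pA.length := by omega
    rw [pt, List.getD_append _ _ _ _ this, List.getD_eq_getElem _ _ this]
    exact hA _ (List.getElem_mem _)
  have mB : ∀ i, pA.length < i → i < pA.length + pB.length + 1 → pt (pA ++ pB) i ∈ B := by
    intro i h0 h1
    have h2 : pA.length ≤ i - 1 := by omega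
    have h3 : i - 1 - pA.length < pB.length := by omega
    rw [pt, List.getD_append_right _ _ _ _ h2, List.getD_eq_getElem _ _ h3]
    exact hB _ (List.getElem_mem _)
  have G : Good x0 A B (pA ++ pB) (pA.length + pB.length + 1) pA.length ds regs := by
    refine ⟨hb, by omega, hd, mA, mB, ?_⟩
    intro K hK r hr h
    have : r ∈ pA ++ pB := by simpa using hreg K hK r hr h
    obtain ⟨i, hi, rfl⟩ := List.getElem_of_mem this
    refine ⟨i + 1, by omega, by simp at hi; omega, ?_⟩
    rw [pt, Nat.add_sub_cancel, List.getD_eq_getElem _ _ hi]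
  refine chk_sound G C ?_ hc.2
  intro x hx
  rw [memN_iff, List.mem_append] at hx
  rcases hx with hx | hx
  · exact FP_sound facts hf hc.1 x ((memN_iff _ _).mpr hx)
  · simp only [leftFacts, List.mem_flatMap, List.mem_range] at hx
    obtain ⟨i, hi, j, hj, hx⟩ := hx
    cases hcond : (Nat.blt 0 i && Nat.ble i pA.length && Nat.blt pA.length j) with
    | false => simp [hcond] at hx
    | true =>
      simp only [hcond, cond_true, List.mem_singleton] at hx
      simp only [Bool.and_eq_true, blt_dec, ble_dec, decide_eq_true_eq] at hcond
      subst hx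
      have e1 : (i * 16 + j) / 256 = 0 := by omega
      have e2 : (i * 16 + j) / 16 % 16 = i := by omega
      have e3 : (i * 16 + j) % 16 = j := by omega
      rw [Dc, e1, e2, e3, DD_zero _ (by omega) (by omega)]
      have := hb.hA _ (mA i hcond.1.1 hcond.1.2)
      have := hb.hB _ (mB j hcond.2 hj)
      linarith


lemma rot1 {p q r : Pt} (h : 0 < ori p q r) : 0 < ori q r p := by rwa [← ori_rot]
lemma rot2 {p q r : Pt} (h : 0 < ori p q r) : 0 < ori r p q := rot1 (rot1 h)

theorem cert_sound' {x0 : ℝ} {A B : Finset Pt} (hb : Base x0 A B) (pA pB : List Pt) (n nA : ℕ)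
    (hnA : pA.length = nA) (hn' : pA.length + pB.length + 1 = n)
    (ds : List (ℕ × ℕ)) (regs : List (List (ℕ × ℕ))) (facts : List ℕ) (C : Cert)
    (hd : ∀ d ∈ ds, pt (pA ++ pB) d.1 ≠ pt (pA ++ pB) d.2)
    (hA : ∀ p ∈ pA, p ∈ A) (hB : ∀ p ∈ pB, p ∈ B)
    (hf : FP (pA ++ pB) facts)
    (hreg : ∀ K ∈ regs, ∀ r ∈ A ∪ B,
      (∀ k ∈ K, 0 ≤ ori (pt (pA ++ pB) k.1) (pt (pA ++ pB) k.2) r) → r ∈ pA ∨ r ∈ pB)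
    (hn : n ≤ 16)
    (hc : (wfF facts && chk ds n nA regs (facts ++ leftFacts n nA) C) = true) : False := by
  subst hnA hn'
  exact cert_sound hb pA pB ds regs facts C hd hA hB hf hreg (by omega) hc

theorem cert_c212dd {x0 : ℝ} {A B : Finset Pt} (hb : Base x0 A B) (c a0 a1 a2 a3 b1 b2 b3 b4 b5 :
      Pt)
    (m_c : c ∈ A) (m_a0 : a0 ∈ A) (m_a1 : a1 ∈ A) (m_a2 : a2 ∈ A) (m_a3 : a3 ∈ A) (m_b1 : b1 ∈ B)
      (m_b2 : b2 ∈ B) (m_b3 : b3 ∈ B) (m_b4 : b4 ∈ B) (m_b5 : b5 ∈ B)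
    (h0 : c.1 < a1.1)
    (h1 : c.1 < a2.1)
    (h2 : 0 < ori c b1 a0)
    (h3 : 0 < ori c a1 a0)
    (h4 : 0 < ori c b2 b1)
    (h5 : 0 < ori c a1 b2)
    (h6 : 0 < ori c b3 a1)
    (h7 : 0 < ori c a2 b3)
    (h8 : 0 < ori c b4 a2)
    (h9 : 0 < ori c b5 b4)
    (h10 : 0 < ori c a3 b5)
    (h11 : 0 < ori c a3 a2)
    (h12 : 0 < ori b2 b1 a0)
    (h13 : 0 < ori b1 b2 a1)
    (h14 : 0 < ori b5 b4 a2)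
    (h15 : 0 < ori b4 b5 a3)
    (d0 : b1 ≠ b4)
    (d1 : b2 ≠ b5)
    (R0 : ∀ r ∈ A ∪ B, 0 ≤ ori a0 c r → 0 ≤ ori c b4 r → r ∈ [c, a0, a1, a2, a3, b1, b2, b3, b4,
      b5])
    (R1 : ∀ r ∈ A ∪ B, 0 ≤ ori a0 c r → 0 ≤ ori c b5 r → r ∈ [c, a0, a1, a2, a3, b1, b2, b3, b4,
      b5])
    (R2 : ∀ r ∈ A ∪ B, 0 ≤ ori b1 c r → 0 ≤ ori c b4 r → r ∈ [c, a0, a1, a2, a3, b1, b2, b3, b4,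
      b5])
    (R3 : ∀ r ∈ A ∪ B, 0 ≤ ori b1 c r → 0 ≤ ori c b5 r → r ∈ [c, a0, a1, a2, a3, b1, b2, b3, b4,
      b5])
    (R4 : ∀ r ∈ A ∪ B, 0 ≤ ori b1 c r → 0 ≤ ori c a3 r → r ∈ [c, a0, a1, a2, a3, b1, b2, b3, b4,
      b5])
    : False := by
  refine cert_sound' hb [c, a0, a1, a2, a3] [b1, b2, b3, b4, b5] 11 5 rfl rfl [(6, 9), (7, 10)]
      [[(2, 1), (1, 9)], [(2, 1), (1, 10)], [(6, 1), (1, 9)], [(6, 1), (1, 10)], [(6, 1), (1, 5)]]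
    [19, 20, 354, 306, 374, 311, 387, 328, 404, 425, 346, 340, 630,
      871, 1193, 1434]
    (.split [7344994, 8393780, 10491282, 6301493, 6297397, 3604866, 3539330, 4718994,
      4850065, 9456213, 4719010, 10491204, 9443925, 1255267, 7344932, 1275912, 1271816,
      1345800, 1346056, 6371444] 922
  (.con [9443893, 3735938] 1284104)
  (.split [9452117] 890
  (.con [3604900, 3801474] 1288200)
  (.split [] 1144
  (.hole [8393842, 8787057, 1345289, 3442441, 92275, 6297669, 6305861, 6309763,
      4653458, 1341704, 7419029, 7555460, 4587922, 1337608, 6370453, 6506884, 6375796]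
      300664 2)
  (.split [4718964, 4653458, 4653474, 1341704] 1129
  (.con [4587921, 4653410] 6297408)
  (.split [] 313
  (.con [3735938] 1284104)
  (.split [1651843, 3539346, 3604882, 3801489, 1272072, 1652292, 6371700, 3539362,
      10491188, 1272328, 4587938, 6296612] 2153
  (.split [8788276, 8788340] 1081
  (.hole [3230355] 108867 3)
  (.hole [] 235623 2))
  (.split [] 1081
  (.hole [3230355] 108867 3)
  (.split [] 2202
  (.hole [9443970, 9640578, 9837185, 11015569, 8428041, 8395106, 8411555, 6326537,
      8403285, 8591701, 9844097, 6392229, 10884497, 6297636, 6314131, 6297941] 354458 4)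
  (.split [] 905
  (.hole [8853809, 9639300] 231783 2)
  (.split [3246739] 1082
  (.split [3819621, 3819637, 4536976, 6304884] 1128
  (.split [6376068, 8393826, 6297636] 1690
  (.hole [9443938, 10884497, 6330889, 6298197, 6306389, 3478624] 88643 4)
  (.hole [] 305512 3))
  (.hole [] 215143 2))
  (.split [] 564
  (.split [3544097, 3609633, 4592179, 3418211, 3418467, 1321011, 4331825, 4332081,
      1217546, 1221642, 8397637] 1929
  (.split [] 649
  (.hole [] 215704 1)
  (.hole [] 144536 0))
  (.hole [] 215431 0))
  (.hole [] 215704 3))))))))))))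
    (by simp [pt, d0, d1]) (by simp [m_c, m_a0, m_a1, m_a2, m_a3]) (by simp [m_b1, m_b2, m_b3,
      m_b4, m_b5])
    ⟨h0, h1, h2, h3, h4, h5, h6, h7, h8, h9, h10, h11, rot2 h12, rot2 h13, rot2 h14, rot2 h15,
      trivial⟩ ?_ (by norm_num) (by decide +kernel)
  intro K hK r hr h
  simp only [List.mem_cons, List.not_mem_nil, or_false] at hK
  rcases hK with rfl | rfl | rfl | rfl | rfl
  · exact List.mem_append.mp (R0 r hr (h (2, 1) (by simp)) (h (1, 9) (by simp)))
  · exact List.mem_append.mp (R1 r hr (h (2, 1) (by simp)) (h (1, 10) (by simp)))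
  · exact List.mem_append.mp (R2 r hr (h (6, 1) (by simp)) (h (1, 9) (by simp)))
  · exact List.mem_append.mp (R3 r hr (h (6, 1) (by simp)) (h (1, 10) (by simp)))
  · exact List.mem_append.mp (R4 r hr (h (6, 1) (by simp)) (h (1, 5) (by simp)))

theorem cert_c212du {x0 : ℝ} {A B : Finset Pt} (hb : Base x0 A B) (c a0 a1 a2 a3 b1 b2 b3 b4 b5 :
      Pt)
    (m_c : c ∈ A) (m_a0 : a0 ∈ A) (m_a1 : a1 ∈ A) (m_a2 : a2 ∈ A) (m_a3 : a3 ∈ A) (m_b1 : b1 ∈ B)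
      (m_b2 : b2 ∈ B) (m_b3 : b3 ∈ B) (m_b4 : b4 ∈ B) (m_b5 : b5 ∈ B)
    (h0 : c.1 < a1.1)
    (h1 : c.1 < a2.1)
    (h2 : 0 < ori c b1 a0)
    (h3 : 0 < ori c a1 a0)
    (h4 : 0 < ori c b2 b1)
    (h5 : 0 < ori c a1 b2)
    (h6 : 0 < ori c b3 a1)
    (h7 : 0 < ori c a2 b3)
    (h8 : 0 < ori c b4 a2)
    (h9 : 0 < ori c b5 b4)
    (h10 : 0 < ori c a3 b5)
    (h11 : 0 < ori c a3 a2)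
    (h12 : 0 < ori b2 b1 a0)
    (h13 : 0 < ori b1 b2 a1)
    (h14 : 0 < ori b4 b5 a2)
    (h15 : 0 < ori b5 b4 a3)
    (d0 : a1 ≠ a3)
    (R0 : ∀ r ∈ A ∪ B, 0 ≤ ori b1 c r → 0 ≤ ori c b4 r → r ∈ [c, a0, a1, a2, a3, b1, b2, b3, b4,
      b5])
    (R1 : ∀ r ∈ A ∪ B, 0 ≤ ori b1 c r → 0 ≤ ori c b5 r → r ∈ [c, a0, a1, a2, a3, b1, b2, b3, b4,
      b5])
    : False := by
  refine cert_sound' hb [c, a0, a1, a2, a3] [b1, b2, b3, b4, b5] 11 5 rfl rfl [(3, 5)] [[(6, 1),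
      (1, 9)], [(6, 1), (1, 10)]]
    [19, 20, 354, 306, 374, 311, 387, 328, 404, 425, 346, 340, 630,
      871, 1178, 1449]
    (.split [7344994, 8393780, 9443905, 10491027, 10491204, 6297397, 3604866, 3539330,
      4718994, 4719010, 1255267, 7344932, 1275912, 1271816, 1345800, 1346056, 9968193,
      6371444] 313
  (.con [3735938] 1284104)
  (.split [1651843, 3539346, 3604882, 1272072, 1276168, 1652292, 1652548, 6371700,
      4587922, 4587938, 1337864, 4653458, 4653474, 1341960, 9837121, 6371749, 6371956,
      9902657, 7420325] 1128
  (.hole [6375812, 6376068, 8393826, 6297636] 301672 1)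
  (.split [8787060] 1079
  (.split [3609636, 4397425, 4397681, 9640513, 10490691, 10499157] 2105
  (.split [] 906
  (.hole [8788529, 8854065, 10687876] 232039 1)
  (.hole [] 215464 1))
  (.hole [] 236135 1))
  (.split [3544177, 7555173] 837
  (.hole [4724017] 215143 0)
  (.hole [] 215143 0)))))
    (by simp [pt, d0]) (by simp [m_c, m_a0, m_a1, m_a2, m_a3]) (by simp [m_b1, m_b2, m_b3, m_b4,
      m_b5])
    ⟨h0, h1, h2, h3, h4, h5, h6, h7, h8, h9, h10, h11, rot2 h12, rot2 h13, rot2 h14, rot2 h15,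
      trivial⟩ ?_ (by norm_num) (by decide +kernel)
  intro K hK r hr h
  simp only [List.mem_cons, List.not_mem_nil, or_false] at hK
  rcases hK with rfl | rfl
  · exact List.mem_append.mp (R0 r hr (h (6, 1) (by simp)) (h (1, 9) (by simp)))
  · exact List.mem_append.mp (R1 r hr (h (6, 1) (by simp)) (h (1, 10) (by simp)))

theorem cert_c212ud {x0 : ℝ} {A B : Finset Pt} (hb : Base x0 A B) (c a0 a1 a2 a3 b1 b2 b3 b4 b5 :
      Pt)
    (m_c : c ∈ A) (m_a0 : a0 ∈ A) (m_a1 : a1 ∈ A) (m_a2 : a2 ∈ A) (m_a3 : a3 ∈ A) (m_b1 : b1 ∈ B)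
      (m_b2 : b2 ∈ B) (m_b3 : b3 ∈ B) (m_b4 : b4 ∈ B) (m_b5 : b5 ∈ B)
    (h0 : c.1 < a1.1)
    (h1 : c.1 < a2.1)
    (h2 : 0 < ori c b1 a0)
    (h3 : 0 < ori c a1 a0)
    (h4 : 0 < ori c b2 b1)
    (h5 : 0 < ori c a1 b2)
    (h6 : 0 < ori c b3 a1)
    (h7 : 0 < ori c a2 b3)
    (h8 : 0 < ori c b4 a2)
    (h9 : 0 < ori c b5 b4)
    (h10 : 0 < ori c a3 b5)
    (h11 : 0 < ori c a3 a2)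
    (h12 : 0 < ori b1 b2 a0)
    (h13 : 0 < ori b2 b1 a1)
    (h14 : 0 < ori b5 b4 a2)
    (h15 : 0 < ori b4 b5 a3)
    (d0 : a0 ≠ a2)
    (d1 : b1 ≠ b4)
    (R0 : ∀ r ∈ A ∪ B, 0 ≤ ori a0 c r → 0 ≤ ori c b4 r → r ∈ [c, a0, a1, a2, a3, b1, b2, b3, b4,
      b5])
    (R1 : ∀ r ∈ A ∪ B, 0 ≤ ori a0 c r → 0 ≤ ori c b5 r → r ∈ [c, a0, a1, a2, a3, b1, b2, b3, b4,
      b5])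
    (R2 : ∀ r ∈ A ∪ B, 0 ≤ ori b1 c r → 0 ≤ ori c b4 r → r ∈ [c, a0, a1, a2, a3, b1, b2, b3, b4,
      b5])
    (R3 : ∀ r ∈ A ∪ B, 0 ≤ ori b1 c r → 0 ≤ ori c b5 r → r ∈ [c, a0, a1, a2, a3, b1, b2, b3, b4,
      b5])
    (R4 : ∀ r ∈ A ∪ B, 0 ≤ ori b1 c r → 0 ≤ ori c a3 r → r ∈ [c, a0, a1, a2, a3, b1, b2, b3, b4,
      b5])
    (R5 : ∀ r ∈ A ∪ B, 0 ≤ ori b2 c r → 0 ≤ ori c a3 r → r ∈ [c, a0, a1, a2, a3, b1, b2, b3, b4,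
      b5])
    : False := by
  refine cert_sound' hb [c, a0, a1, a2, a3] [b1, b2, b3, b4, b5] 11 5 rfl rfl [(2, 4), (6, 9)]
      [[(2, 1), (1, 9)], [(2, 1), (1, 10)], [(6, 1), (1, 9)], [(6, 1), (1, 10)], [(6, 1), (1, 5)],
      [(7, 1), (1, 5)]]
    [19, 20, 354, 306, 374, 311, 387, 328, 404, 425, 346, 340, 615,
      886, 1193, 1434]
    (.split [6297377, 7344739, 7344932, 8393780, 10491282, 3604836, 6296356, 3604866,
      3539330, 4718994, 4850065, 9456213, 4719010, 10491204, 9443925, 1275912, 1271816,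
      1345800, 1346056] 1062
  (.con [6296611, 4718946] 1345032)
  (.split [] 873
  (.con [3539348, 3735938] 1284104)
  (.split [] 314
  (.con [3801474] 1288200)
  (.split [1717379, 1718595, 3539362, 3604898, 10491188, 10687890, 1272328, 1276424,
      1717828, 1718084, 1717908, 1718164, 3604882, 4587922, 4587938, 4653458, 4653474,
      7345252] 1081
  (.hole [3230355] 108867 3)
  (.split [] 1128
  (.split [4810868, 6375300, 6375812, 6376068, 6825072, 7424388, 7424644] 1657
  (.split [7346529, 7477601, 92053, 9441907, 9442676, 9443956, 9447333, 9459315,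
      9463717, 2189205, 6751633] 1658
  (.hole [6752915, 6761107, 7477857, 10490467] 157609 1)
  (.hole [] 305000 3))
  (.hole [] 300904 2))
  (.split [] 2169
  (.split [7424389, 8853812] 1079
  (.split [3604805, 3605604] 292
  (.hole [] 82806 2)
  (.hole [] 82806 0))
  (.hole [] 215431 2))
  (.split [] 2153
  (.split [8788276, 8788338, 3246739] 1078
  (.split [3544100, 3819616] 2202
  (.hole [9443970, 9902721, 11015569, 8428041, 8395122, 8411555, 7375113, 7440805,
      10950033, 7379465, 8395349, 7346212, 7362723, 9897345, 7346517] 358554 5)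
  (.hole [] 215704 3))
  (.hole [] 215430 2))
  (.split [] 1417
  (.hole [9442690, 9835905, 9901441, 1415177, 8395106, 8395122, 6326537, 7375113,
      6297941, 6314131, 7346517, 7362707, 7346276, 7362179, 7366805] 358025 4)
  (.split [] 1079
  (.split [3604805, 3605604] 292
  (.hole [] 82806 2)
  (.hole [] 82806 0))
  (.split [] 1656
  (.hole [6387861, 7346273, 7477345, 7346529, 7477601, 8393331, 8395121, 2189189,
      8526193, 92053, 9441907, 9442676, 9459315, 2189205, 9443972, 6751633] 157577 0)
  (.split [] 1690
  (.hole [9443938, 10884497, 6330889, 92052, 6314403, 6298197, 92068, 7346468,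
      7346532, 9897313, 9898593, 7346788, 10945889, 7350613, 7477589, 7493267] 358042 4)
  (.split [9837188] 1082
  (.split [3819365, 4536976] 1144
  (.split [7424644, 8393842, 7346212] 1946
  (.split [9443954, 9837170, 10950033, 7379465, 7362979, 7362195, 7739733, 7747925,
      3478640] 1302
  (.hole [5707316, 6625058, 3544356, 5445157] 88643 5)
  (.hole [] 88643 4))
  (.hole [] 305528 3))
  (.hole [] 215158 2))
  (.split [] 1658
  (.hole [6388373, 7346785, 7477857, 7346529, 7477601, 9837172, 92069, 10490483,
      10491252, 10495829, 10507891, 2189221, 10639729, 9441907, 2189205, 6751649] 157609 1)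
  (.split [] 2105
  (.split [3246739] 564
  (.split [3418227, 3418483, 3418739, 3544097, 4592179, 8393267, 8397637, 9441843,
      9446213, 10490419] 649
  (.hole [] 215704 1)
  (.hole [] 144536 0))
  (.hole [] 215704 3))
  (.split [] 1657
  (.split [7346529, 7477601, 9837172, 9441907, 1647667, 1648691] 1078
  (.hole [3544100] 82786 0)
  (.split [] 1930
  (.split [] 1864
  (.split [] 837
  (.hole [4724017] 215158 0)
  (.hole [] 215158 0))
  (.hole [] 305528 3))
  (.hole [] 215670 3)))
  (.hole [] 231798 2))))))))))))))))
    (by simp [pt, d0, d1]) (by simp [m_c, m_a0, m_a1, m_a2, m_a3]) (by simp [m_b1, m_b2, m_b3,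
      m_b4, m_b5])
    ⟨h0, h1, h2, h3, h4, h5, h6, h7, h8, h9, h10, h11, rot2 h12, rot2 h13, rot2 h14, rot2 h15,
      trivial⟩ ?_ (by norm_num) (by decide +kernel)
  intro K hK r hr h
  simp only [List.mem_cons, List.not_mem_nil, or_false] at hK
  rcases hK with rfl | rfl | rfl | rfl | rfl | rfl
  · exact List.mem_append.mp (R0 r hr (h (2, 1) (by simp)) (h (1, 9) (by simp)))
  · exact List.mem_append.mp (R1 r hr (h (2, 1) (by simp)) (h (1, 10) (by simp)))
  · exact List.mem_append.mp (R2 r hr (h (6, 1) (by simp)) (h (1, 9) (by simp)))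
  · exact List.mem_append.mp (R3 r hr (h (6, 1) (by simp)) (h (1, 10) (by simp)))
  · exact List.mem_append.mp (R4 r hr (h (6, 1) (by simp)) (h (1, 5) (by simp)))
  · exact List.mem_append.mp (R5 r hr (h (7, 1) (by simp)) (h (1, 5) (by simp)))

theorem cert_cE2dd {x0 : ℝ} {A B : Finset Pt} (hb : Base x0 A B) (c a0 a1 a2 a3 b1 b2 b3 b4 : Pt)
    (m_c : c ∈ A) (m_a0 : a0 ∈ A) (m_a1 : a1 ∈ A) (m_a2 : a2 ∈ A) (m_a3 : a3 ∈ A) (m_b1 : b1 ∈ B)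
      (m_b2 : b2 ∈ B) (m_b3 : b3 ∈ B) (m_b4 : b4 ∈ B)
    (h0 : c.1 < a1.1)
    (h1 : c.1 < a2.1)
    (h2 : c.1 < a3.1)
    (h3 : 0 < ori c b1 a0)
    (h4 : 0 < ori c a1 a0)
    (h5 : 0 < ori c b2 b1)
    (h6 : 0 < ori c a1 b2)
    (h7 : 0 < ori c b3 a1)
    (h8 : 0 < ori c b4 b3)
    (h9 : 0 < ori c a2 b4)
    (h10 : 0 < ori c a3 a2)
    (h11 : 0 < ori b2 b1 a0)
    (h12 : 0 < ori b1 b2 a1)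
    (h13 : 0 < ori b4 b3 a1)
    (h14 : 0 < ori b3 b4 a2)
    (h15 : 0 < ori a1 a3 a2)
    (R0 : ∀ r ∈ A ∪ B, 0 ≤ ori b1 c r → 0 ≤ ori c b4 r → r ∈ [c, a0, a1, a2, a3, b1, b2, b3, b4])
    (R1 : ∀ r ∈ A ∪ B, 0 ≤ ori b1 c r → 0 ≤ ori c a3 r → r ∈ [c, a0, a1, a2, a3, b1, b2, b3, b4])
    : False := by
  refine cert_sound' hb [c, a0, a1, a2, a3] [b1, b2, b3, b4] 10 5 rfl rfl [] [[(6, 1), (1, 9)],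
      [(6, 1), (1, 5)]]
    [19, 20, 21, 354, 306, 374, 311, 387, 408, 329, 340, 630, 871,
      920, 1161, 852]
    (.split [7344994, 9442434, 6297397, 3604866, 3539330, 3735937, 8403269, 3539346,
      3604882, 9442356, 8395077, 1275912, 1276168, 1271816, 6371444, 1272072, 6371700]
      2153
  (.split [8788340] 1337
  (.con [9442611, 9450580, 5505424] 4784464)
  (.hole [] 235623 0))
  (.split [8395106, 9835649, 6326537, 6297636, 6310035, 6297925, 6306117, 3414112] 1110
  (.split [6296661, 6304853, 6309252, 6309268, 5636484, 5636500, 3478624, 9442612] 1113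
  (.hole [4724113, 9721477] 284297 1)
  (.hole [] 87187 1))
  (.split [4587861, 4588948, 5505380, 5505428, 9442612] 1334
  (.hole [5509987] 87187 1)
  (.hole [3478624] 87187 1))))
    (by simp [pt]) (by simp [m_c, m_a0, m_a1, m_a2, m_a3]) (by simp [m_b1, m_b2, m_b3, m_b4])
    ⟨h0, h1, h2, h3, h4, h5, h6, h7, h8, h9, h10, rot2 h11, rot2 h12, rot2 h13, rot2 h14, h15,
      trivial⟩ ?_ (by norm_num) (by decide +kernel)
  intro K hK r hr h
  simp only [List.mem_cons, List.not_mem_nil, or_false] at hK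
  rcases hK with rfl | rfl
  · exact List.mem_append.mp (R0 r hr (h (6, 1) (by simp)) (h (1, 9) (by simp)))
  · exact List.mem_append.mp (R1 r hr (h (6, 1) (by simp)) (h (1, 5) (by simp)))

theorem cert_cE1dd {x0 : ℝ} {A B : Finset Pt} (hb : Base x0 A B) (c a0 a1 a2 b1 b2 b3 b4 b5 : Pt)
    (m_c : c ∈ A) (m_a0 : a0 ∈ A) (m_a1 : a1 ∈ A) (m_a2 : a2 ∈ A) (m_b1 : b1 ∈ B) (m_b2 : b2 ∈ B)
      (m_b3 : b3 ∈ B) (m_b4 : b4 ∈ B) (m_b5 : b5 ∈ B)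
    (h0 : c.1 < a1.1)
    (h1 : c.1 < a2.1)
    (h2 : 0 < ori c b1 a0)
    (h3 : 0 < ori c b2 b1)
    (h4 : 0 < ori c a1 b2)
    (h5 : 0 < ori c b3 a1)
    (h6 : 0 < ori c b4 b3)
    (h7 : 0 < ori c a2 b4)
    (h8 : 0 < ori c b5 a2)
    (h9 : 0 < ori b2 b1 a0)
    (h10 : 0 < ori b1 b2 a1)
    (h11 : 0 < ori b4 b3 a1)
    (h12 : 0 < ori b3 b4 a2)
    (R0 : ∀ r ∈ A ∪ B, 0 ≤ ori b1 c r → 0 ≤ ori c b4 r → r ∈ [c, a0, a1, a2, b1, b2, b3, b4, b5])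
    (R1 : ∀ r ∈ A ∪ B, 0 ≤ ori b1 c r → 0 ≤ ori c b5 r → r ∈ [c, a0, a1, a2, b1, b2, b3, b4, b5])
    : False := by
  refine cert_sound' hb [c, a0, a1, a2] [b1, b2, b3, b4, b5] 10 4 rfl rfl [] [[(5, 1), (1, 8)],
      [(5, 1), (1, 9)]]
    [19, 20, 338, 357, 310, 371, 391, 328, 404, 613, 854, 903, 1144]
    (.split [6296402, 8393842, 5248565, 3539314, 3473778, 3670385, 3473794, 3539330,
      8393780, 7346245, 4718994, 4653458, 1271560, 1271816, 1267464, 1345800, 1341704,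
      5322596, 7424388, 1267720, 5322852] 1880
  (.hole [7673956] 231254 0)
  (.hole [7346258, 8721521, 8722801, 5273609, 5248804, 5261187, 5249093, 1415178,
      4528497, 5327220] 300408 1))
    (by simp [pt]) (by simp [m_c, m_a0, m_a1, m_a2]) (by simp [m_b1, m_b2, m_b3, m_b4, m_b5])
    ⟨h0, h1, h2, h3, h4, h5, h6, h7, h8, rot2 h9, rot2 h10, rot2 h11, rot2 h12, trivial⟩ ?_ (by
      norm_num) (by decide +kernel)
  intro K hK r hr h
  simp only [List.mem_cons, List.not_mem_nil, or_false] at hK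
  rcases hK with rfl | rfl
  · exact List.mem_append.mp (R0 r hr (h (5, 1) (by simp)) (h (1, 8) (by simp)))
  · exact List.mem_append.mp (R1 r hr (h (5, 1) (by simp)) (h (1, 9) (by simp)))

theorem cert_cE2du {x0 : ℝ} {A B : Finset Pt} (hb : Base x0 A B) (c a0 a1 a2 a3 b1 b2 b3 b4 : Pt)
    (m_c : c ∈ A) (m_a0 : a0 ∈ A) (m_a1 : a1 ∈ A) (m_a2 : a2 ∈ A) (m_a3 : a3 ∈ A) (m_b1 : b1 ∈ B)
      (m_b2 : b2 ∈ B) (m_b3 : b3 ∈ B) (m_b4 : b4 ∈ B)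
    (h0 : c.1 < a1.1)
    (h1 : c.1 < a2.1)
    (h2 : c.1 < a3.1)
    (h3 : 0 < ori c b2 b1)
    (h4 : 0 < ori c a1 b2)
    (h5 : 0 < ori c b3 a1)
    (h6 : 0 < ori c b4 b3)
    (h7 : 0 < ori c a2 b4)
    (h8 : 0 < ori c a3 a2)
    (h9 : 0 < ori b2 b1 a0)
    (h10 : 0 < ori b1 b2 a1)
    (h11 : 0 < ori b3 b4 a1)
    (h12 : 0 < ori b4 b3 a2)
    (d0 : a1 ≠ a3)
    (R0 : ∀ r ∈ A ∪ B, 0 ≤ ori b1 c r → 0 ≤ ori c b4 r → r ∈ [c, a0, a1, a2, a3, b1, b2, b3, b4])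
    : False := by
  refine cert_sound' hb [c, a0, a1, a2, a3] [b1, b2, b3, b4] 10 5 rfl rfl [(3, 5)] [[(6, 1), (1,
      9)]]
    [19, 20, 21, 374, 311, 387, 408, 329, 340, 630, 871, 905, 1176]
    (.split [7344994, 8395057, 9442179, 6297397, 3604866, 3604882, 3539330, 3539346,
      4784516, 8393780, 1275912, 1276168, 8853809, 1271816, 8788273, 1480714, 6371444,
      6371700] 1336
  (.con [8394035, 8402004, 5505408] 4718928)
  (.hole [] 231783 0))
    (by simp [pt, d0]) (by simp [m_c, m_a0, m_a1, m_a2, m_a3]) (by simp [m_b1, m_b2, m_b3, m_b4])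
    ⟨h0, h1, h2, h3, h4, h5, h6, h7, h8, rot2 h9, rot2 h10, rot2 h11, rot2 h12, trivial⟩ ?_ (by
      norm_num) (by decide +kernel)
  intro K hK r hr h
  simp only [List.mem_cons, List.not_mem_nil, or_false] at hK
  rcases hK with rfl
  · exact List.mem_append.mp (R0 r hr (h (6, 1) (by simp)) (h (1, 9) (by simp)))

theorem cert_cE1du {x0 : ℝ} {A B : Finset Pt} (hb : Base x0 A B) (c a0 a1 a2 b1 b2 b3 b4 b5 : Pt)
    (m_c : c ∈ A) (m_a0 : a0 ∈ A) (m_a1 : a1 ∈ A) (m_a2 : a2 ∈ A) (m_b1 : b1 ∈ B) (m_b2 : b2 ∈ B)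
      (m_b3 : b3 ∈ B) (m_b4 : b4 ∈ B) (m_b5 : b5 ∈ B)
    (h0 : c.1 < a1.1)
    (h1 : c.1 < a2.1)
    (h2 : 0 < ori c b2 b1)
    (h3 : 0 < ori c a1 b2)
    (h4 : 0 < ori c b3 a1)
    (h5 : 0 < ori c b4 b3)
    (h6 : 0 < ori c a2 b4)
    (h7 : 0 < ori c b5 a2)
    (h8 : 0 < ori b2 b1 a0)
    (h9 : 0 < ori b1 b2 a1)
    (h10 : 0 < ori b3 b4 a1)
    (h11 : 0 < ori b4 b3 a2)
    (R0 : ∀ r ∈ A ∪ B, 0 ≤ ori b1 c r → 0 ≤ ori c a2 r → r ∈ [c, a0, a1, a2, b1, b2, b3, b4, b5])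
    (R1 : ∀ r ∈ A ∪ B, 0 ≤ ori b1 c r → 0 ≤ ori c b4 r → r ∈ [c, a0, a1, a2, b1, b2, b3, b4, b5])
    : False := by
  refine cert_sound' hb [c, a0, a1, a2] [b1, b2, b3, b4, b5] 10 4 rfl rfl [] [[(5, 1), (1, 4)],
      [(5, 1), (1, 8)]]
    [19, 20, 357, 310, 371, 391, 328, 404, 613, 854, 888, 1159]
    (.split [6296402, 7346225, 8393587, 5248565, 3539314, 3539330, 3473778, 3473794,
      4718964, 7345204, 4718994, 4653458, 1271560, 1271816, 7739441, 1267464, 7673905,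
      1410826, 1345800, 1341704, 5322596, 5322852] 889
  (.split [7346481, 7674161, 7739697, 9442163, 1414922, 1480458, 1651827, 1652036,
      1652292] 1929
  (.hole [8722801] 227414 0)
  (.hole [] 227414 0))
  (.hole [] 227414 1))
    (by simp [pt]) (by simp [m_c, m_a0, m_a1, m_a2]) (by simp [m_b1, m_b2, m_b3, m_b4, m_b5])
    ⟨h0, h1, h2, h3, h4, h5, h6, h7, rot2 h8, rot2 h9, rot2 h10, rot2 h11, trivial⟩ ?_ (by
      norm_num) (by decide +kernel)
  intro K hK r hr h
  simp only [List.mem_cons, List.not_mem_nil, or_false] at hK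
  rcases hK with rfl | rfl
  · exact List.mem_append.mp (R0 r hr (h (5, 1) (by simp)) (h (1, 4) (by simp)))
  · exact List.mem_append.mp (R1 r hr (h (5, 1) (by simp)) (h (1, 8) (by simp)))

theorem cert_cE2ud {x0 : ℝ} {A B : Finset Pt} (hb : Base x0 A B) (c a0 a1 a2 a3 b1 b2 b3 b4 : Pt)
    (m_c : c ∈ A) (m_a0 : a0 ∈ A) (m_a1 : a1 ∈ A) (m_a2 : a2 ∈ A) (m_a3 : a3 ∈ A) (m_b1 : b1 ∈ B)
      (m_b2 : b2 ∈ B) (m_b3 : b3 ∈ B) (m_b4 : b4 ∈ B)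
    (h0 : c.1 < a1.1)
    (h1 : c.1 < a2.1)
    (h2 : c.1 < a3.1)
    (h3 : 0 < ori c b1 a0)
    (h4 : 0 < ori c a1 a0)
    (h5 : 0 < ori c b2 b1)
    (h6 : 0 < ori c a1 b2)
    (h7 : 0 < ori c b3 a1)
    (h8 : 0 < ori c b4 b3)
    (h9 : 0 < ori c a2 b4)
    (h10 : 0 < ori c a3 a2)
    (h11 : 0 < ori b1 b2 a0)
    (h12 : 0 < ori b2 b1 a1)
    (h13 : 0 < ori b4 b3 a1)
    (h14 : 0 < ori b3 b4 a2)
    (h15 : 0 < ori a1 a3 a2)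
    (d0 : a0 ≠ a3)
    (R0 : ∀ r ∈ A ∪ B, 0 ≤ ori a0 c r → 0 ≤ ori c b4 r → r ∈ [c, a0, a1, a2, a3, b1, b2, b3, b4])
    (R1 : ∀ r ∈ A ∪ B, 0 ≤ ori b1 c r → 0 ≤ ori c a2 r → r ∈ [c, a0, a1, a2, a3, b1, b2, b3, b4])
    (R2 : ∀ r ∈ A ∪ B, 0 ≤ ori b1 c r → 0 ≤ ori c a3 r → r ∈ [c, a0, a1, a2, a3, b1, b2, b3, b4])
    : False := by
  refine cert_sound' hb [c, a0, a1, a2, a3] [b1, b2, b3, b4] 10 5 rfl rfl [(2, 5)] [[(2, 1), (1,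
      9)], [(6, 1), (1, 4)], [(6, 1), (1, 5)]]
    [19, 20, 21, 354, 306, 374, 311, 387, 408, 329, 340, 615, 886,
      920, 1161, 852]
    (.split [6297377, 7344739, 9442434, 3604836, 6296356, 3604866, 3539330, 3735937,
      8403269, 3539346, 3604882, 9442356, 8395077, 1275912, 1276168, 1271816, 1272072]
      1078
  (.hole [3442187, 4718948, 4719459, 4723555, 4396388, 4587861, 79171, 5505380,
      6305091, 5505332] 87094 2)
  (.split [3414112, 3609697, 6296389, 6300485, 1274888, 7353444] 121
  (.split [92053, 96645, 9442420, 92549, 9442404, 8395124, 8395108] 1657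
  (.split [6388101, 6750868, 7477601, 6750852, 7477345, 9441891, 9446981, 9586785,
      8393315] 1318
  (.con [6296867, 6300756, 5505376] 4587856)
  (.hole [] 157592 0))
  (.hole [] 215414 1))
  (.split [7346468, 7346532] 1865
  (.hole [9901156] 215414 1)
  (.split [] 1335
  (.hole [7353428, 7354708, 4653397, 4654436, 4654484, 5505396, 5510003, 5511539,
      9901364, 5505380] 87187 2)
  (.split [3478640, 7344981, 7353700, 3230036, 5701988] 1305
  (.con [5511473] 9442384)
  (.split [] 1113
  (.split [4658577, 4724113, 7357844, 8393813, 8406420] 1864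
  (.split [7424148] 1400
  (.hole [8394098, 7346276, 8853860] 235638 1)
  (.hole [] 284793 2))
  (.split [7423364, 8393842, 7346212, 7346276] 2169
  (.hole [8853860] 235638 1)
  (.hole [] 284553 2)))
  (.hole [] 87187 2)))))))
    (by simp [pt, d0]) (by simp [m_c, m_a0, m_a1, m_a2, m_a3]) (by simp [m_b1, m_b2, m_b3, m_b4])
    ⟨h0, h1, h2, h3, h4, h5, h6, h7, h8, h9, h10, rot2 h11, rot2 h12, rot2 h13, rot2 h14, h15,
      trivial⟩ ?_ (by norm_num) (by decide +kernel)
  intro K hK r hr h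
  simp only [List.mem_cons, List.not_mem_nil, or_false] at hK
  rcases hK with rfl | rfl | rfl
  · exact List.mem_append.mp (R0 r hr (h (2, 1) (by simp)) (h (1, 9) (by simp)))
  · exact List.mem_append.mp (R1 r hr (h (6, 1) (by simp)) (h (1, 4) (by simp)))
  · exact List.mem_append.mp (R2 r hr (h (6, 1) (by simp)) (h (1, 5) (by simp)))

theorem cert_cE1ud {x0 : ℝ} {A B : Finset Pt} (hb : Base x0 A B) (c a0 a1 a2 b1 b2 b3 b4 b5 : Pt)
    (m_c : c ∈ A) (m_a0 : a0 ∈ A) (m_a1 : a1 ∈ A) (m_a2 : a2 ∈ A) (m_b1 : b1 ∈ B) (m_b2 : b2 ∈ B)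
      (m_b3 : b3 ∈ B) (m_b4 : b4 ∈ B) (m_b5 : b5 ∈ B)
    (h0 : c.1 < a1.1)
    (h1 : c.1 < a2.1)
    (h2 : 0 < ori c b1 a0)
    (h3 : 0 < ori c b2 b1)
    (h4 : 0 < ori c a1 b2)
    (h5 : 0 < ori c b3 a1)
    (h6 : 0 < ori c b4 b3)
    (h7 : 0 < ori c a2 b4)
    (h8 : 0 < ori c b5 a2)
    (h9 : 0 < ori b1 b2 a0)
    (h10 : 0 < ori b2 b1 a1)
    (h11 : 0 < ori b4 b3 a1)
    (h12 : 0 < ori b3 b4 a2)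
    (h13 : 0 < ori a2 b1 a1)
    (R0 : ∀ r ∈ A ∪ B, 0 ≤ ori a0 c r → 0 ≤ ori c a2 r → r ∈ [c, a0, a1, a2, b1, b2, b3, b4, b5])
    (R1 : ∀ r ∈ A ∪ B, 0 ≤ ori a0 c r → 0 ≤ ori c b4 r → r ∈ [c, a0, a1, a2, b1, b2, b3, b4, b5])
    (R2 : ∀ r ∈ A ∪ B, 0 ≤ ori a0 c r → 0 ≤ ori c b5 r → r ∈ [c, a0, a1, a2, b1, b2, b3, b4, b5])
    (R3 : ∀ r ∈ A ∪ B, 0 ≤ ori b1 c r → 0 ≤ ori c a2 r → r ∈ [c, a0, a1, a2, b1, b2, b3, b4, b5])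
    (R4 : ∀ r ∈ A ∪ B, 0 ≤ ori b1 c r → 0 ≤ ori c b5 r → r ∈ [c, a0, a1, a2, b1, b2, b3, b4, b5])
    : False := by
  refine cert_sound' hb [c, a0, a1, a2] [b1, b2, b3, b4, b5] 10 4 rfl rfl [] [[(2, 1), (1, 4)],
      [(2, 1), (1, 8)], [(2, 1), (1, 9)], [(5, 1), (1, 4)], [(5, 1), (1, 9)]]
    [19, 20, 338, 357, 310, 371, 391, 328, 404, 598, 869, 903, 1144,
      837]
    (.split [5248545, 6296147, 8393842, 3539284, 5247780, 5247813, 5251909, 3539314,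
      3473778, 3670385, 7354437, 3473794, 3539330, 8393780, 4522386, 7346245, 4718994,
      4653458, 1271560, 1271816, 3413840, 1267464, 1333363, 1345800, 1333512, 1341704,
      3544145, 6304852, 6624069, 7424388, 4594001, 1337608] 1127
  (.split [4810629, 6375796, 7345250, 6375812, 8393826, 6297380, 6297428, 6297684] 1896
  (.hole [7739476] 231269 3)
  (.hole [] 300664 4))
  (.split [4806499] 1656
  (.con [6375301] 8787056)
  (.split [] 1623
  (.hole [7739476, 5335155] 231269 3)
  (.split [6297425, 6428497, 87669, 7344739, 7349893, 7362181, 2184821] 1608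
  (.split [4675683] 1384
  (.split [5638259, 5646451, 6428753, 8393299] 292
  (.hole [1647696, 1217803] 153223 1)
  (.hole [] 153223 0))
  (.hole [] 215141 3))
  (.split [6375812, 6834002] 1657
  (.hole [7346529, 7477601, 7674209, 9441907, 2185109, 2189205, 5334933] 153209 2)
  (.hole [] 300904 4))))))
    (by simp [pt]) (by simp [m_c, m_a0, m_a1, m_a2]) (by simp [m_b1, m_b2, m_b3, m_b4, m_b5])
    ⟨h0, h1, h2, h3, h4, h5, h6, h7, h8, rot2 h9, rot2 h10, rot2 h11, rot2 h12, rot2 h13, trivial⟩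
      ?_ (by norm_num) (by decide +kernel)
  intro K hK r hr h
  simp only [List.mem_cons, List.not_mem_nil, or_false] at hK
  rcases hK with rfl | rfl | rfl | rfl | rfl
  · exact List.mem_append.mp (R0 r hr (h (2, 1) (by simp)) (h (1, 4) (by simp)))
  · exact List.mem_append.mp (R1 r hr (h (2, 1) (by simp)) (h (1, 8) (by simp)))
  · exact List.mem_append.mp (R2 r hr (h (2, 1) (by simp)) (h (1, 9) (by simp)))
  · exact List.mem_append.mp (R3 r hr (h (5, 1) (by simp)) (h (1, 4) (by simp)))
  · exact List.mem_append.mp (R4 r hr (h (5, 1) (by simp)) (h (1, 9) (by simp)))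

theorem cert_cE2uu {x0 : ℝ} {A B : Finset Pt} (hb : Base x0 A B) (c a0 a1 a2 a3 b1 b2 b3 b4 : Pt)
    (m_c : c ∈ A) (m_a0 : a0 ∈ A) (m_a1 : a1 ∈ A) (m_a2 : a2 ∈ A) (m_a3 : a3 ∈ A) (m_b1 : b1 ∈ B)
      (m_b2 : b2 ∈ B) (m_b3 : b3 ∈ B) (m_b4 : b4 ∈ B)
    (h0 : c.1 < a1.1)
    (h1 : c.1 < a2.1)
    (h2 : c.1 < a3.1)
    (h3 : 0 < ori c b1 a0)
    (h4 : 0 < ori c a1 a0)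
    (h5 : 0 < ori c b2 b1)
    (h6 : 0 < ori c a1 b2)
    (h7 : 0 < ori c b3 a1)
    (h8 : 0 < ori c b4 b3)
    (h9 : 0 < ori c a2 b4)
    (h10 : 0 < ori c a3 a2)
    (h11 : 0 < ori b1 b2 a0)
    (h12 : 0 < ori b2 b1 a1)
    (h13 : 0 < ori b3 b4 a1)
    (h14 : 0 < ori b4 b3 a2)
    (h15 : 0 < ori a1 a3 a2)
    (R0 : ∀ r ∈ A ∪ B, 0 ≤ ori a0 c r → 0 ≤ ori c b4 r → r ∈ [c, a0, a1, a2, a3, b1, b2, b3, b4])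
    (R1 : ∀ r ∈ A ∪ B, 0 ≤ ori a0 c r → 0 ≤ ori c a3 r → r ∈ [c, a0, a1, a2, a3, b1, b2, b3, b4])
    (R2 : ∀ r ∈ A ∪ B, 0 ≤ ori b1 c r → 0 ≤ ori c a2 r → r ∈ [c, a0, a1, a2, a3, b1, b2, b3, b4])
    (R3 : ∀ r ∈ A ∪ B, 0 ≤ ori b1 c r → 0 ≤ ori c b4 r → r ∈ [c, a0, a1, a2, a3, b1, b2, b3, b4])
    (R4 : ∀ r ∈ A ∪ B, 0 ≤ ori b1 c r → 0 ≤ ori c a3 r → r ∈ [c, a0, a1, a2, a3, b1, b2, b3, b4])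
    : False := by
  refine cert_sound' hb [c, a0, a1, a2, a3] [b1, b2, b3, b4] 10 5 rfl rfl [] [[(2, 1), (1, 9)],
      [(2, 1), (1, 5)], [(6, 1), (1, 4)], [(6, 1), (1, 9)], [(6, 1), (1, 5)]]
    [19, 20, 21, 354, 306, 374, 311, 387, 408, 329, 340, 615, 886,
      905, 1176, 852]
    (.split [6297377, 7344739, 8395057, 9442179, 9442356, 3604836, 6296356, 3604866,
      3604882, 3539330, 3539346, 4784516, 8393780, 1275912, 1276168, 8853809, 1271816,
      8788273, 1480714] 1897
  (.split [6387859] 1336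
  (.con [8394035, 8402004, 5505408] 4718928)
  (.hole [] 231798 3))
  (.split [7346529, 7477601, 92053, 9441907, 9442420, 9447301, 9455219, 2189205,
      6751377, 1648691, 4784500, 4784484, 6296612] 1353
  (.hole [4784469, 4785508, 4785540, 5505428, 5505380, 5505412, 8472916] 87192 4)
  (.split [9442389, 9450581, 9454948, 9454964, 9454980, 5833060, 5833076, 5833092,
      6751633, 6296868, 8394036] 1335
  (.split [5837683, 5846885] 293
  (.hole [] 86902 4)
  (.hole [] 86902 1))
  (.split [3479664, 3491957, 1389699] 1112
  (.split [] 1400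
  (.split [5851011, 7887202] 1864
  (.split [4810867] 1078
  (.hole [3491682, 4396388] 87094 4)
  (.hole [] 215158 2))
  (.hole [] 285048 4))
  (.split [5859443, 8673650, 8673634] 1832
  (.split [7477348] 1078
  (.hole [3491682, 4396388] 87094 4)
  (.hole [] 215158 2))
  (.split [2189189] 1896
  (.split [] 1078
  (.hole [3491682, 4396388] 87094 4)
  (.hole [] 215158 2))
  (.hole [] 157577 0))))
  (.hole [] 87171 4)))))
    (by simp [pt]) (by simp [m_c, m_a0, m_a1, m_a2, m_a3]) (by simp [m_b1, m_b2, m_b3, m_b4])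
    ⟨h0, h1, h2, h3, h4, h5, h6, h7, h8, h9, h10, rot2 h11, rot2 h12, rot2 h13, rot2 h14, h15,
      trivial⟩ ?_ (by norm_num) (by decide +kernel)
  intro K hK r hr h
  simp only [List.mem_cons, List.not_mem_nil, or_false] at hK
  rcases hK with rfl | rfl | rfl | rfl | rfl
  · exact List.mem_append.mp (R0 r hr (h (2, 1) (by simp)) (h (1, 9) (by simp)))
  · exact List.mem_append.mp (R1 r hr (h (2, 1) (by simp)) (h (1, 5) (by simp)))
  · exact List.mem_append.mp (R2 r hr (h (6, 1) (by simp)) (h (1, 4) (by simp)))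
  · exact List.mem_append.mp (R3 r hr (h (6, 1) (by simp)) (h (1, 9) (by simp)))
  · exact List.mem_append.mp (R4 r hr (h (6, 1) (by simp)) (h (1, 5) (by simp)))

theorem cert_cE1uu {x0 : ℝ} {A B : Finset Pt} (hb : Base x0 A B) (c a0 a1 a2 b1 b2 b3 b4 b5 : Pt)
    (m_c : c ∈ A) (m_a0 : a0 ∈ A) (m_a1 : a1 ∈ A) (m_a2 : a2 ∈ A) (m_b1 : b1 ∈ B) (m_b2 : b2 ∈ B)
      (m_b3 : b3 ∈ B) (m_b4 : b4 ∈ B) (m_b5 : b5 ∈ B)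
    (h0 : c.1 < a1.1)
    (h1 : c.1 < a2.1)
    (h2 : 0 < ori c b1 a0)
    (h3 : 0 < ori c b2 b1)
    (h4 : 0 < ori c a1 b2)
    (h5 : 0 < ori c b3 a1)
    (h6 : 0 < ori c b4 b3)
    (h7 : 0 < ori c a2 b4)
    (h8 : 0 < ori c b5 a2)
    (h9 : 0 < ori b1 b2 a0)
    (h10 : 0 < ori b2 b1 a1)
    (h11 : 0 < ori b3 b4 a1)
    (h12 : 0 < ori b4 b3 a2)
    (h13 : 0 < ori a2 b1 a1)
    (R0 : ∀ r ∈ A ∪ B, 0 ≤ ori a0 c r → 0 ≤ ori c a2 r → r ∈ [c, a0, a1, a2, b1, b2, b3, b4, b5])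
    (R1 : ∀ r ∈ A ∪ B, 0 ≤ ori a0 c r → 0 ≤ ori c b4 r → r ∈ [c, a0, a1, a2, b1, b2, b3, b4, b5])
    (R2 : ∀ r ∈ A ∪ B, 0 ≤ ori a0 c r → 0 ≤ ori c b5 r → r ∈ [c, a0, a1, a2, b1, b2, b3, b4, b5])
    (R3 : ∀ r ∈ A ∪ B, 0 ≤ ori b1 c r → 0 ≤ ori c a2 r → r ∈ [c, a0, a1, a2, b1, b2, b3, b4, b5])
    (R4 : ∀ r ∈ A ∪ B, 0 ≤ ori b1 c r → 0 ≤ ori c b5 r → r ∈ [c, a0, a1, a2, b1, b2, b3, b4, b5])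
    : False := by
  refine cert_sound' hb [c, a0, a1, a2] [b1, b2, b3, b4, b5] 10 4 rfl rfl [] [[(2, 1), (1, 4)],
      [(2, 1), (1, 8)], [(2, 1), (1, 9)], [(5, 1), (1, 4)], [(5, 1), (1, 9)]]
    [19, 20, 338, 357, 310, 371, 391, 328, 404, 598, 869, 888, 1159,
      837]
    (.split [5248545, 6296147, 7346225, 8393587, 3539284, 5247780, 5247813, 5251909,
      3539314, 3539330, 3473778, 3473794, 4522386, 4718964, 7345204, 4718994, 4653458,
      1271560, 1271816, 3413840, 7739441, 1267464, 1333363, 7673905, 1345800, 1333512,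
      1341704, 3544145, 6304852, 6624069, 4594001, 1337608] 1607
  (.split [4806499] 1383
  (.split [5334917, 6297425, 6428497, 6297681, 6428753, 7344739, 2184821, 7477345,
      8393315, 2184837] 601
  (.split [5249313, 9441875, 1647699] 1929
  (.hole [8526193] 153208 0)
  (.hole [] 153208 0))
  (.hole [] 153208 1))
  (.hole [] 214885 3))
  (.split [6375796, 7345250, 6297428] 2153
  (.split [6375813, 8788340] 1384
  (.hole [6428753] 301159 4)
  (.hole [] 227429 3))
  (.split [] 1384
  (.hole [5326469, 6297681, 6428753, 8722785, 5531797, 87685, 8393315, 8395105,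
      2184837, 8526177, 6429009, 88213, 5767828, 1218570] 153225 2)
  (.hole [] 227429 3))))
    (by simp [pt]) (by simp [m_c, m_a0, m_a1, m_a2]) (by simp [m_b1, m_b2, m_b3, m_b4, m_b5])
    ⟨h0, h1, h2, h3, h4, h5, h6, h7, h8, rot2 h9, rot2 h10, rot2 h11, rot2 h12, rot2 h13, trivial⟩
      ?_ (by norm_num) (by decide +kernel)
  intro K hK r hr h
  simp only [List.mem_cons, List.not_mem_nil, or_false] at hK
  rcases hK with rfl | rfl | rfl | rfl | rfl
  · exact List.mem_append.mp (R0 r hr (h (2, 1) (by simp)) (h (1, 4) (by simp)))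
  · exact List.mem_append.mp (R1 r hr (h (2, 1) (by simp)) (h (1, 8) (by simp)))
  · exact List.mem_append.mp (R2 r hr (h (2, 1) (by simp)) (h (1, 9) (by simp)))
  · exact List.mem_append.mp (R3 r hr (h (5, 1) (by simp)) (h (1, 4) (by simp)))
  · exact List.mem_append.mp (R4 r hr (h (5, 1) (by simp)) (h (1, 9) (by simp)))

theorem cert_cR1ud {x0 : ℝ} {A B : Finset Pt} (hb : Base x0 A B) (c a0 a1 a2 b1 b2 b3 b4 p q : Pt)
    (m_c : c ∈ A) (m_a0 : a0 ∈ A) (m_a1 : a1 ∈ A) (m_a2 : a2 ∈ A) (m_b1 : b1 ∈ B) (m_b2 : b2 ∈ B)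
      (m_b3 : b3 ∈ B) (m_b4 : b4 ∈ B) (m_p : p ∈ B) (m_q : q ∈ B)
    (h0 : c.1 < a1.1)
    (h1 : c.1 < a2.1)
    (h2 : 0 < ori c b1 a0)
    (h3 : 0 < ori c a1 a0)
    (h4 : 0 < ori c b2 b1)
    (h5 : 0 < ori c a1 b2)
    (h6 : 0 < ori c b3 a1)
    (h7 : 0 < ori c b4 b3)
    (h8 : 0 < ori c a2 b4)
    (h9 : 0 < ori c p a2)
    (h10 : 0 < ori c q p)
    (h11 : 0 < ori b1 b2 a0)
    (h12 : 0 < ori b2 b1 a1)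
    (h13 : 0 < ori b4 b3 a1)
    (h14 : 0 < ori b3 b4 a2)
    (h15 : 0 < ori c a0 a2)
    (h16 : 0 < ori b1 a2 a1)
    (h17 : 0 < ori p q a2)
    (d0 : b2 ≠ b3)
    (R0 : ∀ r ∈ A ∪ B, 0 ≤ ori b1 c r → 0 ≤ ori c a2 r → r ∈ [c, a0, a1, a2, b1, b2, b3, b4, p, q])
    (R1 : ∀ r ∈ A ∪ B, 0 ≤ ori b1 c r → 0 ≤ ori c q r → r ∈ [c, a0, a1, a2, b1, b2, b3, b4, p, q])
    : False := by
  refine cert_sound' hb [c, a0, a1, a2] [b1, b2, b3, b4, p, q] 11 4 rfl rfl [(6, 7)] [[(5, 1), (1,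
      4)], [(5, 1), (1, 10)]]
    [19, 20, 338, 306, 357, 310, 371, 391, 328, 404, 425, 598, 869,
      903, 1144, 292, 852, 1178]
    (.split [5248545, 6296147, 6296356, 8393842, 9443905, 10491027, 3539284, 5247780,
      3473778, 3670385, 7354437, 3473794, 3539330, 8393780, 7346245, 4718994, 4719010,
      4653458, 4653474, 1267464, 1345800, 1346056, 9968193, 1341704, 9902657, 1550602,
      7424388, 7424644, 3437835, 3441931, 1267720, 4653907, 8729714, 4718900, 4653396,
      4391314, 4391330, 3478564, 4391205, 4395604, 1283082, 1287178, 1451089, 4522386,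
      4522402, 5322308, 1333512, 1333768, 3474578, 9640513, 3474594, 2360147, 2381321,
      1647664, 1714480, 3539346, 9441844, 9638468, 9771569, 1272072, 3539362, 10490420,
      10687044, 1272328, 4587922, 4587938, 9837105, 2386184, 2386440, 6437204, 6437460]
      838
  (.split [] 1898
  (.split [] 1674
  (.split [] 2105
  (.split [] 906
  (.hole [3670689, 8722993, 5335203] 232037 1)
  (.hole [] 215464 1))
  (.hole [] 236133 1))
  (.hole [] 215462 1))
  (.hole [] 301688 1))
  (.hole [] 82789 0))
    (by simp [pt, d0]) (by simp [m_c, m_a0, m_a1, m_a2]) (by simp [m_b1, m_b2, m_b3, m_b4, m_p,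
      m_q])
    ⟨h0, h1, h2, h3, h4, h5, h6, h7, h8, h9, h10, rot2 h11, rot2 h12, rot2 h13, rot2 h14, h15,
      rot2 h16, rot2 h17, trivial⟩ ?_ (by norm_num) (by decide +kernel)
  intro K hK r hr h
  simp only [List.mem_cons, List.not_mem_nil, or_false] at hK
  rcases hK with rfl | rfl
  · exact List.mem_append.mp (R0 r hr (h (5, 1) (by simp)) (h (1, 4) (by simp)))
  · exact List.mem_append.mp (R1 r hr (h (5, 1) (by simp)) (h (1, 10) (by simp)))

theorem cert_cR2ud {x0 : ℝ} {A B : Finset Pt} (hb : Base x0 A B) (c a0 a1 a2 b1 b2 b3 b4 p q : Pt)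
    (m_c : c ∈ A) (m_a0 : a0 ∈ A) (m_a1 : a1 ∈ A) (m_a2 : a2 ∈ A) (m_b1 : b1 ∈ B) (m_b2 : b2 ∈ B)
      (m_b3 : b3 ∈ B) (m_b4 : b4 ∈ B) (m_p : p ∈ B) (m_q : q ∈ B)
    (h0 : c.1 < a1.1)
    (h1 : c.1 < a2.1)
    (h2 : 0 < ori c b1 a0)
    (h3 : 0 < ori c a1 a0)
    (h4 : 0 < ori c b2 b1)
    (h5 : 0 < ori c a1 b2)
    (h6 : 0 < ori c b3 a1)
    (h7 : 0 < ori c b4 b3)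
    (h8 : 0 < ori c a2 b4)
    (h9 : 0 < ori c p a2)
    (h10 : 0 < ori c q p)
    (h11 : 0 < ori b1 b2 a0)
    (h12 : 0 < ori b2 b1 a1)
    (h13 : 0 < ori b4 b3 a1)
    (h14 : 0 < ori b3 b4 a2)
    (h15 : 0 < ori c a0 a2)
    (h16 : 0 < ori b1 a2 a1)
    (h17 : 0 < ori q p a2)
    (h18 : 0 < ori p q a0)
    (d0 : b2 ≠ b3)
    (R0 : ∀ r ∈ A ∪ B, 0 ≤ ori b1 c r → 0 ≤ ori c q r → 0 ≤ ori q p r → r ∈ [c, a0, a1, a2, b1,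
      b2, b3, b4, p, q])
    : False := by
  refine cert_sound' hb [c, a0, a1, a2] [b1, b2, b3, b4, p, q] 11 4 rfl rfl [(6, 7)] [[(5, 1), (1,
      10), (10, 9)]]
    [19, 20, 338, 306, 357, 310, 371, 391, 328, 404, 425, 598, 869,
      903, 1144, 292, 852, 1193, 666]
    (.split [5248545, 6296147, 8393842, 3539284, 5247780, 3473778, 3670385, 7354437,
      3473794, 3539330, 8393780, 7346245, 4718994, 4653458, 4850065, 4653474, 4719010,
      1267464, 1345800, 1346056, 1341704, 7424388, 3437835, 3441931, 1267720, 4653907,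
      8729714, 4718900, 4653396, 1341960, 4391330, 4522402, 10490691, 1333768, 4864371,
      4872563, 7424644, 1726835, 1718659, 3474578, 3474594, 1647664, 1713200, 3478564,
      4391205, 4395604, 1451089, 5322308, 4594257, 3539362, 10490420, 10687044, 10687122,
      1272328, 1221899, 4594001, 1452369, 3539346, 9441844, 10823985, 1218059, 2692772,
      2758212, 10883730, 2360147, 6441300, 6441556] 838
  (.split [] 1897
  (.split [] 2442
  (.split [] 1673
  (.split [] 2106
  (.split [] 905
  (.hole [3670673, 8722737, 5335187] 231781 0)
  (.hole [] 215704 0))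
  (.hole [] 239973 0))
  (.hole [] 215702 0))
  (.hole [] 215702 0))
  (.hole [9837172, 9902724] 305528 0))
  (.hole [] 82789 0))
    (by simp [pt, d0]) (by simp [m_c, m_a0, m_a1, m_a2]) (by simp [m_b1, m_b2, m_b3, m_b4, m_p,
      m_q])
    ⟨h0, h1, h2, h3, h4, h5, h6, h7, h8, h9, h10, rot2 h11, rot2 h12, rot2 h13, rot2 h14, h15,
      rot2 h16, rot2 h17, rot2 h18, trivial⟩ ?_ (by norm_num) (by decide +kernel)
  intro K hK r hr h
  simp only [List.mem_cons, List.not_mem_nil, or_false] at hK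
  rcases hK with rfl
  · exact List.mem_append.mp (R0 r hr (h (5, 1) (by simp)) (h (1, 10) (by simp)) (h (10, 9) (by
      simp)))

theorem cert_cR1uu {x0 : ℝ} {A B : Finset Pt} (hb : Base x0 A B) (c a0 a1 a2 b1 b2 b3 b4 p q : Pt)
    (m_c : c ∈ A) (m_a0 : a0 ∈ A) (m_a1 : a1 ∈ A) (m_a2 : a2 ∈ A) (m_b1 : b1 ∈ B) (m_b2 : b2 ∈ B)
      (m_b3 : b3 ∈ B) (m_b4 : b4 ∈ B) (m_p : p ∈ B) (m_q : q ∈ B)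
    (h0 : c.1 < a1.1)
    (h1 : c.1 < a2.1)
    (h2 : 0 < ori c b1 a0)
    (h3 : 0 < ori c a1 a0)
    (h4 : 0 < ori c b2 b1)
    (h5 : 0 < ori c a1 b2)
    (h6 : 0 < ori c b3 a1)
    (h7 : 0 < ori c b4 b3)
    (h8 : 0 < ori c a2 b4)
    (h9 : 0 < ori c p a2)
    (h10 : 0 < ori c q p)
    (h11 : 0 < ori b1 b2 a0)
    (h12 : 0 < ori b2 b1 a1)
    (h13 : 0 < ori b3 b4 a1)
    (h14 : 0 < ori b4 b3 a2)
    (h15 : 0 < ori c a0 a2)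
    (h16 : 0 < ori b1 a2 a1)
    (h17 : 0 < ori p q a2)
    (R0 : ∀ r ∈ A ∪ B, 0 ≤ ori b1 c r → 0 ≤ ori c a2 r → r ∈ [c, a0, a1, a2, b1, b2, b3, b4, p, q])
    (R1 : ∀ r ∈ A ∪ B, 0 ≤ ori b1 c r → 0 ≤ ori c q r → r ∈ [c, a0, a1, a2, b1, b2, b3, b4, p, q])
    : False := by
  refine cert_sound' hb [c, a0, a1, a2] [b1, b2, b3, b4, p, q] 11 4 rfl rfl [] [[(5, 1), (1, 4)],
      [(5, 1), (1, 10)]]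
    [19, 20, 338, 306, 357, 310, 371, 391, 328, 404, 425, 598, 869,
      888, 1159, 292, 852, 1178]
    (.split [5248545, 6296147, 6296356, 7346225, 8393587, 8393780, 9443905, 10491027,
      3539284, 5247780, 3539314, 3539330, 3473778, 3473794, 4718964, 7345204, 4718994,
      4719010, 4653458, 4653474, 1271560, 1271816, 7739441, 1267464, 7673905, 1410826,
      1345800, 1346056, 9968193, 1341704, 9902657, 1550602, 3437835, 3441931, 4719443,
      4653364, 4653396, 4391314, 4391330, 3478564, 4391205, 4395604, 1283082, 1287178,
      1451089, 4522386, 4522402, 5322308, 1333512, 1333768, 2360147, 2381321, 1647664,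
      1714480, 9441844, 9638468, 3539362, 10490420, 10687044, 4587938, 2386440, 6437460]
      2170
  (.hole [7440803] 301703 1)
  (.split [8591985, 8723057, 8788593, 3242149, 5335203, 3605153, 5334915] 1929
  (.hole [8788337] 227429 0)
  (.hole [] 227429 0)))
    (by simp [pt]) (by simp [m_c, m_a0, m_a1, m_a2]) (by simp [m_b1, m_b2, m_b3, m_b4, m_p, m_q])
    ⟨h0, h1, h2, h3, h4, h5, h6, h7, h8, h9, h10, rot2 h11, rot2 h12, rot2 h13, rot2 h14, h15,
      rot2 h16, rot2 h17, trivial⟩ ?_ (by norm_num) (by decide +kernel)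
  intro K hK r hr h
  simp only [List.mem_cons, List.not_mem_nil, or_false] at hK
  rcases hK with rfl | rfl
  · exact List.mem_append.mp (R0 r hr (h (5, 1) (by simp)) (h (1, 4) (by simp)))
  · exact List.mem_append.mp (R1 r hr (h (5, 1) (by simp)) (h (1, 10) (by simp)))

theorem cert_cR2uu {x0 : ℝ} {A B : Finset Pt} (hb : Base x0 A B) (c a0 a1 a2 b1 b2 b3 b4 p q : Pt)
    (m_c : c ∈ A) (m_a0 : a0 ∈ A) (m_a1 : a1 ∈ A) (m_a2 : a2 ∈ A) (m_b1 : b1 ∈ B) (m_b2 : b2 ∈ B)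
      (m_b3 : b3 ∈ B) (m_b4 : b4 ∈ B) (m_p : p ∈ B) (m_q : q ∈ B)
    (h0 : c.1 < a1.1)
    (h1 : c.1 < a2.1)
    (h2 : 0 < ori c b1 a0)
    (h3 : 0 < ori c a1 a0)
    (h4 : 0 < ori c b2 b1)
    (h5 : 0 < ori c a1 b2)
    (h6 : 0 < ori c b3 a1)
    (h7 : 0 < ori c b4 b3)
    (h8 : 0 < ori c a2 b4)
    (h9 : 0 < ori c p a2)
    (h10 : 0 < ori c q p)
    (h11 : 0 < ori b1 b2 a0)
    (h12 : 0 < ori b2 b1 a1)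
    (h13 : 0 < ori b3 b4 a1)
    (h14 : 0 < ori b4 b3 a2)
    (h15 : 0 < ori c a0 a2)
    (h16 : 0 < ori b1 a2 a1)
    (h17 : 0 < ori q p a2)
    (h18 : 0 < ori p q a0)
    (R0 : ∀ r ∈ A ∪ B, 0 ≤ ori b1 c r → 0 ≤ ori c q r → 0 ≤ ori q p r → r ∈ [c, a0, a1, a2, b1,
      b2, b3, b4, p, q])
    : False := by
  refine cert_sound' hb [c, a0, a1, a2] [b1, b2, b3, b4, p, q] 11 4 rfl rfl [] [[(5, 1), (1, 10),
      (10, 9)]]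
    [19, 20, 338, 306, 357, 310, 371, 391, 328, 404, 425, 598, 869,
      888, 1159, 292, 852, 1193, 666]
    (.split [5248545, 6296147, 7346225, 8393587, 8393780, 3539284, 5247780, 3539314,
      3539330, 3473778, 3473794, 4718964, 7345204, 4718994, 4653458, 4850065, 4653474,
      4719010, 1271560, 1271816, 7739441, 1267464, 7673905, 1410826, 1345800, 1346056,
      1341704, 3437835, 3441931, 4719443, 4653364, 4653396, 1341960, 4391330, 4522402,
      10490691, 1333768, 4864371, 4872563, 1726835, 1718659, 3474578, 3474594, 1647664,
      1713200, 3478564, 4391205, 4395604, 1451089, 5322308, 4594257, 3539362, 10490420,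
      10687044, 10687122, 1272328, 1221899, 4594001, 1452369, 3539346, 9441844, 10823985,
      1218059, 2692772, 2758212, 10883730, 2360147, 6441300] 838
  (.split [] 889
  (.split [3605137, 7674161, 7739697, 9640564, 5334931] 2169
  (.split [7441043] 1673
  (.split [9837188] 1384
  (.con [5335188] 8722784)
  (.hole [] 227429 0))
  (.hole [] 227685 0))
  (.hole [] 227685 0))
  (.split [3242132, 3242643, 8591732] 2426
  (.hole [] 215703 0)
  (.hole [9968241] 215702 0)))
  (.hole [] 82789 0))
    (by simp [pt]) (by simp [m_c, m_a0, m_a1, m_a2]) (by simp [m_b1, m_b2, m_b3, m_b4, m_p, m_q])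
    ⟨h0, h1, h2, h3, h4, h5, h6, h7, h8, h9, h10, rot2 h11, rot2 h12, rot2 h13, rot2 h14, h15,
      rot2 h16, rot2 h17, rot2 h18, trivial⟩ ?_ (by norm_num) (by decide +kernel)
  intro K hK r hr h
  simp only [List.mem_cons, List.not_mem_nil, or_false] at hK
  rcases hK with rfl
  · exact List.mem_append.mp (R0 r hr (h (5, 1) (by simp)) (h (1, 10) (by simp)) (h (10, 9) (by
      simp)))

theorem cert_cY {x0 : ℝ} {A B : Finset Pt} (hb : Base x0 A B) (c a0 a1 a2 b1 b2 b3 b4 : Pt)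
    (m_c : c ∈ A) (m_a0 : a0 ∈ A) (m_a1 : a1 ∈ A) (m_a2 : a2 ∈ A) (m_b1 : b1 ∈ B) (m_b2 : b2 ∈ B)
      (m_b3 : b3 ∈ B) (m_b4 : b4 ∈ B)
    (h0 : c.1 < a1.1)
    (h1 : c.1 < a2.1)
    (h2 : 0 < ori c b1 a0)
    (h3 : 0 < ori c a1 a0)
    (h4 : 0 < ori c a2 a0)
    (h5 : 0 < ori c a1 b2)
    (h6 : 0 < ori c b3 a1)
    (h7 : 0 < ori c b4 b3)
    (h8 : 0 < ori c a2 b4)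
    (h9 : 0 < ori b2 b1 a1)
    (h10 : 0 < ori b1 a2 a1)
    (R0 : ∀ r ∈ A ∪ B, 0 ≤ ori a0 c r → 0 ≤ ori c a2 r → r ∈ [c, a0, a1, a2, b1, b2, b3, b4])
    : False := by
  refine cert_sound' hb [c, a0, a1, a2] [b1, b2, b3, b4] 9 4 rfl rfl [] [[(2, 1), (1, 4)]]
    [19, 20, 338, 306, 322, 310, 371, 391, 328, 869, 852]
    (.split [3539284, 5247780, 3473778] 792
  (.hole [3473794, 8393780, 3441931, 4718932, 4723539, 5248036, 3478564] 82770 0)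
  (.con [3670386] 1279752))
    (by simp [pt]) (by simp [m_c, m_a0, m_a1, m_a2]) (by simp [m_b1, m_b2, m_b3, m_b4])
    ⟨h0, h1, h2, h3, h4, h5, h6, h7, h8, rot2 h9, rot2 h10, trivial⟩ ?_ (by norm_num) (by decide +kernel)
  intro K hK r hr h
  simp only [List.mem_cons, List.not_mem_nil, or_false] at hK
  rcases hK with rfl
  · exact List.mem_append.mp (R0 r hr (h (2, 1) (by simp)) (h (1, 4) (by simp)))

theorem cert_prop {x0 : ℝ} {A B : Finset Pt} (hb : Base x0 A B) (c a1 a2 a3 f n m : Pt)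
    (m_c : c ∈ A) (m_a1 : a1 ∈ A) (m_a2 : a2 ∈ A) (m_a3 : a3 ∈ A) (m_f : f ∈ B) (m_n : n ∈ B) (m_m
      : m ∈ B)
    (h0 : c.1 < a1.1)
    (h1 : c.1 < a2.1)
    (h2 : c.1 < a3.1)
    (h3 : 0 < ori c a1 f)
    (h4 : 0 < ori c n a1)
    (h5 : 0 < ori c a2 n)
    (h6 : 0 < ori c m a2)
    (h7 : 0 < ori c a3 m)
    (h8 : 0 < ori f n a2)
    (h9 : 0 < ori m f a3)
    (R0 : ∀ r ∈ A ∪ B, 0 ≤ ori a1 c r → 0 ≤ ori c a3 r → r ∈ [c, a1, a2, a3, f, n, m])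
    (R1 : ∀ r ∈ A ∪ B, 0 ≤ ori f c r → 0 ≤ ori c a3 r → 0 ≤ ori f n r → r ∈ [c, a1, a2, a3, f, n,
      m])
    : False := by
  refine cert_sound' hb [c, a1, a2, a3] [f, n, m] 8 4 rfl rfl [] [[(2, 1), (1, 4)], [(5, 1), (1,
      4), (5, 6)]]
    [18, 19, 20, 293, 354, 310, 371, 327, 854, 1141]
    (.split [6296356, 7345204, 2425186, 6300498, 5252661, 3539314, 4653396, 2299472,
      5247541, 5247589, 3479393, 1271560, 1267464, 5322596, 7672932, 4653412, 6296612]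
      308
  (.con [3408240] 4653360)
  (.split [] 292
  (.con [2359648] 4587808)
  (.split [] 1078
  (.hole [3544100] 82786 0)
  (.hole [3478625, 6506325] 214870 1))))
    (by simp [pt]) (by simp [m_c, m_a1, m_a2, m_a3]) (by simp [m_f, m_n, m_m])
    ⟨h0, h1, h2, h3, h4, h5, h6, h7, rot2 h8, rot2 h9, trivial⟩ ?_ (by norm_num) (by decide +kernel)
  intro K hK r hr h
  simp only [List.mem_cons, List.not_mem_nil, or_false] at hK
  rcases hK with rfl | rfl
  · exact List.mem_append.mp (R0 r hr (h (2, 1) (by simp)) (h (1, 4) (by simp)))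
  · exact List.mem_append.mp (R1 r hr (h (5, 1) (by simp)) (h (1, 4) (by simp)) (h (5, 6) (by
      simp)))

theorem cert_prop0 {x0 : ℝ} {A B : Finset Pt} (hb : Base x0 A B) (c a1 a2 a3 b1 b2 b3 b4 : Pt)
    (m_c : c ∈ A) (m_a1 : a1 ∈ A) (m_a2 : a2 ∈ A) (m_a3 : a3 ∈ A) (m_b1 : b1 ∈ B) (m_b2 : b2 ∈ B)
      (m_b3 : b3 ∈ B) (m_b4 : b4 ∈ B)
    (h0 : c.1 < a1.1)
    (h1 : c.1 < a2.1)
    (h2 : c.1 < a3.1)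
    (h3 : 0 < ori c b2 b1)
    (h4 : 0 < ori c a1 b2)
    (h5 : 0 < ori c b3 a1)
    (h6 : 0 < ori c a2 b3)
    (h7 : 0 < ori c b4 a2)
    (h8 : 0 < ori c a3 b4)
    (h9 : 0 < ori a1 a3 a2)
    (h10 : 0 < ori b1 b2 a1)
    (h11 : 0 < ori b3 b1 a2)
    (R0 : ∀ r ∈ A ∪ B, 0 ≤ ori b1 c r → 0 ≤ ori c a2 r → r ∈ [c, a1, a2, a3, b1, b2, b3, b4])
    (R1 : ∀ r ∈ A ∪ B, 0 ≤ ori b1 c r → 0 ≤ ori c a3 r → r ∈ [c, a1, a2, a3, b1, b2, b3, b4])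
    : False := by
  refine cert_sound' hb [c, a1, a2, a3] [b1, b2, b3, b4] 9 4 rfl rfl [] [[(5, 1), (1, 3)], [(5,
      1), (1, 4)]]
    [18, 19, 20, 357, 294, 370, 311, 387, 328, 579, 598, 885]
    (.split [6296146, 7344932, 8393780, 5248549, 2490738, 2425202, 3604820, 3604866,
      1206024, 1201928, 5318500, 7672676, 3604836] 806
  (.split [3605091, 3609187, 3277186, 2491266, 8397637, 2373730, 2393611, 2360192,
      4718884, 4723491, 4728372, 4325732] 1045
  (.con [4325714] 5247552)
  (.hole [] 82726 1))
  (.hole [2299744, 2429793, 6436693] 145238 0))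
    (by simp [pt]) (by simp [m_c, m_a1, m_a2, m_a3]) (by simp [m_b1, m_b2, m_b3, m_b4])
    ⟨h0, h1, h2, h3, h4, h5, h6, h7, h8, h9, rot2 h10, rot2 h11, trivial⟩ ?_ (by norm_num) (by decide +kernel)
  intro K hK r hr h
  simp only [List.mem_cons, List.not_mem_nil, or_false] at hK
  rcases hK with rfl | rfl
  · exact List.mem_append.mp (R0 r hr (h (5, 1) (by simp)) (h (1, 3) (by simp)))
  · exact List.mem_append.mp (R1 r hr (h (5, 1) (by simp)) (h (1, 4) (by simp)))

theorem cert_su {x0 : ℝ} {A B : Finset Pt} (hb : Base x0 A B) (c a0 a1 a2 a3 b1 b2 b3 b4 : Pt)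
    (m_c : c ∈ A) (m_a0 : a0 ∈ A) (m_a1 : a1 ∈ A) (m_a2 : a2 ∈ A) (m_a3 : a3 ∈ A) (m_b1 : b1 ∈ B)
      (m_b2 : b2 ∈ B) (m_b3 : b3 ∈ B) (m_b4 : b4 ∈ B)
    (h0 : c.1 < a1.1)
    (h1 : c.1 < a2.1)
    (h2 : c.1 < a3.1)
    (h3 : 0 < ori c b1 a0)
    (h4 : 0 < ori c a1 a0)
    (h5 : 0 < ori c b2 b1)
    (h6 : 0 < ori c a1 b2)
    (h7 : 0 < ori c b3 a1)
    (h8 : 0 < ori c a2 b3)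
    (h9 : 0 < ori c b4 a2)
    (h10 : 0 < ori c a3 b4)
    (h11 : 0 < ori b1 b2 a0)
    (h12 : 0 < ori b2 b1 a1)
    (h13 : 0 < ori a1 a3 a2)
    (h14 : 0 < ori b3 b2 a2)
    (R0 : ∀ r ∈ A ∪ B, 0 ≤ ori a0 c r → 0 ≤ ori c b4 r → r ∈ [c, a0, a1, a2, a3, b1, b2, b3, b4])
    (R1 : ∀ r ∈ A ∪ B, 0 ≤ ori a0 c r → 0 ≤ ori c a3 r → r ∈ [c, a0, a1, a2, a3, b1, b2, b3, b4])
    (R2 : ∀ r ∈ A ∪ B, 0 ≤ ori b1 c r → 0 ≤ ori c a2 r → r ∈ [c, a0, a1, a2, a3, b1, b2, b3, b4])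
    (R3 : ∀ r ∈ A ∪ B, 0 ≤ ori b1 c r → 0 ≤ ori c b4 r → r ∈ [c, a0, a1, a2, a3, b1, b2, b3, b4])
    (R4 : ∀ r ∈ A ∪ B, 0 ≤ ori b1 c r → 0 ≤ ori c a3 r → r ∈ [c, a0, a1, a2, a3, b1, b2, b3, b4])
    : False := by
  refine cert_sound' hb [c, a0, a1, a2, a3] [b1, b2, b3, b4] 10 5 rfl rfl [] [[(2, 1), (1, 9)],
      [(2, 1), (1, 5)], [(6, 1), (1, 4)], [(6, 1), (1, 9)], [(6, 1), (1, 5)]]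
    [19, 20, 21, 354, 306, 374, 311, 387, 328, 404, 345, 615, 886,
      852, 1159]
    (.split [6297377, 7344739, 8393780, 9442628, 3604836, 6296356, 3604866, 3539330,
      4718964, 7345252, 4718994, 4653458, 4653412, 6296612, 1275912, 1271816, 1345800,
      4587922, 1337608, 1341704, 4810867] 1302
  (.con [5833058] 1414664)
  (.split [6296868] 1304
  (.con [5833090] 1415176)
  (.split [8394036] 1335
  (.split [3507979, 5767540, 5768051, 5772147, 7345508, 3605860, 1390979, 9442612] 293
  (.hole [] 86902 4)
  (.hole [] 86902 1))
  (.split [3479664, 3491957, 1390979, 3414128, 7419029, 3539346, 9442612, 5837875] 1112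
  (.split [] 841
  (.split [] 1078
  (.hole [3491682, 4396388] 87094 4)
  (.split [] 1656
  (.split [7346273, 7477345, 8393331, 8398645, 2189189] 1657
  (.split [7346529, 7477601, 9441907, 2189205, 1647667] 2105
  (.split [] 1929
  (.hole [8526193, 8788337] 157577 0)
  (.hole [] 215431 0))
  (.hole [8526129, 8788273, 8853809] 157577 0))
  (.hole [] 215414 3))
  (.hole [] 215158 2)))
  (.hole [] 88387 4))
  (.hole [] 87171 4)))))
    (by simp [pt]) (by simp [m_c, m_a0, m_a1, m_a2, m_a3]) (by simp [m_b1, m_b2, m_b3, m_b4])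
    ⟨h0, h1, h2, h3, h4, h5, h6, h7, h8, h9, h10, rot2 h11, rot2 h12, h13, rot2 h14, trivial⟩ ?_
      (by norm_num) (by decide +kernel)
  intro K hK r hr h
  simp only [List.mem_cons, List.not_mem_nil, or_false] at hK
  rcases hK with rfl | rfl | rfl | rfl | rfl
  · exact List.mem_append.mp (R0 r hr (h (2, 1) (by simp)) (h (1, 9) (by simp)))
  · exact List.mem_append.mp (R1 r hr (h (2, 1) (by simp)) (h (1, 5) (by simp)))
  · exact List.mem_append.mp (R2 r hr (h (6, 1) (by simp)) (h (1, 4) (by simp)))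
  · exact List.mem_append.mp (R3 r hr (h (6, 1) (by simp)) (h (1, 9) (by simp)))
  · exact List.mem_append.mp (R4 r hr (h (6, 1) (by simp)) (h (1, 5) (by simp)))

theorem cert_cX {x0 : ℝ} {A B : Finset Pt} (hb : Base x0 A B) (c a1 f n p q : Pt)
    (m_c : c ∈ A) (m_a1 : a1 ∈ A) (m_f : f ∈ B) (m_n : n ∈ B) (m_p : p ∈ B) (m_q : q ∈ B)
    (h0 : c.1 < a1.1)
    (h1 : 0 < ori c n f)
    (h2 : 0 < ori c a1 n)
    (h3 : 0 < ori c p a1)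
    (h4 : 0 < ori c q p)
    (h5 : 0 < ori f n a1)
    (h6 : 0 < ori p q a1)
    (R0 : ∀ r ∈ A ∪ B, 0 ≤ ori f c r → 0 ≤ ori c q r → 0 ≤ ori f n r → r ∈ [c, a1, f, n, p, q])
    : False := by
  refine cert_sound' hb [c, a1] [f, n, p, q] 7 2 rfl rfl [] [[(3, 1), (1, 6), (3, 4)]]
    [18, 323, 292, 338, 357, 564, 598]
    (.hole [4198962, 5248545, 6296147, 3150885, 2359634, 2359650, 2294098, 2294114,
      1197320, 1197576, 5510689, 1193224, 5445153, 1271050, 3220804, 3221060] 153140 0)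
    (by simp [pt]) (by simp [m_c, m_a1]) (by simp [m_f, m_n, m_p, m_q])
    ⟨h0, h1, h2, h3, h4, rot2 h5, rot2 h6, trivial⟩ ?_ (by norm_num) (by decide +kernel)
  intro K hK r hr h
  simp only [List.mem_cons, List.not_mem_nil, or_false] at hK
  rcases hK with rfl
  · exact List.mem_append.mp (R0 r hr (h (3, 1) (by simp)) (h (1, 6) (by simp)) (h (3, 4) (by
      simp)))

theorem cert_cUD {x0 : ℝ} {A B : Finset Pt} (hb : Base x0 A B) (c a1 a2 f n p q : Pt)
    (m_c : c ∈ A) (m_a1 : a1 ∈ A) (m_a2 : a2 ∈ A) (m_f : f ∈ B) (m_n : n ∈ B) (m_p : p ∈ B) (m_q :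
      q ∈ B)
    (h0 : c.1 < a1.1)
    (h1 : c.1 < a2.1)
    (h2 : 0 < ori c a1 f)
    (h3 : 0 < ori c n a1)
    (h4 : 0 < ori c a2 n)
    (h5 : 0 < ori c p a2)
    (h6 : 0 < ori c q p)
    (h7 : 0 < ori f n a2)
    (h8 : 0 < ori q p a2)
    (h9 : 0 < ori q p f)
    (h10 : 0 < ori n p a1)
    (R0 : ∀ r ∈ A ∪ B, 0 ≤ ori f c r → 0 ≤ ori c q r → 0 ≤ ori f n r → r ∈ [c, a1, a2, f, n, p, q])
    : False := by
  refine cert_sound' hb [c, a1, a2] [f, n, p, q] 8 3 rfl rfl [] [[(4, 1), (1, 7), (4, 5)]]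
    [18, 19, 292, 338, 309, 355, 374, 837, 886, 1142, 598]
    (.hole [5247780, 2359634, 5251906, 4203829, 3473762, 5251938, 3604833, 6296883,
      3473778, 4198965, 4198997, 5510689, 3413585, 3413841, 1267464, 1263112, 6559572,
      7738419, 4274004] 226885 0)
    (by simp [pt]) (by simp [m_c, m_a1, m_a2]) (by simp [m_f, m_n, m_p, m_q])
    ⟨h0, h1, h2, h3, h4, h5, h6, rot2 h7, rot2 h8, rot2 h9, rot2 h10, trivial⟩ ?_ (by norm_num)
      (by decide +kernel)
  intro K hK r hr h
  simp only [List.mem_cons, List.not_mem_nil, or_false] at hK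
  rcases hK with rfl
  · exact List.mem_append.mp (R0 r hr (h (4, 1) (by simp)) (h (1, 7) (by simp)) (h (4, 5) (by
      simp)))

theorem cert_cross {x0 : ℝ} {A B : Finset Pt} (hb : Base x0 A B) (c a0 a1 a2 a9 b1 b2 p q : Pt)
    (m_c : c ∈ A) (m_a0 : a0 ∈ A) (m_a1 : a1 ∈ A) (m_a2 : a2 ∈ A) (m_a9 : a9 ∈ A) (m_b1 : b1 ∈ B)
      (m_b2 : b2 ∈ B) (m_p : p ∈ B) (m_q : q ∈ B)
    (h0 : c.1 < a1.1)
    (h1 : c.1 < a2.1)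
    (h2 : 0 < ori c b2 b1)
    (h3 : 0 < ori c a1 b2)
    (h4 : 0 < ori c a2 a1)
    (h5 : 0 < ori c p a2)
    (h6 : 0 < ori c q p)
    (h7 : 0 < ori c b1 a0)
    (h8 : 0 < ori c a9 q)
    (h9 : 0 < ori b1 b2 a0)
    (h10 : 0 < ori q p a2)
    (h11 : 0 < ori p q a9)
    (h12 : 0 < ori p q b2)
    (h13 : 0 < ori b1 b2 p)
    : False := by
  refine cert_sound' hb [c, a0, a1, a2, a9] [b1, b2, p, q] 10 5 rfl rfl [] []
    [19, 20, 374, 311, 323, 388, 408, 354, 345, 615, 1176, 1417, 1929,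
      1656]
    (.split [6297377, 9442690] 1047
  (.con [7344964, 3604805] 4391280)
  (.con [4653442, 7345252, 7358561] 8407408))
    (by simp [pt]) (by simp [m_c, m_a0, m_a1, m_a2, m_a9]) (by simp [m_b1, m_b2, m_p, m_q])
    ⟨h0, h1, h2, h3, h4, h5, h6, h7, h8, rot2 h9, rot2 h10, rot2 h11, rot2 h12, h13, trivial⟩ ?_
      (by norm_num) (by decide +kernel)
  intro K hK r hr h
  simp at hK

theorem cert_dichb {x0 : ℝ} {A B : Finset Pt} (hb : Base x0 A B) (c a0 a1 b1 b2 : Pt)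
    (m_c : c ∈ A) (m_a0 : a0 ∈ A) (m_a1 : a1 ∈ A) (m_b1 : b1 ∈ B) (m_b2 : b2 ∈ B)
    (h0 : 0 < ori c b1 a0)
    (h1 : 0 < ori c b2 b1)
    (h2 : 0 < ori c a1 b2)
    (h3 : 0 < ori b1 b2 a0)
    (h4 : 0 < ori b1 b2 a1)
    : False := by
  refine cert_sound' hb [c, a0, a1] [b1, b2] 6 3 rfl rfl [] []
    [322, 340, 309, 581, 837]
    (.con [4199713] 5247808)
    (by simp [pt]) (by simp [m_c, m_a0, m_a1]) (by simp [m_b1, m_b2])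
    ⟨h0, h1, h2, rot2 h3, rot2 h4, trivial⟩ ?_ (by norm_num) (by decide +kernel)
  intro K hK r hr h
  simp at hK

theorem cert_dichc {x0 : ℝ} {A B : Finset Pt} (hb : Base x0 A B) (c a0 a1 b1 b2 : Pt)
    (m_c : c ∈ A) (m_a0 : a0 ∈ A) (m_a1 : a1 ∈ A) (m_b1 : b1 ∈ B) (m_b2 : b2 ∈ B)
    (h0 : 0 < ori c b1 a0)
    (h1 : 0 < ori c b2 b1)
    (h2 : 0 < ori c a1 b2)
    (h3 : 0 < ori c a1 a0)
    (h4 : 0 < ori b2 b1 a0)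
    (h5 : 0 < ori b2 b1 a1)
    (h6 : 0 < ori c a1 b1)
    (h7 : 0 < ori c b2 a0)
    (R0 : ∀ r ∈ A ∪ B, 0 ≤ ori a0 c r → 0 ≤ ori c a1 r → r ∈ [c, a0, a1, b1, b2])
    : False := by
  refine cert_sound' hb [c, a0, a1] [b1, b2] 6 3 rfl rfl [] [[(2, 1), (1, 3)]]
    [322, 340, 309, 306, 596, 852, 308, 338]
    (.hole [4199204, 5247780] 79170 0)
    (by simp [pt]) (by simp [m_c, m_a0, m_a1]) (by simp [m_b1, m_b2])
    ⟨h0, h1, h2, h3, rot2 h4, rot2 h5, h6, h7, trivial⟩ ?_ (by norm_num) (by decide +kernel)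
  intro K hK r hr h
  simp only [List.mem_cons, List.not_mem_nil, or_false] at hK
  rcases hK with rfl
  · exact List.mem_append.mp (R0 r hr (h (2, 1) (by simp)) (h (1, 3) (by simp)))

theorem cert_emptA {x0 : ℝ} {A B : Finset Pt} (hb : Base x0 A B) (c a2 a3 f n m : Pt)
    (m_c : c ∈ A) (m_a2 : a2 ∈ A) (m_a3 : a3 ∈ A) (m_f : f ∈ B) (m_n : n ∈ B) (m_m : m ∈ B)
    (h0 : c.1 < a2.1)
    (h1 : 0 < ori c n f)
    (h2 : 0 < ori c a2 n)
    (h3 : 0 < ori c m a2)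
    (h4 : 0 < ori f n a2)
    (h5 : 0 < ori f m a2)
    : False := by
  refine cert_sound' hb [c, a2, a3] [f, n, m] 7 3 rfl rfl [] []
    [18, 340, 293, 354, 581, 582]
    (.con [5247554, 2359649] 4199712)
    (by simp [pt]) (by simp [m_c, m_a2, m_a3]) (by simp [m_f, m_n, m_m])
    ⟨h0, h1, h2, h3, rot2 h4, rot2 h5, trivial⟩ ?_ (by norm_num) (by decide +kernel)
  intro K hK r hr h
  simp at hK

theorem cert_emptN {x0 : ℝ} {A B : Finset Pt} (hb : Base x0 A B) (c a2 a3 f n m : Pt)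
    (m_c : c ∈ A) (m_a2 : a2 ∈ A) (m_a3 : a3 ∈ A) (m_f : f ∈ B) (m_n : n ∈ B) (m_m : m ∈ B)
    (h0 : c.1 < a2.1)
    (h1 : 0 < ori c n f)
    (h2 : 0 < ori c a2 n)
    (h3 : 0 < ori c m a2)
    (h4 : 0 < ori f n a2)
    (h5 : 0 < ori f m n)
    : False := by
  refine cert_sound' hb [c, a2, a3] [f, n, m] 7 3 rfl rfl [] []
    [18, 340, 293, 354, 581, 1125]
    (.con [5247554, 4199717, 2425186, 2359650, 4269649, 1201672] 6624288)
    (by simp [pt]) (by simp [m_c, m_a2, m_a3]) (by simp [m_f, m_n, m_m])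
    ⟨h0, h1, h2, h3, rot2 h4, h5, trivial⟩ ?_ (by norm_num) (by decide +kernel)
  intro K hK r hr h
  simp at hK

theorem cert_emptR {x0 : ℝ} {A B : Finset Pt} (hb : Base x0 A B) (c a2 a3 r f n m : Pt)
    (m_c : c ∈ A) (m_a2 : a2 ∈ A) (m_a3 : a3 ∈ A) (m_r : r ∈ A) (m_f : f ∈ B) (m_n : n ∈ B) (m_m :
      m ∈ B)
    (h0 : c.1 < a2.1)
    (h1 : 0 < ori c n f)
    (h2 : 0 < ori c a2 n)
    (h3 : 0 < ori c m a2)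
    (h4 : 0 < ori f n a2)
    (h5 : 0 < ori c r f)
    (h6 : 0 < ori n f r)
    (h7 : 0 < ori f m r)
    : False := by
  refine cert_sound' hb [c, a2, a3, r] [f, n, m] 8 4 rfl rfl [] []
    [18, 357, 294, 370, 598, 325, 1125, 1111]
    (.con [6296146, 5248549, 2425202, 5317731, 1201928] 5318464)
    (by simp [pt]) (by simp [m_c, m_a2, m_a3, m_r]) (by simp [m_f, m_n, m_m])
    ⟨h0, h1, h2, h3, rot2 h4, h5, rot2 h6, rot2 h7, trivial⟩ ?_ (by norm_num) (by decide +kernel)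
  intro K hK r hr h
  simp at hK

theorem cert_Vh {x0 : ℝ} {A B : Finset Pt} (hb : Base x0 A B) (c a2 x p q : Pt)
    (m_c : c ∈ A) (m_a2 : a2 ∈ A) (m_x : x ∈ A) (m_p : p ∈ B) (m_q : q ∈ B)
    (h0 : 0 < ori c p a2)
    (h1 : 0 < ori c q p)
    (h2 : 0 < ori c x q)
    (h3 : 0 < ori c x a2)
    (h4 : 0 < ori c q a2)
    (h5 : 0 < ori c x p)
    (h6 : 0 < ori q p a2)
    (h7 : 0 < ori q p x)
    (R0 : ∀ r ∈ A ∪ B, 0 ≤ ori a2 c r → 0 ≤ ori c x r → 0 ≤ ori q p r → r ∈ [c, a2, x, p, q])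
    : False := by
  refine cert_sound' hb [c, a2, x] [p, q] 6 3 rfl rfl [] [[(2, 1), (1, 3), (5, 4)]]
    [322, 340, 309, 306, 338, 308, 596, 852]
    (.hole [4199204, 5247780] 79170 0)
    (by simp [pt]) (by simp [m_c, m_a2, m_x]) (by simp [m_p, m_q])
    ⟨h0, h1, h2, h3, h4, h5, rot2 h6, rot2 h7, trivial⟩ ?_ (by norm_num) (by decide +kernel)
  intro K hK r hr h
  simp only [List.mem_cons, List.not_mem_nil, or_false] at hK
  rcases hK with rfl
  · exact List.mem_append.mp (R0 r hr (h (2, 1) (by simp)) (h (1, 3) (by simp)) (h (5, 4) (by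
      simp)))

theorem cert_cZ {x0 : ℝ} {A B : Finset Pt} (hb : Base x0 A B) (c a1 a2 a3 b1 b2 b3 b4 : Pt)
    (m_c : c ∈ A) (m_a1 : a1 ∈ A) (m_a2 : a2 ∈ A) (m_a3 : a3 ∈ A) (m_b1 : b1 ∈ B) (m_b2 : b2 ∈ B)
      (m_b3 : b3 ∈ B) (m_b4 : b4 ∈ B)
    (h0 : c.1 < a1.1)
    (h1 : c.1 < a2.1)
    (h2 : c.1 < a3.1)
    (h3 : 0 < ori c a1 b2)
    (h4 : 0 < ori c b3 a1)
    (h5 : 0 < ori c b4 b3)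
    (h6 : 0 < ori c a2 b4)
    (h7 : 0 < ori c a3 a2)
    (h8 : 0 < ori a1 a3 a2)
    (h9 : 0 < ori b2 b1 a1)
    (h10 : 0 < ori b1 a2 a1)
    (R0 : ∀ r ∈ A ∪ B, 0 ≤ ori b1 c r → 0 ≤ ori c a3 r → 0 ≤ ori a3 a2 r → r ∈ [c, a1, a2, a3, b1,
      b2, b3, b4])
    : False := by
  refine cert_sound' hb [c, a1, a2, a3] [b1, b2, b3, b4] 9 4 rfl rfl [] [[(5, 1), (1, 4), (4, 3)]]
    [18, 19, 20, 294, 370, 391, 312, 323, 579, 613, 595]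
    (.split [2490708, 2425202] 536
  (.hole [2425218, 8393508, 2327819, 3670611, 3670356, 3674707, 3277125, 3277908,
      74803, 4391204, 4391252, 5252147] 82725 0)
  (.con [2621810] 1214216))
    (by simp [pt]) (by simp [m_c, m_a1, m_a2, m_a3]) (by simp [m_b1, m_b2, m_b3, m_b4])
    ⟨h0, h1, h2, h3, h4, h5, h6, h7, h8, rot2 h9, rot2 h10, trivial⟩ ?_ (by norm_num) (by decide +kernel)
  intro K hK r hr h
  simp only [List.mem_cons, List.not_mem_nil, or_false] at hK
  rcases hK with rfl
  · exact List.mem_append.mp (R0 r hr (h (5, 1) (by simp)) (h (1, 4) (by simp)) (h (4, 3) (by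
      simp)))

theorem cert_Zr {x0 : ℝ} {A B : Finset Pt} (hb : Base x0 A B) (c a2 a3 r : Pt)
    (m_c : c ∈ A) (m_a2 : a2 ∈ A) (m_a3 : a3 ∈ A) (m_r : r ∈ B)
    (h0 : 0 < ori c r a2)
    (h1 : 0 < ori c a3 r)
    (h2 : 0 < ori a3 a2 r)
    : False := by
  refine cert_sound' hb [c, a2, a3] [r] 5 3 rfl rfl [] []
    [322, 308, 579]
    (.con [] 4199200)
    (by simp [pt]) (by simp [m_c, m_a2, m_a3]) (by simp [m_r])
    ⟨h0, h1, rot1 h2, trivial⟩ ?_ (by norm_num) (by decide +kernel)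
  intro K hK r hr h
  simp at hK

theorem cert_emptRB {x0 : ℝ} {A B : Finset Pt} (hb : Base x0 A B) (c a2 a3 f n m r : Pt)
    (m_c : c ∈ A) (m_a2 : a2 ∈ A) (m_a3 : a3 ∈ A) (m_f : f ∈ B) (m_n : n ∈ B) (m_m : m ∈ B) (m_r :
      r ∈ B)
    (h0 : c.1 < a2.1)
    (h1 : 0 < ori c n f)
    (h2 : 0 < ori c a2 n)
    (h3 : 0 < ori c m a2)
    (h4 : 0 < ori f n a2)
    (h5 : 0 < ori c r f)
    (h6 : 0 < ori n f r)
    (h7 : 0 < ori f m r)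
    : False := by
  refine cert_sound' hb [c, a2, a3] [f, n, m, r] 8 3 rfl rfl [] []
    [18, 340, 293, 354, 581, 372, 1141, 1127]
    (.con [5247554, 4199717, 2359650, 4269907, 1197576] 4269680)
    (by simp [pt]) (by simp [m_c, m_a2, m_a3]) (by simp [m_f, m_n, m_m, m_r])
    ⟨h0, h1, h2, h3, rot2 h4, h5, rot1 h6, h7, trivial⟩ ?_ (by norm_num) (by decide +kernel)
  intro K hK r hr h
  simp at hK

theorem cert_coneA {x0 : ℝ} {A B : Finset Pt} (hb : Base x0 A B) (c a f n : Pt)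
    (m_c : c ∈ A) (m_a : a ∈ A) (m_f : f ∈ B) (m_n : n ∈ B)
    (h0 : 0 < ori c a f)
    (h1 : 0 < ori c n a)
    (h2 : 0 < ori c n f)
    (h3 : 0 < ori f n a)
    : False := by
  refine cert_sound' hb [c, a] [f, n] 5 2 rfl rfl [] []
    [291, 322, 323, 564]
    (.con [1311283] 2294080)
    (by simp [pt]) (by simp [m_c, m_a]) (by simp [m_f, m_n])
    ⟨h0, h1, h2, rot2 h3, trivial⟩ ?_ (by norm_num) (by decide +kernel)
  intro K hK r hr h
  simp at hK

theorem cert_Ra {x0 : ℝ} {A B : Finset Pt} (hb : Base x0 A B) (c a2 p q s : Pt)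
    (m_c : c ∈ A) (m_a2 : a2 ∈ A) (m_p : p ∈ B) (m_q : q ∈ B) (m_s : s ∈ B)
    (h0 : 0 < ori c p a2)
    (h1 : 0 < ori c q p)
    (h2 : 0 < ori c s p)
    (h3 : 0 < ori s p a2)
    (h4 : 0 < ori p q s)
    (h5 : 0 < ori p q a2)
    : False := by
  refine cert_sound' hb [c, a2] [p, q, s] 6 2 rfl rfl [] []
    [306, 323, 339, 595, 837, 564]
    (.con [3150881, 3408469, 144468, 4199731] 5439808)
    (by simp [pt]) (by simp [m_c, m_a2]) (by simp [m_p, m_q, m_s])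
    ⟨h0, h1, h2, rot2 h3, h4, rot2 h5, trivial⟩ ?_ (by norm_num) (by decide +kernel)
  intro K hK r hr h
  simp at hK


lemma Base.dich {x0 : ℝ} {A B : Finset Pt} (hb : Base x0 A B) {p q r : Pt} (mp : p ∈ A ∪ B)
    (mq : q ∈ A ∪ B) (mr : r ∈ A ∪ B) (h1 : p ≠ q) (h2 : p ≠ r) (h3 : q ≠ r) :
    0 < ori p q r ∨ 0 < ori q p r := by
  have := hb.gp p mp q mq r mr h1 h2 h3
  rw [ori_swap p q r]
  rcases lt_or_gt_of_ne this with h | h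
  · right; linarith
  · left; exact h

lemma Base.neAB {x0 : ℝ} {A B : Finset Pt} (hb : Base x0 A B) {p q : Pt} (mp : p ∈ A)
    (mq : q ∈ B) : p ≠ q := by
  rintro rfl
  have := hb.hA p mp
  have := hb.hB p mq
  linarith

lemma inA {A B : Finset Pt} {p : Pt} (h : p ∈ A) : p ∈ A ∪ B := Finset.mem_union_left _ h
lemma inB {A B : Finset Pt} {p : Pt} (h : p ∈ B) : p ∈ A ∪ B := Finset.mem_union_right _ h

lemma ne12 {p q r : Pt} (h : 0 < ori p q r) : p ≠ q := by
  rintro rfl; rw [ori_self] at h; exact lt_irrefl _ h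
lemma ne13 {p q r : Pt} (h : 0 < ori p q r) : p ≠ r := by
  rintro rfl; rw [ori_self''] at h; exact lt_irrefl _ h
lemma ne23 {p q r : Pt} (h : 0 < ori p q r) : q ≠ r := by
  rintro rfl; rw [ori_self'] at h; exact lt_irrefl _ h

lemma ori_cyc (p q r : Pt) : ori p q r = ori r p q := by rw [ori_rot r p q]

lemma ori_sw (p q r : Pt) : ori p r q = - ori p q r := by unfold ori; ring

/-- closed angular interval -/
structure In (c x y r : Pt) : Prop where
  fst : 0 ≤ ori c r x
  snd : 0 ≤ ori c y r
/-- open angular interval -/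
structure SI (c x y r : Pt) : Prop where
  fst : 0 < ori c r x
  snd : 0 < ori c y r

lemma SI.In {c x y r : Pt} (h : SI c x y r) : In c x y r := ⟨h.1.le, h.2.le⟩

lemma lo1 {c x y u r : Pt} (hc : 0 < ori c y x) (hu : SI c x y u) (h : 0 ≤ ori c r u) :
    0 ≤ ori c r x ∨ 0 < ori c r y := by
  by_contra hcon
  push Not at hcon
  obtain ⟨h1, h2⟩ := hcon
  have key : ori c y x * ori c r u = ori c y u * ori c r x + ori c u x * ori c r y := by
    unfold ori; ring
  have e1 : 0 ≤ ori c y x * ori c r u := mul_nonneg hc.le h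
  have e2 : ori c y u * ori c r x < 0 := mul_neg_of_pos_of_neg hu.2 h1
  have e3 : ori c u x * ori c r y ≤ 0 := mul_nonpos_of_nonneg_of_nonpos hu.1.le h2
  linarith

lemma hi1 {c x y w r : Pt} (hc : 0 < ori c y x) (hw : SI c x y w) (h : 0 ≤ ori c w r) :
    0 ≤ ori c y r ∨ 0 < ori c x r := by
  by_contra hcon
  push Not at hcon
  obtain ⟨h1, h2⟩ := hcon
  have key : ori c y x * ori c w r = ori c w x * ori c y r + ori c y w * ori c x r := by
    unfold ori; ring
  have e1 : 0 ≤ ori c y x * ori c w r := mul_nonneg hc.le h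
  have e2 : ori c w x * ori c y r < 0 := mul_neg_of_pos_of_neg hw.1 h1
  have e3 : ori c y w * ori c x r ≤ 0 := mul_nonpos_of_nonneg_of_nonpos hw.2.le h2
  linarith

lemma K2 {c x y z u w r : Pt} (hxy : 0 < ori c y x) (hyz : 0 < ori c z y)
    (hu : u = x ∨ SI c x y u) (hw : w = z ∨ SI c y z w)
    (h1 : 0 ≤ ori u c r) (h2 : 0 ≤ ori c w r) : In c x y r ∨ In c y z r := by
  rw [ori_rot] at h1
  have g1 : 0 ≤ ori c r x ∨ 0 < ori c r y := by
    rcases hu with rfl | hu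
    · exact Or.inl h1
    · exact lo1 hxy hu h1
  have g2 : 0 ≤ ori c z r ∨ 0 < ori c y r := by
    rcases hw with rfl | hw
    · exact Or.inl h2
    · exact hi1 hyz hw h2
  have sy := ori_sw c y r
  rcases le_or_gt 0 (ori c y r) with h | h
  · left
    rcases g1 with g1 | g1
    · exact ⟨g1, h⟩
    · linarith
  · right
    rcases g2 with g2 | g2
    · exact ⟨by linarith, g2⟩
    · linarith

lemma K3 {c x y z v u w r : Pt} (hxy : 0 < ori c y x) (hzv : 0 < ori c v z)
    (hu : u = x ∨ SI c x y u) (hw : w = v ∨ SI c z v w)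
    (h1 : 0 ≤ ori u c r) (h2 : 0 ≤ ori c w r) : In c x y r ∨ In c y z r ∨ In c z v r := by
  rw [ori_rot] at h1
  have g1 : 0 ≤ ori c r x ∨ 0 < ori c r y := by
    rcases hu with rfl | hu
    · exact Or.inl h1
    · exact lo1 hxy hu h1
  have g2 : 0 ≤ ori c v r ∨ 0 < ori c z r := by
    rcases hw with rfl | hw
    · exact Or.inl h2
    · exact hi1 hzv hw h2
  have sy := ori_sw c y r
  have sz := ori_sw c z r
  rcases le_or_gt 0 (ori c y r) with h | h
  · left
    rcases g1 with g1 | g1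
    · exact ⟨g1, h⟩
    · linarith
  · right
    rcases le_or_gt 0 (ori c z r) with h' | h'
    · left
      exact ⟨by linarith, h'⟩
    · right
      rcases g2 with g2 | g2
      · exact ⟨by linarith, g2⟩
      · linarith

lemma cw_trans {c x y z : Pt} (hx : c.1 < x.1) (hy : c.1 < y.1) (hz : c.1 < z.1)
    (h1 : 0 < ori c y x) (h2 : 0 < ori c z y) : 0 < ori c z x := by
  have key : (y.1 - c.1) * ori c z x = (x.1 - c.1) * ori c z y + (z.1 - c.1) * ori c y x := by
    unfold ori; ring
  have e1 : 0 < (x.1 - c.1) * ori c z y := mul_pos (by linarith) h2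
  have e2 : 0 < (z.1 - c.1) * ori c y x := mul_pos (by linarith) h1
  have : 0 < (y.1 - c.1) * ori c z x := by rw [key]; linarith
  exact pos_of_mul_pos_right this (by linarith)

/-- clockwise-first point after the ray o→z -/
lemma angFirst {o z : Pt} (S : Finset Pt) (hS : S.Nonempty) (h : ∀ x ∈ S, 0 < ori o x z) :
    ∃ y ∈ S, ∀ x ∈ S, 0 ≤ ori o x y := by
  obtain ⟨y, hy, hmax⟩ := S.exists_max_image
    (fun x => ((x.1 - o.1) * (z.1 - o.1) + (x.2 - o.2) * (z.2 - o.2)) / ori o x z) hS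
  refine ⟨y, hy, fun x hx => ?_⟩
  have h1 := hmax x hx
  have hx0 := h x hx
  have hy0 := h y hy
  rw [div_le_div_iff₀ hx0 hy0] at h1
  have key : ((z.1 - o.1) ^ 2 + (z.2 - o.2) ^ 2) * ori o x y =
      ((y.1 - o.1) * (z.1 - o.1) + (y.2 - o.2) * (z.2 - o.2)) * ori o x z -
      ((x.1 - o.1) * (z.1 - o.1) + (x.2 - o.2) * (z.2 - o.2)) * ori o y z := by
    unfold ori; ring
  by_contra hneg
  push Not at hneg
  have hz : 0 < (z.1 - o.1) ^ 2 + (z.2 - o.2) ^ 2 := by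
    rcases eq_or_ne (z.1 - o.1) 0 with e1 | e1
    · rcases eq_or_ne (z.2 - o.2) 0 with e2 | e2
      · exfalso
        have : o = z := Prod.ext (by linarith) (by linarith)
        exact ne13 hx0 this
      · positivity
    · positivity
  have := mul_neg_of_pos_of_neg hz hneg
  linarith

lemma angLast {o z : Pt} (S : Finset Pt) (hS : S.Nonempty) (h : ∀ x ∈ S, 0 < ori o z x) :
    ∃ y ∈ S, ∀ x ∈ S, 0 ≤ ori o y x := by
  obtain ⟨y', hy', hmin'⟩ := S.exists_max_image
    (fun x => ((x.1 - o.1) * (z.1 - o.1) + (x.2 - o.2) * (z.2 - o.2)) / ori o z x) hS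
  refine ⟨y', hy', fun x hx => ?_⟩
  have h1 := hmin' x hx
  have hx0 := h x hx
  have hy0 := h y' hy'
  rw [div_le_div_iff₀ hx0 hy0] at h1
  have key : ((z.1 - o.1) ^ 2 + (z.2 - o.2) ^ 2) * ori o y' x =
      ((y'.1 - o.1) * (z.1 - o.1) + (y'.2 - o.2) * (z.2 - o.2)) * ori o z x -
      ((x.1 - o.1) * (z.1 - o.1) + (x.2 - o.2) * (z.2 - o.2)) * ori o z y' := by
    unfold ori; ring
  by_contra hneg
  push Not at hneg
  have hz : 0 < (z.1 - o.1) ^ 2 + (z.2 - o.2) ^ 2 := by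
    rcases eq_or_ne (z.1 - o.1) 0 with e1 | e1
    · rcases eq_or_ne (z.2 - o.2) 0 with e2 | e2
      · exfalso
        have : o = z := Prod.ext (by linarith) (by linarith)
        exact ne12 hx0 this
      · positivity
    · positivity
  have := mul_neg_of_pos_of_neg hz hneg
  linarith

structure Wd (A : Finset Pt) (c x y : Pt) : Prop where
  mc : c ∈ A
  mx : x ∈ A
  my : y ∈ A
  conv : 0 < ori c y x
  wA : ∀ r ∈ A, In c x y r → r = c ∨ r = x ∨ r = y

structure W2 (B : Finset Pt) (c x y b1 b2 : Pt) : Prop where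
  m1 : b1 ∈ B
  m2 : b2 ∈ B
  s1 : SI c x y b1
  s2 : SI c x y b2
  o : 0 < ori c b2 b1
  all : ∀ r ∈ B, In c x y r → r = b1 ∨ r = b2

structure W1 (B : Finset Pt) (c x y m : Pt) : Prop where
  m1 : m ∈ B
  s1 : SI c x y m
  all : ∀ r ∈ B, In c x y r → r = m

lemma Wd.pts2 {A B : Finset Pt} {c x y b1 b2 r : Pt} (w : Wd A c x y) (h : W2 B c x y b1 b2)
    (hr : r ∈ A ∪ B) (hi : In c x y r) : r = c ∨ r = x ∨ r = y ∨ r = b1 ∨ r = b2 := by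
  rcases Finset.mem_union.1 hr with hA | hB
  · have := w.wA r hA hi; tauto
  · have := h.all r hB hi; tauto

lemma Wd.pts1 {A B : Finset Pt} {c x y m r : Pt} (w : Wd A c x y) (h : W1 B c x y m)
    (hr : r ∈ A ∪ B) (hi : In c x y r) : r = c ∨ r = x ∨ r = y ∨ r = m := by
  rcases Finset.mem_union.1 hr with hA | hB
  · have := w.wA r hA hi; tauto
  · have := h.all r hB hi; tauto

lemma Wd.pts0 {A B : Finset Pt} {c x y r : Pt} (w : Wd A c x y)
    (h : ∀ r ∈ B, ¬ In c x y r) (hr : r ∈ A ∪ B) (hi : In c x y r) :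
    r = c ∨ r = x ∨ r = y := by
  rcases Finset.mem_union.1 hr with hA | hB
  · exact w.wA r hA hi
  · exact absurd hi (h r hB)

lemma In.si {x0 : ℝ} {A B : Finset Pt} (hb : Base x0 A B) {c x y r : Pt} (w : Wd A c x y)
    (hr : r ∈ B) (h : In c x y r) : SI c x y r := by
  have n1 := hb.neAB w.mc hr
  have n2 := hb.neAB w.mx hr
  have n3 := hb.neAB w.my hr
  have g1 := hb.gp c (inA w.mc) r (inB hr) x (inA w.mx) n1 (ne13 w.conv) n2.symm
  have g2 := hb.gp c (inA w.mc) y (inA w.my) r (inB hr) (ne12 w.conv) n1 n3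
  exact ⟨lt_of_le_of_ne h.1 g1.symm, lt_of_le_of_ne h.2 g2.symm⟩

/-- The two possible ways a line through the two points of a wedge separates the boundary. -/
lemma L_dich {x0 : ℝ} {A B : Finset Pt} (hb : Base x0 A B) {c x y b1 b2 : Pt} (w : Wd A c x y)
    (h : W2 B c x y b1 b2) :
    (0 < ori b1 b2 x ∧ 0 < ori b2 b1 y) ∨ (0 < ori b2 b1 x ∧ 0 < ori b1 b2 y) := by
  obtain ⟨mc, mx, my, conv, wA⟩ := w
  have w : Wd A c x y := ⟨mc, mx, my, conv, wA⟩
  have h' := h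
  obtain ⟨m1, m2, ⟨s11, s12⟩, ⟨s21, s22⟩, o, all⟩ := h
  have n := ne23 o
  rcases hb.dich (inB m1) (inB m2) (inA mx) n.symm (hb.neAB mx m1).symm (hb.neAB mx m2).symm
    with g | g <;>
  rcases hb.dich (inB m1) (inB m2) (inA my) n.symm (hb.neAB my m1).symm (hb.neAB my m2).symm
    with g' | g'
  · exfalso
    apply cert_dichb hb c x y b1 b2 <;> assumption
  · exact Or.inl ⟨g, g'⟩
  · exact Or.inr ⟨g, g'⟩
  · exfalso
    apply cert_dichc hb c x y b1 b2 <;> try assumption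
    intro r hr h1 h2
    rw [ori_rot] at h1
    have := w.pts2 h' hr ⟨h1, h2⟩
    simp; tauto


/-- The pattern 2,1,2 except for the mirror image of the first case. -/
lemma loc_d2 {x0 : ℝ} {A B : Finset Pt} (hb : Base x0 A B) {c a0 a1 a2 a3 b1 b2 b3 b4 b5 : Pt}
    (w0 : Wd A c a0 a1) (w1 : Wd A c a1 a2) (w2 : Wd A c a2 a3)
    (r1 : c.1 < a1.1) (r2 : c.1 < a2.1) (e1 : a0 ≠ a2) (e2 : a1 ≠ a3)
    (h0 : W2 B c a0 a1 b1 b2) (h1 : W1 B c a1 a2 b3) (h2 : W2 B c a2 a3 b4 b5) :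
    0 < ori b1 b2 a0 ∧ 0 < ori b4 b5 a2 := by
  have reg : ∀ u w, (u = a0 ∨ SI c a0 a1 u) → (w = a3 ∨ SI c a2 a3 w) →
      ∀ r ∈ A ∪ B, 0 ≤ ori u c r → 0 ≤ ori c w r → r ∈ [c, a0, a1, a2, a3, b1, b2, b3, b4, b5] := by
    intro u w hu hw r hr g1 g2
    rcases K3 w0.conv w2.conv hu hw g1 g2 with h | h | h
    · rcases w0.pts2 h0 hr h with e | e | e | e | e <;> simp [e]
    · rcases w1.pts1 h1 hr h with e | e | e | e <;> simp [e]
    · rcases w2.pts2 h2 hr h with e | e | e | e | e <;> simp [e]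
  have L0 := L_dich hb w0 h0
  have L2 := L_dich hb w2 h2
  obtain ⟨mc, m0, m1, cv0, -⟩ := w0
  obtain ⟨-, -, m2, cv1, -⟩ := w1
  obtain ⟨-, -, m3, cv2, -⟩ := w2
  obtain ⟨n1, n2, s1, s2, o1, -⟩ := h0
  obtain ⟨n3, s3, -⟩ := h1
  obtain ⟨n4, n5, s4, s5, o2, -⟩ := h2
  have s1' := s1
  have s2' := s2
  have s3' := s3
  have s4' := s4
  have s5' := s5
  have f1 := cw_trans (hb.hA c mc |>.trans (hb.hB b2 n2)) r1 (hb.hA c mc |>.trans (hb.hB b3 n3))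
    s2.2 s3.1
  have f2 := cw_trans (hb.hA c mc |>.trans (hb.hB b3 n3)) r2 (hb.hA c mc |>.trans (hb.hB b4 n4))
    s3.2 s4.1
  have f3 := cw_trans (hb.hA c mc |>.trans (hb.hB b1 n1)) r1 (hb.hA c mc |>.trans (hb.hB b3 n3))
    s1.2 s3.1
  have f4 := cw_trans (hb.hA c mc |>.trans (hb.hB b1 n1)) (hb.hA c mc |>.trans (hb.hB b3 n3))
    (hb.hA c mc |>.trans (hb.hB b4 n4)) f3 f2
  have f5 := cw_trans (hb.hA c mc |>.trans (hb.hB b2 n2)) (hb.hA c mc |>.trans (hb.hB b3 n3))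
    (hb.hA c mc |>.trans (hb.hB b4 n4)) f1 f2
  have f6 := cw_trans (hb.hA c mc |>.trans (hb.hB b2 n2)) (hb.hA c mc |>.trans (hb.hB b4 n4))
    (hb.hA c mc |>.trans (hb.hB b5 n5)) f5 o2
  have d14 : b1 ≠ b4 := (ne23 f4).symm
  have d25 : b2 ≠ b5 := (ne23 f6).symm
  obtain ⟨s11, s12⟩ := s1'
  obtain ⟨s21, s22⟩ := s2'
  obtain ⟨s31, s32⟩ := s3'
  obtain ⟨s41, s42⟩ := s4'
  obtain ⟨s51, s52⟩ := s5'
  rcases L0 with ⟨u1, u2⟩ | ⟨u1, u2⟩ <;> rcases L2 with ⟨v1, v2⟩ | ⟨v1, v2⟩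
  · exact ⟨u1, v1⟩
  · exfalso
    apply cert_c212ud hb c a0 a1 a2 a3 b1 b2 b3 b4 b5 <;> first
      | with_reducible assumption
      | exact reg _ _ (by first | exact Or.inl rfl | exact Or.inr (by with_reducible assumption))
          (by first | exact Or.inl rfl | exact Or.inr (by with_reducible assumption))
  · exfalso
    apply cert_c212du hb c a0 a1 a2 a3 b1 b2 b3 b4 b5 <;> first
      | with_reducible assumption
      | exact reg _ _ (by first | exact Or.inl rfl | exact Or.inr (by with_reducible assumption))
          (by first | exact Or.inl rfl | exact Or.inr (by with_reducible assumption))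
  · exfalso
    apply cert_c212dd hb c a0 a1 a2 a3 b1 b2 b3 b4 b5 <;> first
      | with_reducible assumption
      | exact reg _ _ (by first | exact Or.inl rfl | exact Or.inr (by with_reducible assumption))
          (by first | exact Or.inl rfl | exact Or.inr (by with_reducible assumption))

/-- Pattern 2,2 followed by an empty wedge. -/
lemma loc_E2 {x0 : ℝ} {A B : Finset Pt} (hb : Base x0 A B) {c a0 a1 a2 a3 b1 b2 b3 b4 : Pt}
    (w0 : Wd A c a0 a1) (w1 : Wd A c a1 a2) (w2 : Wd A c a2 a3)
    (r1 : c.1 < a1.1) (r2 : c.1 < a2.1) (r3 : c.1 < a3.1) (e1 : a0 ≠ a2) (e2 : a1 ≠ a3)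
    (e3 : a0 ≠ a3) (hull : 0 < ori a1 a3 a2)
    (h0 : W2 B c a0 a1 b1 b2) (h1 : W2 B c a1 a2 b3 b4) (h2 : ∀ r ∈ B, ¬ In c a2 a3 r) :
    False := by
  have reg : ∀ u w, (u = a0 ∨ SI c a0 a1 u) → (w = a2 ∨ SI c a1 a2 w) →
      ∀ r ∈ A ∪ B, 0 ≤ ori u c r → 0 ≤ ori c w r → r ∈ [c, a0, a1, a2, a3, b1, b2, b3, b4] := by
    intro u w hu hw r hr g1 g2
    rcases K2 w0.conv w1.conv hu hw g1 g2 with h | h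
    · rcases w0.pts2 h0 hr h with e | e | e | e | e <;> simp [e]
    · rcases w1.pts2 h1 hr h with e | e | e | e | e <;> simp [e]
  have reg' : ∀ u w, (u = a0 ∨ SI c a0 a1 u) → (w = a3 ∨ SI c a2 a3 w) →
      ∀ r ∈ A ∪ B, 0 ≤ ori u c r → 0 ≤ ori c w r → r ∈ [c, a0, a1, a2, a3, b1, b2, b3, b4] := by
    intro u w hu hw r hr g1 g2
    rcases K3 w0.conv w2.conv hu hw g1 g2 with h | h | h
    · rcases w0.pts2 h0 hr h with e | e | e | e | e <;> simp [e]
    · rcases w1.pts2 h1 hr h with e | e | e | e | e <;> simp [e]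
    · rcases w2.pts0 h2 hr h with e | e | e <;> simp [e]
  have L0 := L_dich hb w0 h0
  have L2 := L_dich hb w1 h1
  obtain ⟨mc, m0, m1, cv0, -⟩ := w0
  obtain ⟨-, -, m2, cv1, -⟩ := w1
  obtain ⟨-, -, m3, cv2, -⟩ := w2
  obtain ⟨n1, n2, s1, s2, o1, -⟩ := h0
  obtain ⟨n3, n4, s3, s4, o2, -⟩ := h1
  have s1' := s1
  have s2' := s2
  have s3' := s3
  have s4' := s4
  obtain ⟨s11, s12⟩ := s1'
  obtain ⟨s21, s22⟩ := s2'
  obtain ⟨s31, s32⟩ := s3'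
  obtain ⟨s41, s42⟩ := s4'
  rcases L0 with ⟨u1, u2⟩ | ⟨u1, u2⟩ <;> rcases L2 with ⟨v1, v2⟩ | ⟨v1, v2⟩
  · apply cert_cE2uu hb c a0 a1 a2 a3 b1 b2 b3 b4 <;> first
      | with_reducible assumption
      | exact reg _ _ (by first | exact Or.inl rfl | exact Or.inr (by with_reducible assumption))
          (by first | exact Or.inl rfl | exact Or.inr (by with_reducible assumption))
      | exact reg' _ _ (by first | exact Or.inl rfl | exact Or.inr (by with_reducible assumption))
          (by first | exact Or.inl rfl | exact Or.inr (by with_reducible assumption))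
  · apply cert_cE2ud hb c a0 a1 a2 a3 b1 b2 b3 b4 <;> first
      | with_reducible assumption
      | exact reg _ _ (by first | exact Or.inl rfl | exact Or.inr (by with_reducible assumption))
          (by first | exact Or.inl rfl | exact Or.inr (by with_reducible assumption))
      | exact reg' _ _ (by first | exact Or.inl rfl | exact Or.inr (by with_reducible assumption))
          (by first | exact Or.inl rfl | exact Or.inr (by with_reducible assumption))
  · apply cert_cE2du hb c a0 a1 a2 a3 b1 b2 b3 b4 <;> first
      | with_reducible assumption
      | exact reg _ _ (by first | exact Or.inl rfl | exact Or.inr (by with_reducible assumption))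
          (by first | exact Or.inl rfl | exact Or.inr (by with_reducible assumption))
      | exact reg' _ _ (by first | exact Or.inl rfl | exact Or.inr (by with_reducible assumption))
          (by first | exact Or.inl rfl | exact Or.inr (by with_reducible assumption))
  · apply cert_cE2dd hb c a0 a1 a2 a3 b1 b2 b3 b4 <;> first
      | with_reducible assumption
      | exact reg _ _ (by first | exact Or.inl rfl | exact Or.inr (by with_reducible assumption))
          (by first | exact Or.inl rfl | exact Or.inr (by with_reducible assumption))
      | exact reg' _ _ (by first | exact Or.inl rfl | exact Or.inr (by with_reducible assumption))
          (by first | exact Or.inl rfl | exact Or.inr (by with_reducible assumption))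

/-- first point of `B` in a wedge, among those different from a given point -/
lemma first_pt {x0 : ℝ} {A B : Finset Pt} (hb : Base x0 A B) {c x y e : Pt} (w : Wd A c x y)
    (P : Pt → Prop) (he : e ∈ B) (hs : SI c x y e) (hp : P e) :
    ∃ p ∈ B, SI c x y p ∧ P p ∧ ∀ r ∈ B, In c x y r → P r → r = p ∨ 0 < ori c r p := by
  classical
  obtain ⟨p, hp1, hp2⟩ := angFirst (o := c) (z := x) (B.filter fun r => In c x y r ∧ P r)
    ⟨e, by simp [he, hs.In, hp]⟩ (by
      intro r hr
      simp only [Finset.mem_filter] at hr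
      exact (In.si hb w hr.1 hr.2.1).1)
  simp only [Finset.mem_filter] at hp1
  refine ⟨p, hp1.1, In.si hb w hp1.1 hp1.2.1, hp1.2.2, ?_⟩
  intro r hr hi hP
  by_cases e : r = p
  · exact Or.inl e
  · right
    have := hp2 r (by simp [hr, hi, hP])
    exact lt_of_le_of_ne this (hb.gp c (inA w.mc) r (inB hr) p (inB hp1.1) (hb.neAB w.mc hr)
      (hb.neAB w.mc hp1.1) e).symm

lemma not_both {c p q : Pt} (h : 0 < ori c p q) (h' : 0 ≤ ori c q p) : False := by
  rw [ori_sw] at h'; linarith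

/-- Pattern 2,2 followed by a wedge with at least two points, remaining case. -/
lemma loc_R {x0 : ℝ} {A B : Finset Pt} (hb : Base x0 A B) {c a0 a1 a2 a3 b1 b2 b3 b4 e e' : Pt}
    (w0 : Wd A c a0 a1) (w1 : Wd A c a1 a2) (w2 : Wd A c a2 a3)
    (r1 : c.1 < a1.1) (r2 : c.1 < a2.1)
    (h0 : W2 B c a0 a1 b1 b2) (h1 : W2 B c a1 a2 b3 b4) (he : e ∈ B) (he' : e' ∈ B) (hee : e ≠ e')
    (hs : SI c a2 a3 e) (hs' : SI c a2 a3 e')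
    (hall : ∀ r ∈ B, In c a0 a1 r ∨ In c a1 a2 r ∨ In c a2 a3 r)
    (L2 : (0 < ori b3 b4 a1 ∧ 0 < ori b4 b3 a2) ∨ (0 < ori b4 b3 a1 ∧ 0 < ori b3 b4 a2))
    (u1 : 0 < ori b1 b2 a0) (u2 : 0 < ori b2 b1 a1) (z : 0 < ori b1 a2 a1)
    (y' : 0 < ori c a0 a2) : False := by
  classical
  have reg : ∀ u w, (u = a0 ∨ SI c a0 a1 u) → (w = a2 ∨ SI c a1 a2 w) →
      ∀ r ∈ A ∪ B, 0 ≤ ori u c r → 0 ≤ ori c w r →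
        r = c ∨ r = a0 ∨ r = a1 ∨ r = a2 ∨ r = b1 ∨ r = b2 ∨ r = b3 ∨ r = b4 := by
    intro u w hu hw r hr g1 g2
    rcases K2 w0.conv w1.conv hu hw g1 g2 with h | h
    · rcases w0.pts2 h0 hr h with e | e | e | e | e <;> simp [e]
    · rcases w1.pts2 h1 hr h with e | e | e | e | e <;> simp [e]
  have big : ∀ u w, (u = a0 ∨ SI c a0 a1 u) → SI c a2 a3 w →
      ∀ r ∈ A ∪ B, 0 ≤ ori u c r → 0 ≤ ori c w r →
        (r = c ∨ r = a0 ∨ r = a1 ∨ r = a2 ∨ r = b1 ∨ r = b2 ∨ r = b3 ∨ r = b4) ∨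
        (r ∈ B ∧ SI c a2 a3 r) := by
    intro u w hu hw r hr g1 g2
    rcases K3 w0.conv w2.conv hu (Or.inr hw) g1 g2 with h | h | h
    · rcases w0.pts2 h0 hr h with e | e | e | e | e <;> simp [e]
    · rcases w1.pts2 h1 hr h with e | e | e | e | e <;> simp [e]
    · rcases Finset.mem_union.1 hr with hA | hB
      · rcases w2.wA r hA h with h' | h' | h'
        · simp [h']
        · simp [h']
        · subst h'
          exact (not_both hw.2 g2).elim
      · exact Or.inr ⟨hB, In.si hb w2 hB h⟩
  obtain ⟨p, np, sp, -, hfst⟩ := first_pt hb w2 (fun _ => True) he hs trivial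
  obtain ⟨s, ns, ss, hsp, hsnd⟩ : ∃ s ∈ B, SI c a2 a3 s ∧ s ≠ p ∧
      ∀ r ∈ B, In c a2 a3 r → r ≠ p → r = s ∨ 0 < ori c r s := by
    by_cases h : e = p
    · exact first_pt hb w2 (fun r => r ≠ p) he' hs' (fun h' => hee (h.trans h'.symm))
    · exact first_pt hb w2 (fun r => r ≠ p) he hs h
  have osp : 0 < ori c s p := (hfst s ns ss.In trivial).resolve_left hsp
  have w0' := w0
  have w1' := w1
  have w2' := w2
  obtain ⟨mc, m0, m1, cv0, -⟩ := w0
  obtain ⟨-, -, m2, cv1, -⟩ := w1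
  have h0' := h0
  have h1' := h1
  obtain ⟨-, -, m3, cv2, wA2⟩ := w2
  obtain ⟨n1, n2, s1, s2, o1, -⟩ := h0
  obtain ⟨n3, n4, s3, s4, o2, -⟩ := h1
  have s1' := s1
  have s2' := s2
  have s3' := s3
  have s4' := s4
  have sp' := sp
  obtain ⟨s11, s12⟩ := s1'
  obtain ⟨s21, s22⟩ := s2'
  obtain ⟨s31, s32⟩ := s3'
  obtain ⟨s41, s42⟩ := s4'
  obtain ⟨sp1, sp2⟩ := sp'
  have rc : ∀ b ∈ B, c.1 < b.1 := fun b hb' => (hb.hA c mc).trans (hb.hB b hb')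
  have d23 : b2 ≠ b3 := (ne23 (cw_trans (rc b2 n2) r1 (rc b3 n3) s22 s31)).symm
  rcases hb.dich (inB np) (inB ns) (inA m2) hsp.symm (hb.neAB m2 np).symm (hb.neAB m2 ns).symm
    with k | k
  · have R0 : ∀ r ∈ A ∪ B, 0 ≤ ori b1 c r → 0 ≤ ori c a2 r →
        r ∈ [c, a0, a1, a2, b1, b2, b3, b4, p, s] := by
      intro r hr g1 g2
      rcases reg b1 a2 (Or.inr s1) (Or.inl rfl) r hr g1 g2 with e | e | e | e | e | e | e | e <;> simp [e]
    have R1 : ∀ r ∈ A ∪ B, 0 ≤ ori b1 c r → 0 ≤ ori c s r →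
        r ∈ [c, a0, a1, a2, b1, b2, b3, b4, p, s] := by
      intro r hr g1 g2
      rcases big b1 s (Or.inr s1) ss r hr g1 g2 with h | ⟨hB, h⟩
      · rcases h with e | e | e | e | e | e | e | e <;> simp [e]
      · by_cases e1 : r = p
        · simp [e1]
        · rcases hsnd r hB h.In e1 with h' | h'
          · simp [h']
          · exact (not_both h' g2).elim
    rcases L2 with ⟨v1, v2⟩ | ⟨v1, v2⟩
    · apply cert_cR1uu hb c a0 a1 a2 b1 b2 b3 b4 p s <;> with_reducible assumption
    · apply cert_cR1ud hb c a0 a1 a2 b1 b2 b3 b4 p s <;> with_reducible assumption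
  obtain ⟨q, hq, hqmin⟩ := angLast (o := p) (z := c)
    (B.filter fun r => In c a2 a3 r ∧ r ≠ p) ⟨s, by simp [ns, ss.In, hsp]⟩ (by
      intro r hr
      simp only [Finset.mem_filter] at hr
      have := (hfst r hr.1 hr.2.1 trivial).resolve_left hr.2.2
      rwa [ori_rot, ori_rot] at this)
  simp only [Finset.mem_filter] at hq
  obtain ⟨nq, iq, hqp⟩ := hq
  have sq := In.si hb w2' nq iq
  have oqp : 0 < ori c q p := (hfst q nq iq trivial).resolve_left hqp
  have hqm : ∀ r ∈ B, In c a2 a3 r → r = p ∨ r = q ∨ 0 < ori p q r := by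
    intro r hr hi
    by_cases e1 : r = p
    · exact Or.inl e1
    by_cases e2 : r = q
    · exact Or.inr (Or.inl e2)
    have := hqmin r (by simp [hr, hi, e1])
    exact Or.inr (Or.inr (lt_of_le_of_ne this (hb.gp p (inB np) q (inB nq) r (inB hr)
      (Ne.symm hqp) (Ne.symm e1) (Ne.symm e2)).symm))
  have k2 : 0 < ori q p a2 := by
    rcases hb.dich (inB nq) (inB np) (inA m2) hqp (hb.neAB m2 nq).symm (hb.neAB m2 np).symm
      with h | h
    · exact h
    · exfalso
      rcases hqm s ns ss.In with h' | h' | h'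
      · exact hsp h'
      · subst h'
        rw [ori_swap] at k; linarith
      · apply cert_Ra hb c a2 p q s <;> with_reducible assumption
  have hswap : ∀ r, 0 < ori p q r → 0 ≤ ori q p r → False := by
    intro r g1 g2
    rw [ori_swap] at g2; linarith
  rcases hb.dich (inB np) (inB nq) (inA m0) hqp.symm (hb.neAB m0 np).symm (hb.neAB m0 nq).symm
    with k3 | k3
  · have R0 : ∀ r ∈ A ∪ B, 0 ≤ ori b1 c r → 0 ≤ ori c q r → 0 ≤ ori q p r →
        r ∈ [c, a0, a1, a2, b1, b2, b3, b4, p, q] := by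
      intro r hr g1 g2 g3
      rcases big b1 q (Or.inr s1) sq r hr g1 g2 with h | ⟨hB, h⟩
      · rcases h with e | e | e | e | e | e | e | e <;> simp [e]
      · rcases hqm r hB h.In with h' | h' | h'
        · simp [h']
        · simp [h']
        · exact (hswap r h' g3).elim
    rcases L2 with ⟨v1, v2⟩ | ⟨v1, v2⟩
    · apply cert_cR2uu hb c a0 a1 a2 b1 b2 b3 b4 p q <;> with_reducible assumption
    · apply cert_cR2ud hb c a0 a1 a2 b1 b2 b3 b4 p q <;> with_reducible assumption
  obtain ⟨x, hx, hxmin⟩ := angFirst (o := c) (z := a2)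
    (A.filter fun r => 0 < ori c r a2 ∧ 0 < ori q p r) ⟨a0, by simp [m0, y', k3]⟩ (by
      intro r hr
      simp only [Finset.mem_filter] at hr
      exact hr.2.1)
  simp only [Finset.mem_filter] at hx
  obtain ⟨mx, ox, kx⟩ := hx
  have cone : ∀ w ∈ B, SI c a2 a3 w → 0 < ori c x w := by
    intro w hw hsi
    by_contra hcon
    push Not at hcon
    have hcon' : 0 ≤ ori c w x := by rw [ori_sw]; linarith
    rcases hi1 cv2 hsi hcon' with h | h
    · rcases wA2 x mx ⟨ox.le, h⟩ with h' | h' | h'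
      · exact ne12 ox h'.symm
      · exact ne23 ox h'
      · rw [h'] at hcon'
        exact not_both hsi.2 hcon'
    · exact not_both ox h.le
  refine cert_Vh hb c a2 x p q mc m2 mx np nq sp1 oqp (cone q nq sq) ox sq.1 (cone p np sp) k2 kx ?_
  intro r hr g1 g2 g3
  rw [ori_rot] at g1
  rcases Finset.mem_union.1 hr with hA | hB
  · by_cases f1 : r = c
    · simp [f1]
    by_cases f2 : r = a2
    · simp [f2]
    by_cases f3 : r = x
    · simp [f3]
    exfalso
    have t1 := hb.gp c (inA mc) r hr a2 (inA m2) (Ne.symm f1) (ne12 cv1) f2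
    have t2 := hb.gp q (inB nq) p (inB np) r hr hqp (hb.neAB hA nq).symm (hb.neAB hA np).symm
    have t3 := hb.gp c (inA mc) x (inA mx) r hr (ne12 ox) (Ne.symm f1) (Ne.symm f3)
    have := hxmin r (by
      simp only [Finset.mem_filter]
      exact ⟨hA, lt_of_le_of_ne g1 t1.symm, lt_of_le_of_ne g3 t2.symm⟩)
    exact not_both (lt_of_le_of_ne g2 t3.symm) this
  · rcases hall r hB with h | h | h
    · exfalso
      have h := In.si hb w0' hB h
      exact not_both (cw_trans (rc r hB) r1 r2 h.2 cv1) g1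
    · exfalso
      have h := In.si hb w1' hB h
      exact not_both h.2 g1
    · rcases hqm r hB h with h' | h' | h'
      · simp [h']
      · simp [h']
      · exact (hswap r h' g3).elim

/-- Pattern 2,2 followed by a nonempty wedge. -/
lemma loc_E1 {x0 : ℝ} {A B : Finset Pt} (hb : Base x0 A B) {c a0 a1 a2 a3 b1 b2 b3 b4 e : Pt}
    (w0 : Wd A c a0 a1) (w1 : Wd A c a1 a2) (w2 : Wd A c a2 a3)
    (r1 : c.1 < a1.1) (r2 : c.1 < a2.1) (e1 : a0 ≠ a2) (e2 : a1 ≠ a3)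
    (hull : c.1 < a3.1 → 0 < ori a1 a3 a2)
    (h0 : W2 B c a0 a1 b1 b2) (h1 : W2 B c a1 a2 b3 b4) (he : e ∈ B) (hs : SI c a2 a3 e)
    (hcnt : ¬ c.1 < a3.1 → ¬ c.1 < a0.1 →
      (∃ p ∈ B, ∃ s ∈ B, p ≠ s ∧ SI c a2 a3 p ∧ SI c a2 a3 s) ∧
      ∀ r ∈ B, In c a0 a1 r ∨ In c a1 a2 r ∨ In c a2 a3 r) :
    False := by
  obtain ⟨b5, n5, s5, -, hfst⟩ := first_pt hb w2 (fun _ => True) he hs trivial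
  have reg : ∀ u w, (u = a0 ∨ SI c a0 a1 u) → (w = a2 ∨ SI c a1 a2 w) →
      ∀ r ∈ A ∪ B, 0 ≤ ori u c r → 0 ≤ ori c w r →
        r = c ∨ r = a0 ∨ r = a1 ∨ r = a2 ∨ r = b1 ∨ r = b2 ∨ r = b3 ∨ r = b4 := by
    intro u w hu hw r hr g1 g2
    rcases K2 w0.conv w1.conv hu hw g1 g2 with h | h
    · rcases w0.pts2 h0 hr h with e | e | e | e | e <;> simp [e]
    · rcases w1.pts2 h1 hr h with e | e | e | e | e <;> simp [e]
  have reg1 : ∀ u w, (u = a0 ∨ SI c a0 a1 u) → (w = a2 ∨ SI c a1 a2 w) →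
      ∀ r ∈ A ∪ B, 0 ≤ ori u c r → 0 ≤ ori c w r → r ∈ [c, a0, a1, a2, b1, b2, b3, b4, b5] := by
    intro u w hu hw r hr g1 g2
    rcases reg u w hu hw r hr g1 g2 with e | e | e | e | e | e | e | e <;> simp [e]
  have big : ∀ u w, (u = a0 ∨ SI c a0 a1 u) → SI c a2 a3 w →
      ∀ r ∈ A ∪ B, 0 ≤ ori u c r → 0 ≤ ori c w r →
        (r = c ∨ r = a0 ∨ r = a1 ∨ r = a2 ∨ r = b1 ∨ r = b2 ∨ r = b3 ∨ r = b4) ∨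
        (r ∈ B ∧ SI c a2 a3 r) := by
    intro u w hu hw r hr g1 g2
    rcases K3 w0.conv w2.conv hu (Or.inr hw) g1 g2 with h | h | h
    · rcases w0.pts2 h0 hr h with e | e | e | e | e <;> simp [e]
    · rcases w1.pts2 h1 hr h with e | e | e | e | e <;> simp [e]
    · rcases Finset.mem_union.1 hr with hA | hB
      · rcases w2.wA r hA h with h' | h' | h'
        · simp [h']
        · simp [h']
        · subst h'
          exact (not_both hw.2 g2).elim
      · exact Or.inr ⟨hB, In.si hb w2 hB h⟩
  have reg' : ∀ u, (u = a0 ∨ SI c a0 a1 u) →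
      ∀ r ∈ A ∪ B, 0 ≤ ori u c r → 0 ≤ ori c b5 r → r ∈ [c, a0, a1, a2, b1, b2, b3, b4, b5] := by
    intro u hu r hr g1 g2
    rcases big u b5 hu s5 r hr g1 g2 with h | ⟨hB, h⟩
    · rcases h with e | e | e | e | e | e | e | e <;> simp [e]
    · rcases hfst r hB h.In trivial with h' | h'
      · simp [h']
      · exact (not_both h' g2).elim
  have L0 := L_dich hb w0 h0
  have L2 := L_dich hb w1 h1
  have w0' := w0
  have w1' := w1
  have w2' := w2
  obtain ⟨mc, m0, m1, cv0, -⟩ := w0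
  obtain ⟨-, -, m2, cv1, -⟩ := w1
  have h0' := h0
  have h1' := h1
  obtain ⟨-, -, m3, cv2, wA2⟩ := w2
  obtain ⟨n1, n2, s1, s2, o1, -⟩ := h0
  obtain ⟨n3, n4, s3, s4, o2, -⟩ := h1
  have s1' := s1
  have s2' := s2
  have s3' := s3
  have s4' := s4
  have s5' := s5
  obtain ⟨s11, s12⟩ := s1'
  obtain ⟨s21, s22⟩ := s2'
  obtain ⟨s31, s32⟩ := s3'
  obtain ⟨s41, s42⟩ := s4'
  obtain ⟨s51, s52⟩ := s5'
  have rc : ∀ b ∈ B, c.1 < b.1 := fun b hb' => (hb.hA c mc).trans (hb.hB b hb')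
  rcases L0 with ⟨u1, u2⟩ | ⟨u1, u2⟩
  rotate_left
  · rcases L2 with ⟨v1, v2⟩ | ⟨v1, v2⟩
    · apply cert_cE1du hb c a0 a1 a2 b1 b2 b3 b4 b5 <;> first
        | with_reducible assumption
        | exact reg1 _ _ (by first | exact Or.inl rfl | exact Or.inr (by with_reducible assumption))
            (by first | exact Or.inl rfl | exact Or.inr (by with_reducible assumption))
        | exact reg' _ (by first | exact Or.inl rfl | exact Or.inr (by with_reducible assumption))
    · apply cert_cE1dd hb c a0 a1 a2 b1 b2 b3 b4 b5 <;> first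
        | with_reducible assumption
        | exact reg1 _ _ (by first | exact Or.inl rfl | exact Or.inr (by with_reducible assumption))
            (by first | exact Or.inl rfl | exact Or.inr (by with_reducible assumption))
        | exact reg' _ (by first | exact Or.inl rfl | exact Or.inr (by with_reducible assumption))
  rcases hb.dich (inA m2) (inB n1) (inA m1) (hb.neAB m2 n1) (ne23 cv1) (hb.neAB m1 n1).symm
    with z | z
  · rcases L2 with ⟨v1, v2⟩ | ⟨v1, v2⟩
    · apply cert_cE1uu hb c a0 a1 a2 b1 b2 b3 b4 b5 <;> first
        | with_reducible assumption
        | exact reg1 _ _ (by first | exact Or.inl rfl | exact Or.inr (by with_reducible assumption))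
            (by first | exact Or.inl rfl | exact Or.inr (by with_reducible assumption))
        | exact reg' _ (by first | exact Or.inl rfl | exact Or.inr (by with_reducible assumption))
    · apply cert_cE1ud hb c a0 a1 a2 b1 b2 b3 b4 b5 <;> first
        | with_reducible assumption
        | exact reg1 _ _ (by first | exact Or.inl rfl | exact Or.inr (by with_reducible assumption))
            (by first | exact Or.inl rfl | exact Or.inr (by with_reducible assumption))
        | exact reg' _ (by first | exact Or.inl rfl | exact Or.inr (by with_reducible assumption))
  have y' : 0 < ori c a2 a0 ∨ 0 < ori c a0 a2 := by
    have := hb.dich (inA mc) (inA m2) (inA m0) (ne12 cv1) (ne13 cv0) e1.symm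
    rcases this with h | h
    · exact Or.inl h
    · right; rw [ori_rot, ori_rot]; exact h
  rcases y' with y' | y'
  · apply cert_cY hb c a0 a1 a2 b1 b2 b3 b4 <;> try with_reducible assumption
    intro r hr g1 g2
    rcases reg a0 a2 (Or.inl rfl) (Or.inl rfl) r hr g1 g2 with e | e | e | e | e | e | e | e <;> simp [e]
  have ra0 : ¬ c.1 < a0.1 := fun h => not_both y' (cw_trans h r1 r2 cv0 cv1).le
  by_cases r3 : c.1 < a3.1
  · have hul := hull r3
    apply cert_cZ hb c a1 a2 a3 b1 b2 b3 b4 <;> try with_reducible assumption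
    intro r hr g1 g2 g3
    rcases K3 cv0 cv2 (Or.inr s1) (Or.inl rfl) g1 g2 with h | h | h
    · have hne : r ≠ a0 := by
        rintro rfl
        rw [ori_rot] at g1
        exact not_both s11 g1
      rcases w0'.pts2 h0' hr h with e | e | e | e | e
      · simp [e]
      · exact absurd e hne
      · simp [e]
      · simp [e]
      · simp [e]
    · rcases w1'.pts2 h1' hr h with e | e | e | e | e <;> simp [e]
    · rcases Finset.mem_union.1 hr with hA | hB
      · rcases wA2 r hA h with e | e | e <;> simp [e]
      · exfalso
        have hsi := In.si hb w2' hB h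
        have h3 := hb.gp a3 (inA m3) a2 (inA m2) r (inB hB) (ne23 cv2) (hb.neAB m3 hB)
          (hb.neAB m2 hB)
        exact cert_Zr hb c a2 a3 r mc m2 m3 hB hsi.1 hsi.2 (lt_of_le_of_ne g3 h3.symm)
  obtain ⟨⟨p0, hp0, q0, hq0, hpq, sp0, sq0⟩, hall⟩ := hcnt r3 ra0
  exact loc_R hb w0' w1' w2' r1 r2 h0' h1' hp0 hq0 hpq sp0 sq0 hall L2 u1 u2 z y'


/-- The three regions of a chain 2,1,1. -/
lemma reg211 {A B : Finset Pt} {c a0 a1 a2 a3 b1 b2 b3 b4 : Pt}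
    (w0 : Wd A c a0 a1) (w1 : Wd A c a1 a2) (w2 : Wd A c a2 a3)
    (h0 : W2 B c a0 a1 b1 b2) (h1 : W1 B c a1 a2 b3) (h2 : W1 B c a2 a3 b4) (u w : Pt)
    (hu : u = a0 ∨ SI c a0 a1 u) (hw : w = a2 ∨ w = a3 ∨ SI c a2 a3 w) :
    ∀ r ∈ A ∪ B, 0 ≤ ori u c r → 0 ≤ ori c w r → r ∈ [c, a0, a1, a2, a3, b1, b2, b3, b4] := by
  intro r hr g1 g2
  rcases hw with hw | hw
  · rcases K2 w0.conv w1.conv hu (Or.inl hw) g1 g2 with h | h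
    · rcases w0.pts2 h0 hr h with e | e | e | e | e <;> simp [e]
    · rcases w1.pts1 h1 hr h with e | e | e | e <;> simp [e]
  · rcases K3 w0.conv w2.conv hu hw g1 g2 with h | h | h
    · rcases w0.pts2 h0 hr h with e | e | e | e | e <;> simp [e]
    · rcases w1.pts1 h1 hr h with e | e | e | e <;> simp [e]
    · rcases w2.pts1 h2 hr h with e | e | e | e <;> simp [e]

lemma su_loc {x0 : ℝ} {A B : Finset Pt} (hb : Base x0 A B) {c a0 a1 a2 a3 b1 b2 b3 b4 : Pt}
    (w0 : Wd A c a0 a1) (w1 : Wd A c a1 a2) (w2 : Wd A c a2 a3)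
    (r1 : c.1 < a1.1) (r2 : c.1 < a2.1) (r3 : c.1 < a3.1) (hull : 0 < ori a1 a3 a2)
    (h0 : W2 B c a0 a1 b1 b2) (h1 : W1 B c a1 a2 b3) (h2 : W1 B c a2 a3 b4)
    (u1 : 0 < ori b1 b2 a0) (u2 : 0 < ori b2 b1 a1) : 0 < ori b2 b3 a2 := by
  have reg := reg211 w0 w1 w2 h0 h1 h2
  have rc : ∀ b ∈ B, c.1 < b.1 := fun b hb' => (hb.hA c w0.mc).trans (hb.hB b hb')
  have f1 := cw_trans (rc b2 h0.m2) r1 (rc b3 h1.m1) h0.s2.2 h1.s1.1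
  rcases hb.dich (inB h0.m2) (inB h1.m1) (inA w1.my) (ne23 f1).symm (hb.neAB w1.my h0.m2).symm
    (hb.neAB w1.my h1.m1).symm with h | h
  · exact h
  exfalso
  refine cert_su hb c a0 a1 a2 a3 b1 b2 b3 b4 w0.mc w0.mx w1.mx w2.mx w2.my h0.m1 h0.m2 h1.m1 h2.m1
    r1 r2 r3 h0.s1.1 w0.conv h0.o h0.s2.2 h1.s1.1 h1.s1.2 h2.s1.1 h2.s1.2 u1 u2 hull h
    (reg _ _ (Or.inl rfl) (Or.inr (Or.inr h2.s1))) (reg _ _ (Or.inl rfl) (Or.inr (Or.inl rfl)))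
    (reg _ _ (Or.inr h0.s1) (Or.inl rfl)) (reg _ _ (Or.inr h0.s1) (Or.inr (Or.inr h2.s1)))
    (reg _ _ (Or.inr h0.s1) (Or.inr (Or.inl rfl)))

lemma prop0_loc {x0 : ℝ} {A B : Finset Pt} (hb : Base x0 A B) {c a0 a1 a2 a3 b1 b2 b3 b4 : Pt}
    (w0 : Wd A c a0 a1) (w1 : Wd A c a1 a2) (w2 : Wd A c a2 a3)
    (r1 : c.1 < a1.1) (r2 : c.1 < a2.1) (r3 : c.1 < a3.1) (hull : 0 < ori a1 a3 a2)
    (h0 : W2 B c a0 a1 b1 b2) (h1 : W1 B c a1 a2 b3) (h2 : W1 B c a2 a3 b4)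
    (u2 : 0 < ori b1 b2 a1) : 0 < ori b1 b3 a2 := by
  have reg := reg211 w0 w1 w2 h0 h1 h2
  have reg' : ∀ w, (w = a2 ∨ w = a3) → ∀ r ∈ A ∪ B, 0 ≤ ori b1 c r → 0 ≤ ori c w r →
      r ∈ [c, a1, a2, a3, b1, b2, b3, b4] := by
    intro w hw r hr g1 g2
    have key := reg b1 w (Or.inr h0.s1) (by rcases hw with h | h <;> simp [h]) r hr g1 g2
    have hne : r ≠ a0 := by
      rintro rfl
      rw [ori_rot] at g1
      exact not_both h0.s1.1 g1
    simp only [List.mem_cons, hne, false_or] at key ⊢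
    exact key
  have rc : ∀ b ∈ B, c.1 < b.1 := fun b hb' => (hb.hA c w0.mc).trans (hb.hB b hb')
  have f1 := cw_trans (rc b1 h0.m1) r1 (rc b3 h1.m1) h0.s1.2 h1.s1.1
  rcases hb.dich (inB h0.m1) (inB h1.m1) (inA w1.my) (ne23 f1).symm (hb.neAB w1.my h0.m1).symm
    (hb.neAB w1.my h1.m1).symm with h | h
  · exact h
  exfalso
  exact cert_prop0 hb c a1 a2 a3 b1 b2 b3 b4 w0.mc w1.mx w2.mx w2.my h0.m1 h0.m2 h1.m1 h2.m1
    r1 r2 r3 h0.o h0.s2.2 h1.s1.1 h1.s1.2 h2.s1.1 h2.s1.2 hull u2 h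
    (reg' _ (Or.inl rfl)) (reg' _ (Or.inr rfl))

/-- State of the sweep: `f n` is an edge seen from `c` with the point `x` beyond it. -/
structure Dn (A B : Finset Pt) (c x f n : Pt) : Prop where
  mf : f ∈ B
  mn : n ∈ B
  ofn : 0 < ori c n f
  onx : 0 < ori c x n
  bey : 0 < ori f n x
  emp : ∀ r ∈ A ∪ B, 0 < ori c r f → 0 < ori c x r → r ≠ n → 0 < ori n f r

/-- empty region for a sweep state -/
lemma Dn.reg {x0 : ℝ} {A B : Finset Pt} (hb : Base x0 A B) {c x y f n r : Pt} (w : Wd A c x y)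
    (D : Dn A B c x f n) (hr : r ∈ A ∪ B) (h1 : 0 ≤ ori f c r)
    (h2 : 0 ≤ ori c y r ∨ 0 < ori c x r) (h3 : 0 ≤ ori f n r) :
    r = c ∨ r = f ∨ r = n ∨ In c x y r := by
  rw [ori_rot] at h1
  by_cases e1 : r = c
  · exact Or.inl e1
  by_cases e2 : r = f
  · exact Or.inr (Or.inl e2)
  by_cases e3 : r = n
  · exact Or.inr (Or.inr (Or.inl e3))
  have g := hb.gp c (inA w.mc) r hr f (inB D.mf) (Ne.symm e1) (hb.neAB w.mc D.mf) e2
  have h1' : 0 < ori c r f := lt_of_le_of_ne h1 g.symm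
  rcases lt_or_ge 0 (ori c x r) with h | h
  · exfalso
    have := D.emp r hr h1' h e3
    rw [ori_swap] at this
    linarith
  · right; right; right
    refine ⟨by rw [ori_sw]; linarith, ?_⟩
    rcases h2 with h2 | h2
    · exact h2
    · linarith

lemma Dn.step {x0 : ℝ} {A B : Finset Pt} (hb : Base x0 A B) {c x y f n m : Pt} (w : Wd A c x y)
    (D : Dn A B c x f n) (hx : c.1 < x.1) (h1 : W1 B c x y m) (hm : 0 < ori f m y) :
    Dn A B c y f m := by
  have rc : ∀ b ∈ B, c.1 < b.1 := fun b hb' => (hb.hA c w.mc).trans (hb.hB b hb')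
  have f1 : 0 < ori c m n := cw_trans (rc n D.mn) hx (rc m h1.m1) D.onx h1.s1.1
  have f2 : 0 < ori c m f := cw_trans (rc f D.mf) (rc n D.mn) (rc m h1.m1) D.ofn f1
  refine ⟨D.mf, h1.m1, f2, h1.s1.2, hm, ?_⟩
  intro r hr g1 g2 g3
  have hd := hb.dich (inB h1.m1) (inB D.mf) hr (ne23 f2) g3.symm (ne23 g1).symm
  rcases hd with hd | hd
  · exact hd
  exfalso
  by_cases e1 : r = x
  · subst e1
    exact cert_emptA hb c r y f n m w.mc w.mx w.my D.mf D.mn h1.m1 hx D.ofn D.onx h1.s1.1 D.bey hd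
  rcases lt_or_ge 0 (ori c x r) with h | h
  · by_cases e2 : r = n
    · subst e2
      exact cert_emptN hb c x y f r m w.mc w.mx w.my D.mf D.mn h1.m1 hx D.ofn D.onx h1.s1.1 D.bey hd
    have h6 := D.emp r hr g1 h e2
    rcases Finset.mem_union.1 hr with hA | hB
    · exact cert_emptR hb c x y r f n m w.mc w.mx w.my hA D.mf D.mn h1.m1 hx D.ofn D.onx h1.s1.1
        D.bey g1 h6 hd
    · exact cert_emptRB hb c x y f n m r w.mc w.mx w.my D.mf D.mn h1.m1 hB hx D.ofn D.onx h1.s1.1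
        D.bey g1 h6 hd
  · rcases w.pts1 h1 hr ⟨by rw [ori_sw]; linarith, g2.le⟩ with e | e | e | e
    · exact ne12 g1 e.symm
    · exact e1 e
    · exact ne23 g2 e.symm
    · exact g3 e

lemma prop_loc {x0 : ℝ} {A B : Finset Pt} (hb : Base x0 A B) {c a1 a2 a3 f n m : Pt}
    (w1 : Wd A c a1 a2) (w2 : Wd A c a2 a3)
    (r1 : c.1 < a1.1) (r2 : c.1 < a2.1) (r3 : c.1 < a3.1)
    (h1 : W1 B c a1 a2 n) (h2 : W1 B c a2 a3 m) (D : Dn A B c a2 f n) (hf : 0 < ori c a1 f) :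
    Dn A B c a3 f m := by
  refine D.step hb w2 r2 h2 ?_
  have rc : ∀ b ∈ B, c.1 < b.1 := fun b hb' => (hb.hA c w1.mc).trans (hb.hB b hb')
  have f1 : 0 < ori c m n := cw_trans (rc n D.mn) r2 (rc m h2.m1) D.onx h2.s1.1
  have f2 : 0 < ori c m f := cw_trans (rc f D.mf) (rc n D.mn) (rc m h2.m1) D.ofn f1
  rcases hb.dich (inB D.mf) (inB h2.m1) (inA w2.my) (ne23 f2).symm (hb.neAB w2.my D.mf).symm
    (hb.neAB w2.my h2.m1).symm with h | h
  · exact h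
  exfalso
  refine cert_prop hb c a1 a2 a3 f n m w1.mc w1.mx w1.my w2.my D.mf D.mn h2.m1 r1 r2 r3 hf h1.s1.1
    h1.s1.2 h2.s1.1 h2.s1.2 D.bey h ?_ ?_
  · intro r hr g1 g2
    rcases K2 w1.conv w2.conv (Or.inl rfl) (Or.inl rfl) g1 g2 with h | h
    · rcases w1.pts1 h1 hr h with e | e | e | e <;> simp [e]
    · rcases w2.pts1 h2 hr h with e | e | e | e <;> simp [e]
  · intro r hr g1 g2 g3
    rcases D.reg hb w2 hr g1 (Or.inl g2) g3 with e | e | e | h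
    · simp [e]
    · simp [e]
    · simp [e]
    · rcases w2.pts1 h2 hr h with e | e | e | e <;> simp [e]

lemma Dn.regq {x0 : ℝ} {A B : Finset Pt} (hb : Base x0 A B) {c x y f n p q r : Pt} (w : Wd A c x y)
    (D : Dn A B c x f n) (h : W2 B c x y p q) (hr : r ∈ A ∪ B) (g1 : 0 ≤ ori f c r)
    (g2 : 0 ≤ ori c q r) (g3 : 0 ≤ ori f n r) :
    r = c ∨ r = x ∨ r = f ∨ r = n ∨ r = p ∨ r = q := by
  rcases D.reg hb w hr g1 (hi1 w.conv h.s2 g2) g3 with e | e | e | h'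
  · simp [e]
  · simp [e]
  · simp [e]
  · rcases w.pts2 h hr h' with e | e | e | e | e
    · simp [e]
    · simp [e]
    · subst e
      exact (not_both h.s2.2 g2).elim
    · simp [e]
    · simp [e]

lemma cX_loc {x0 : ℝ} {A B : Finset Pt} (hb : Base x0 A B) {c x y f n p q : Pt}
    (w : Wd A c x y) (D : Dn A B c x f n) (hx : c.1 < x.1) (h : W2 B c x y p q) :
    0 < ori q p x ∧ 0 < ori p q y := by
  rcases L_dich hb w h with ⟨h1, h2⟩ | hh
  · exfalso
    refine cert_cX hb c x f n p q w.mc w.mx D.mf D.mn h.m1 h.m2 hx D.ofn D.onx h.s1.1 h.o D.bey h1 ?_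
    intro r hr g1 g2 g3
    rcases D.regq hb w h hr g1 g2 g3 with e | e | e | e | e | e <;> simp [e]
  · exact hh

lemma cUD_loc {x0 : ℝ} {A B : Finset Pt} (hb : Base x0 A B) {c v x y f n p q : Pt}
    (w0 : Wd A c v x) (w : Wd A c x y) (D : Dn A B c x f n) (hv : c.1 < v.1) (hx : c.1 < x.1)
    (hf : 0 < ori c v f) (hn : 0 < ori c n v) (hnp : 0 < ori n p v)
    (h : W2 B c x y p q) : 0 < ori p q f := by
  have rc : ∀ b ∈ B, c.1 < b.1 := fun b hb' => (hb.hA c w.mc).trans (hb.hB b hb')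
  have f0 := cw_trans (rc f D.mf) (rc n D.mn) hx D.ofn D.onx
  have f1 := cw_trans (rc f D.mf) hx (rc p h.m1) f0 h.s1.1
  have f2 := cw_trans (rc f D.mf) hx (rc q h.m2) f0 h.s2.1
  rcases hb.dich (inB h.m1) (inB h.m2) (inB D.mf) (ne23 h.o).symm (ne23 f1) (ne23 f2) with k | k
  · exact k
  exfalso
  refine cert_cUD hb c v x f n p q w.mc w0.mx w.mx D.mf D.mn h.m1 h.m2 hv hx hf hn D.onx h.s1.1 h.o
    D.bey (cX_loc hb w D hx h).1 k hnp ?_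
  intro r hr g1 g2 g3
  rcases D.regq hb w h hr g1 g2 g3 with e | e | e | e | e | e <;> simp [e]

lemma Dn_down {x0 : ℝ} {A B : Finset Pt} (hb : Base x0 A B) {c a0 a1 b1 b2 : Pt}
    (w0 : Wd A c a0 a1) (h0 : W2 B c a0 a1 b1 b2) (u2 : 0 < ori b1 b2 a1) :
    Dn A B c a1 b1 b2 := by
  refine ⟨h0.m1, h0.m2, h0.o, h0.s2.2, u2, ?_⟩
  intro r hr g1 g2 g3
  exfalso
  rcases lo1 w0.conv h0.s1 g1.le with h | h
  · rcases w0.pts2 h0 hr ⟨h, g2.le⟩ with e | e | e | e | e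
    · exact ne12 g1 e.symm
    · subst e; exact not_both g1 h0.s1.1.le
    · exact ne23 g2 e.symm
    · exact ne23 g1 e
    · exact g3 e
  · exact not_both g2 h.le

lemma Dn_up {x0 : ℝ} {A B : Finset Pt} (hb : Base x0 A B) {c a0 a1 a2 b1 b2 b3 : Pt}
    (w0 : Wd A c a0 a1) (w1 : Wd A c a1 a2) (h0 : W2 B c a0 a1 b1 b2) (h1 : W1 B c a1 a2 b3)
    (r1 : c.1 < a1.1) (u : 0 < ori b2 b3 a2) :
    Dn A B c a2 b2 b3 := by
  have rc : ∀ b ∈ B, c.1 < b.1 := fun b hb' => (hb.hA c w0.mc).trans (hb.hB b hb')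
  have f1 : 0 < ori c b3 b2 := cw_trans (rc b2 h0.m2) r1 (rc b3 h1.m1) h0.s2.2 h1.s1.1
  refine ⟨h0.m2, h1.m1, f1, h1.s1.2, u, ?_⟩
  intro r hr g1 g2 g3
  by_cases e1 : r = a1
  · subst e1
    rcases hb.dich (inB h1.m1) (inB h0.m2) hr (ne23 f1) g3.symm (ne23 g1).symm with h | h
    · exact h
    · exact (cert_coneA hb c r b2 b3 w0.mc w0.my h0.m2 h1.m1 g1 h1.s1.1 f1 h).elim
  exfalso
  rcases lt_or_ge 0 (ori c a1 r) with h | h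
  · rcases lo1 w0.conv h0.s2 g1.le with h' | h'
    · rcases w0.pts2 h0 hr ⟨h', h.le⟩ with e | e | e | e | e
      · exact ne12 g1 e.symm
      · subst e; exact not_both g1 h0.s2.1.le
      · exact e1 e
      · subst e; exact not_both g1 h0.o.le
      · exact ne23 g1 e
    · exact not_both h h'.le
  · rcases w1.pts1 h1 hr ⟨by rw [ori_sw]; linarith, g2.le⟩ with e | e | e | e
    · exact ne12 g1 e.symm
    · exact e1 e
    · exact ne23 g2 e.symm
    · exact g3 e


/-- Reflection in the horizontal axis. -/
def mu : Pt →ₗ[ℝ] Pt where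
  toFun p := (p.1, -p.2)
  map_add' p q := by ext <;> simp; ring
  map_smul' t p := by ext <;> simp

lemma mu_apply (p : Pt) : mu p = (p.1, -p.2) := rfl
lemma mu_fst (p : Pt) : (mu p).1 = p.1 := rfl
lemma mu_mu (p : Pt) : mu (mu p) = p := by simp [mu_apply]
lemma mu_inj : Function.Injective mu := fun p q h => by
  have := congrArg mu h
  rwa [mu_mu, mu_mu] at this
lemma ori_mu (p q r : Pt) : ori (mu p) (mu q) (mu r) = ori q p r := by
  simp only [mu_apply, ori]; ring
lemma ori_mu' (p q r : Pt) : ori (mu p) (mu q) (mu r) = ori p r q := by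
  simp only [mu_apply, ori]; ring

/-- Image of a finite point set under the reflection. -/
def mir (A : Finset Pt) : Finset Pt := A.image mu

lemma mem_mir {A : Finset Pt} {p : Pt} : p ∈ mir A ↔ ∃ q ∈ A, mu q = p := by simp [mir]
lemma mu_mem_mir {A : Finset Pt} {p : Pt} (h : p ∈ A) : mu p ∈ mir A := mem_mir.2 ⟨p, h, rfl⟩
lemma mu_mem_iff {A : Finset Pt} {p : Pt} : mu p ∈ mir A ↔ p ∈ A := by
  constructor
  · intro h
    obtain ⟨q, hq, e⟩ := mem_mir.1 h
    rwa [← mu_inj e]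
  · exact mu_mem_mir
lemma mir_mir (A : Finset Pt) : mir (mir A) = A := by
  ext p
  rw [← mu_mu p, mu_mem_iff, mu_mem_iff, mu_mu]
lemma mir_union (A B : Finset Pt) : mir A ∪ mir B = mir (A ∪ B) := by
  simp [mir, Finset.image_union]
lemma coe_mir (A : Finset Pt) : (↑(mir A) : Set Pt) = Set.image mu ↑A := by simp [mir]

lemma hull_mu (S : Set Pt) (p : Pt) : mu p ∈ convexHull ℝ (Set.image mu S) ↔ p ∈ convexHull ℝ S := by
  rw [← LinearMap.image_convexHull mu S]
  exact mu_inj.mem_set_image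

lemma hole_mir {A B H : Finset Pt} (h : DividedFiveHole A B H) :
    DividedFiveHole (mir A) (mir B) (mir H) := by
  obtain ⟨⟨h1, h2, h3, h4⟩, ⟨x, hx⟩, ⟨y, hy⟩⟩ := h
  refine ⟨⟨?_, ?_, ?_, ?_⟩, ⟨mu x, ?_⟩, ⟨mu y, ?_⟩⟩
  · rw [mir_union]; exact Finset.image_subset_image h1
  · rw [mir, Finset.card_image_of_injective _ mu_inj, h2]
  · intro p hp
    obtain ⟨q, hq, rfl⟩ := mem_mir.1 (Finset.mem_coe.1 hp)
    rw [coe_mir, ← Set.image_singleton, ← Set.image_sdiff mu_inj, hull_mu]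
    exact h3 q (Finset.mem_coe.2 hq)
  · intro p hp hpH
    rw [mir_union] at hp
    obtain ⟨q, hq, rfl⟩ := mem_mir.1 hp
    rw [mu_mem_iff] at hpH
    rw [coe_mir, hull_mu]
    exact h4 q hq hpH
  · exact ⟨Finset.mem_coe.2 (mu_mem_mir (Finset.mem_coe.1 hx.1)),
      Finset.mem_coe.2 (mu_mem_mir (Finset.mem_coe.1 hx.2))⟩
  · exact ⟨Finset.mem_coe.2 (mu_mem_mir (Finset.mem_coe.1 hy.1)),
      Finset.mem_coe.2 (mu_mem_mir (Finset.mem_coe.1 hy.2))⟩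

lemma Base.mir {x0 : ℝ} {A B : Finset Pt} (hb : Base x0 A B) : Base x0 (mir A) (mir B) := by
  refine ⟨?_, ?_, ?_, ?_, ?_⟩
  · intro p hp
    obtain ⟨q, hq, rfl⟩ := mem_mir.1 hp
    exact hb.hA q hq
  · intro p hp
    obtain ⟨q, hq, rfl⟩ := mem_mir.1 hp
    exact hb.hB q hq
  · rw [mir_union]
    intro p hp q hq r hr h1 h2 h3
    obtain ⟨p', hp', rfl⟩ := mem_mir.1 hp
    obtain ⟨q', hq', rfl⟩ := mem_mir.1 hq
    obtain ⟨r', hr', rfl⟩ := mem_mir.1 hr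
    rw [ori_mu]
    exact hb.gp q' hq' p' hp' r' hr' (fun h => h1 (by rw [h])) (fun h => h3 (by rw [h]))
      (fun h => h2 (by rw [h]))
  · rw [mir_union]
    intro p hp q hq h
    obtain ⟨p', hp', rfl⟩ := mem_mir.1 hp
    obtain ⟨q', hq', rfl⟩ := mem_mir.1 hq
    rw [hb.inj p' hp' q' hq' h]
  · intro H hH
    have := hole_mir hH
    rw [mir_mir, mir_mir] at this
    exact hb.nohole _ this

lemma In_mu {c x y r : Pt} : In (mu c) (mu x) (mu y) (mu r) ↔ In c y x r := by
  constructor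
  · rintro ⟨h1, h2⟩
    rw [ori_mu'] at h1 h2
    exact ⟨h2, h1⟩
  · rintro ⟨h1, h2⟩
    refine ⟨?_, ?_⟩ <;> rw [ori_mu'] <;> assumption
lemma SI_mu {c x y r : Pt} (h : SI c y x r) : SI (mu c) (mu x) (mu y) (mu r) := by
  refine ⟨?_, ?_⟩ <;> rw [ori_mu']
  exacts [h.2, h.1]

lemma Wd.mir {A : Finset Pt} {c x y : Pt} (w : Wd A c x y) : Wd (mir A) (mu c) (mu y) (mu x) := by
  refine ⟨mu_mem_mir w.mc, mu_mem_mir w.my, mu_mem_mir w.mx, ?_, ?_⟩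
  · rw [ori_mu']; exact w.conv
  · intro r hr hi
    obtain ⟨r', hr', rfl⟩ := mem_mir.1 hr
    rw [In_mu] at hi
    rcases w.wA r' hr' hi with h | h | h <;> simp [h]

lemma W2.mir {B : Finset Pt} {c x y b1 b2 : Pt} (w : W2 B c x y b1 b2) :
    W2 (mir B) (mu c) (mu y) (mu x) (mu b2) (mu b1) := by
  refine ⟨mu_mem_mir w.m2, mu_mem_mir w.m1, SI_mu w.s2, SI_mu w.s1, ?_, ?_⟩
  · rw [ori_mu']; exact w.o
  · intro r hr hi
    obtain ⟨r', hr', rfl⟩ := mem_mir.1 hr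
    rw [In_mu] at hi
    rcases w.all r' hr' hi with h | h <;> simp [h]

lemma W1.mir {B : Finset Pt} {c x y m : Pt} (w : W1 B c x y m) :
    W1 (mir B) (mu c) (mu y) (mu x) (mu m) := by
  refine ⟨mu_mem_mir w.m1, SI_mu w.s1, ?_⟩
  intro r hr hi
  obtain ⟨r', hr', rfl⟩ := mem_mir.1 hr
  rw [In_mu] at hi
  rw [w.all r' hr' hi]

/-- The wedges around `c`, indexed by the integers. -/
structure Ctx (x0 : ℝ) (A B : Finset Pt) (c : Pt) (a : ℤ → Pt) (lo hi : ℤ) : Prop where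
  hb : Base x0 A B
  card : 6 ≤ B.card
  wd : ∀ k, Wd A c (a k) (a (k + 1))
  d2 : ∀ k, a k ≠ a (k + 2)
  d3 : ∀ k, a k ≠ a (k + 3)
  rt : ∀ k, lo < k → k < hi → c.1 < (a k).1
  bW : ∀ b ∈ B, ∃ k, lo ≤ k ∧ k < hi ∧ SI c (a k) (a (k + 1)) b
  hull : ∀ k, c.1 < (a k).1 → c.1 < (a (k + 1)).1 → c.1 < (a (k + 2)).1 →
    0 < ori (a k) (a (k + 2)) (a (k + 1))

lemma Ctx.shift {x0 : ℝ} {A B : Finset Pt} {c : Pt} {a : ℤ → Pt} {lo hi : ℤ}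
    (C : Ctx x0 A B c a lo hi) (s : ℤ) : Ctx x0 A B c (fun k => a (k + s)) (lo - s) (hi - s) := by
  refine ⟨C.hb, C.card, fun k => ?_, fun k => ?_, fun k => ?_, fun k h1 h2 => ?_, fun b hb => ?_,
    fun k => ?_⟩
  · have := C.wd (k + s)
    rwa [show k + s + 1 = k + 1 + s by ring] at this
  · have := C.d2 (k + s)
    rwa [show k + s + 2 = k + 2 + s by ring] at this
  · have := C.d3 (k + s)
    rwa [show k + s + 3 = k + 3 + s by ring] at this
  · exact C.rt (k + s) (by omega) (by omega)
  · obtain ⟨k, h1, h2, h3⟩ := C.bW b hb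
    refine ⟨k - s, by omega, by omega, ?_⟩
    rwa [show k - s + s = k by ring, show k - s + 1 + s = k + 1 by ring]
  · have := C.hull (k + s)
    rwa [show k + s + 1 = k + 1 + s by ring, show k + s + 2 = k + 2 + s by ring] at this

lemma Ctx.mir {x0 : ℝ} {A B : Finset Pt} {c : Pt} {a : ℤ → Pt} {lo hi : ℤ}
    (C : Ctx x0 A B c a lo hi) (s : ℤ) :
    Ctx x0 (mir A) (mir B) (mu c) (fun k => mu (a (s - k))) (s - hi) (s - lo) := by
  refine ⟨C.hb.mir, ?_, fun k => ?_, fun k => ?_, fun k => ?_, fun k h1 h2 => ?_, fun b hb => ?_,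
    fun k h1 h2 h3 => ?_⟩
  · rw [_root_.mir, Finset.card_image_of_injective _ mu_inj]; exact C.card
  · have := (C.wd (s - (k + 1))).mir
    rwa [show s - (k + 1) + 1 = s - k by ring] at this
  · have := C.d2 (s - (k + 2))
    rw [show s - (k + 2) + 2 = s - k by ring] at this
    exact fun h => this (mu_inj h).symm
  · have := C.d3 (s - (k + 3))
    rw [show s - (k + 3) + 3 = s - k by ring] at this
    exact fun h => this (mu_inj h).symm
  · exact C.rt (s - k) (by omega) (by omega)
  · obtain ⟨b', hb', rfl⟩ := mem_mir.1 hb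
    obtain ⟨k, h1, h2, h3⟩ := C.bW b' hb'
    refine ⟨s - k - 1, by omega, by omega, ?_⟩
    rw [show s - (s - k - 1 + 1) = k by ring, show s - (s - k - 1) = k + 1 by ring]
    exact SI_mu h3
  · have := C.hull (s - (k + 2))
    rw [show s - (k + 2) + 1 = s - (k + 1) by ring, show s - (k + 2) + 2 = s - k by ring] at this
    rw [ori_mu]
    exact this h3 h2 h1

/-- The pattern 2,1,…,1,2. -/
structure Conf (x0 : ℝ) (A B : Finset Pt) (c : Pt) (a : ℤ → Pt) (lo hi d : ℤ) (b1 b2 : Pt)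
    (m : ℤ → Pt) (p q : Pt) : Prop where
  C : Ctx x0 A B c a lo hi
  hlo : lo ≤ 0
  hhi : d < hi
  hd : 1 ≤ d
  v0 : W2 B c (a 0) (a 1) b1 b2
  vm : ∀ k, 0 < k → k < d → W1 B c (a k) (a (k + 1)) (m k)
  vd : W2 B c (a d) (a (d + 1)) p q

section conf
variable {x0 : ℝ} {A B : Finset Pt} {c : Pt} {a : ℤ → Pt} {lo hi d : ℤ} {b1 b2 : Pt}
    {m : ℤ → Pt} {p q : Pt}

lemma Conf.mir (K : Conf x0 A B c a lo hi d b1 b2 m p q) :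
    Conf x0 (mir A) (mir B) (mu c) (fun k => mu (a (d + 1 - k))) (d + 1 - hi) (d + 1 - lo) d
      (mu q) (mu p) (fun k => mu (m (d - k))) (mu b2) (mu b1) := by
  have := K.hlo
  have := K.hhi
  refine ⟨K.C.mir (d + 1), by omega, by omega, K.hd, ?_, fun k h1 h2 => ?_, ?_⟩
  · have := K.vd.mir
    simpa using this
  · have := (K.vm (d - k) (by omega) (by omega)).mir
    rw [show d + 1 - (k + 1) = d - k by ring, show d + 1 - k = d - k + 1 by ring]
    exact this
  · have := K.v0.mir
    rw [show d + 1 - d = 1 by ring, show d + 1 - (d + 1) = 0 by ring]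
    exact this

lemma Conf.rt (K : Conf x0 A B c a lo hi d b1 b2 m p q) {k : ℤ} (h1 : 1 ≤ k) (h2 : k ≤ d) :
    c.1 < (a k).1 :=
  K.C.rt k (by have := K.hlo; omega) (by have := K.hhi; omega)

lemma Conf.rc (K : Conf x0 A B c a lo hi d b1 b2 m p q) {b : Pt} (h : b ∈ B) : c.1 < b.1 :=
  (K.C.hb.hA c (K.C.wd 0).mc).trans (K.C.hb.hB b h)

lemma Conf.cwf (K : Conf x0 A B c a lo hi d b1 b2 m p q) {f : Pt} (hf : f ∈ B)
    (h : 0 < ori c (a 1) f) (j : ℤ) (h1 : 1 ≤ j) : j ≤ d → 0 < ori c (a j) f := by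
  induction j, h1 using Int.leInduction with
  | base => intro _; exact h
  | succ j hj ih =>
    intro hjd
    exact cw_trans (K.rc hf) (K.rt hj (by omega)) (K.rt (by omega) hjd) (ih (by omega))
      (K.C.wd j).conv

/-- run the sweep -/
lemma Conf.run (K : Conf x0 A B c a lo hi d b1 b2 m p q) {f : Pt}
    (h : 0 < ori c (a 1) f) (D : Dn A B c (a 2) f (m 1)) (k : ℤ) (hk : 2 ≤ k) :
    k ≤ d → Dn A B c (a k) f (m (k - 1)) := by
  induction k, hk using Int.leInduction with
  | base => intro _; exact D
  | succ k hk ih =>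
    intro hkd
    have h1 := K.vm (k - 1) (by omega) (by omega)
    have w1 := K.C.wd (k - 1)
    rw [show k - 1 + 1 = k by ring] at h1 w1
    have := prop_loc K.C.hb w1 (K.C.wd k) (K.rt (by omega) (by omega)) (K.rt (by omega) (by omega))
      (K.rt (by omega) (by omega)) h1 (K.vm k (by omega) (by omega)) (ih (by omega))
      (K.cwf D.mf h _ (by omega) (by omega))
    rwa [show k + 1 - 1 = k by ring]

lemma Conf.su (K : Conf x0 A B c a lo hi d b1 b2 m p q) (h3 : 3 ≤ d)
    (u1 : 0 < ori b1 b2 (a 0)) (u2 : 0 < ori b2 b1 (a 1)) : 0 < ori b2 (m 1) (a 2) :=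
  su_loc K.C.hb (K.C.wd 0) (K.C.wd 1) (K.C.wd 2) (K.rt (by omega) (by omega))
    (K.rt (by omega) (by omega)) (K.rt (by omega) (by omega))
    (K.C.hull 1 (K.rt (by omega) (by omega)) (K.rt (by omega) (by omega))
      (K.rt (by omega) (by omega)))
    K.v0 (K.vm 1 (by omega) (by omega)) (K.vm 2 (by omega) (by omega)) u1 u2

lemma Conf.dn (K : Conf x0 A B c a lo hi d b1 b2 m p q) (h3 : 3 ≤ d) :
    (∃ f, Dn A B c (a d) f (m (d - 1))) ∧
    (0 < ori b1 b2 (a 0) → 0 < ori b2 b1 (a 1) → Dn A B c (a d) b2 (m (d - 1))) := by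
  have up : 0 < ori b1 b2 (a 0) → 0 < ori b2 b1 (a 1) → Dn A B c (a d) b2 (m (d - 1)) := by
    intro u1 u2
    exact K.run K.v0.s2.2 (Dn_up K.C.hb (K.C.wd 0) (K.C.wd 1) K.v0 (K.vm 1 (by omega) (by omega))
      (K.rt (by omega) (by omega)) (K.su h3 u1 u2)) d (by omega) le_rfl
  refine ⟨?_, up⟩
  rcases L_dich K.C.hb (K.C.wd 0) K.v0 with ⟨u1, u2⟩ | ⟨u1, u2⟩
  · exact ⟨b2, up u1 u2⟩
  · refine ⟨b1, K.run K.v0.s1.2 ?_ d (by omega) le_rfl⟩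
    have D1 := Dn_down K.C.hb (K.C.wd 0) K.v0 u2
    have := prop0_loc K.C.hb (K.C.wd 0) (K.C.wd 1) (K.C.wd 2) (K.rt (by omega) (by omega))
      (K.rt (by omega) (by omega)) (K.rt (by omega) (by omega))
      (K.C.hull 1 (K.rt (by omega) (by omega)) (K.rt (by omega) (by omega))
        (K.rt (by omega) (by omega)))
      K.v0 (K.vm 1 (by omega) (by omega)) (K.vm 2 (by omega) (by omega)) u2
    exact D1.step K.C.hb (K.C.wd 1) (K.rt (by omega) (by omega)) (K.vm 1 (by omega) (by omega)) this

lemma Conf.Ld (K : Conf x0 A B c a lo hi d b1 b2 m p q) (h3 : 3 ≤ d) :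
    0 < ori q p (a d) ∧ 0 < ori p q (a (d + 1)) := by
  obtain ⟨⟨f, D⟩, -⟩ := K.dn h3
  exact cX_loc K.C.hb (K.C.wd d) D (K.rt (by omega) le_rfl) K.vd

lemma Conf.Lu (K : Conf x0 A B c a lo hi d b1 b2 m p q) (h3 : 3 ≤ d) :
    0 < ori b1 b2 (a 0) ∧ 0 < ori b2 b1 (a 1) := by
  have := K.mir.Ld h3
  rw [show d + 1 - d = 1 by ring, show d + 1 - (d + 1) = 0 by ring, ori_mu, ori_mu] at this
  exact ⟨this.2, this.1⟩

lemma Conf.side (K : Conf x0 A B c a lo hi d b1 b2 m p q) (h3 : 3 ≤ d) : 0 < ori p q b2 := by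
  obtain ⟨u1, u2⟩ := K.Lu h3
  obtain ⟨v1, v2⟩ := K.Ld h3
  have D := (K.dn h3).2 u1 u2
  have hs := K.mir.su h3 (by
      rw [ori_mu, show d + 1 - 0 = d + 1 by ring]; exact v2) (by
      rw [ori_mu, show d + 1 - 1 = d by ring]; exact v1)
  rw [ori_mu, show d + 1 - 2 = d - 1 by ring] at hs
  have h1 := K.vm (d - 1) (by omega) (by omega)
  have w1 := K.C.wd (d - 1)
  rw [show d - 1 + 1 = d by ring] at h1 w1
  exact cUD_loc K.C.hb w1 (K.C.wd d) D (K.rt (by omega) (by omega)) (K.rt (by omega) le_rfl)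
    (K.cwf K.v0.m2 K.v0.s2.2 _ (by omega) (by omega)) h1.s1.1 hs K.vd

lemma Conf.false3 (K : Conf x0 A B c a lo hi d b1 b2 m p q) (h3 : 3 ≤ d) : False := by
  obtain ⟨u1, u2⟩ := K.Lu h3
  obtain ⟨v1, v2⟩ := K.Ld h3
  have k1 := K.side h3
  have k2 := K.mir.side h3
  rw [ori_mu] at k2
  have hA : ∀ j : ℤ, 2 ≤ j → j ≤ d → 0 < ori c (a j) (a 1) := by
    intro j hj
    induction j, hj using Int.leInduction with
    | base => intro _; exact (K.C.wd 1).conv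
    | succ j hj ih =>
      intro hjd
      exact cw_trans (K.rt (by omega) (by omega)) (K.rt (by omega) (by omega))
        (K.rt (by omega) (by omega)) (ih (by omega)) (K.C.wd j).conv
  exact cert_cross K.C.hb c (a 0) (a 1) (a d) (a (d + 1)) b1 b2 p q (K.C.wd 0).mc (K.C.wd 0).mx
    (K.C.wd 0).my (K.C.wd d).mx (K.C.wd d).my K.v0.m1 K.v0.m2 K.vd.m1 K.vd.m2
    (K.rt (by omega) (by omega)) (K.rt (by omega) (by omega)) K.v0.o K.v0.s2.2
    (hA d (by omega) le_rfl) K.vd.s1.1 K.vd.o K.v0.s1.1 K.vd.s2.2 u1 v1 v2 k1 k2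

lemma Conf.false2 (K : Conf x0 A B c a lo hi 2 b1 b2 m p q) : False := by
  have h := fun {A B : Finset Pt} {c : Pt} {a : ℤ → Pt} {lo hi : ℤ} {b1 b2 : Pt}
    {m : ℤ → Pt} {p q : Pt} (K : Conf x0 A B c a lo hi 2 b1 b2 m p q) =>
    loc_d2 K.C.hb (K.C.wd 0) (K.C.wd 1) (K.C.wd 2) (K.rt (by omega) (by omega))
      (K.rt (by omega) (by omega)) (K.C.d2 0) (K.C.d2 1) K.v0 (K.vm 1 (by omega) (by omega)) K.vd
  have h1 := h K
  have h2 := h K.mir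
  have e := h2.1
  rw [ori_mu] at e
  have e' := h1.2
  rcases L_dich K.C.hb (K.C.wd 2) K.vd with ⟨u1, u2⟩ | ⟨u1, u2⟩
  · rw [ori_swap] at u2
    norm_num at e u2
    linarith
  · rw [ori_swap] at u1
    norm_num at e' u1
    linarith

lemma Conf.right1 (K : Conf x0 A B c a lo hi 1 b1 b2 m p q) {b : Pt} (hbB : b ∈ B) {k : ℤ}
    (hk : 2 ≤ k) (hk' : k < hi) (hs : SI c (a k) (a (k + 1)) b) : False := by
  have hlo := K.hlo
  have r1 : c.1 < (a 1).1 := K.rt le_rfl le_rfl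
  have r2 : c.1 < (a 2).1 := K.C.rt 2 (by omega) (by omega)
  have w0 := K.C.wd 0
  have w1 := K.C.wd 1
  have w2 := K.C.wd 2
  have d0 := K.C.d2 0
  have d1 := K.C.d2 1
  have d3 := K.C.d3 0
  have hh := K.C.hull 1 r1 r2
  have v1 := K.vd
  norm_num at w0 w1 w2 d0 d1 d3 hh v1
  by_cases hE : ∃ e ∈ B, In c (a 2) (a 3) e
  · obtain ⟨e, he, hi'⟩ := hE
    refine loc_E1 K.C.hb w0 w1 w2 r1 r2 d0 d1 hh K.v0 v1 he (In.si K.C.hb w2 he hi') ?_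
    intro n3 n0
    have hhi : hi ≤ 3 := by
      by_contra hcon
      exact n3 (K.C.rt 3 (by omega) (by omega))
    have hlo' : 0 ≤ lo := by
      by_contra hcon
      exact n0 (K.C.rt 0 (by omega) (by omega))
    have hall : ∀ r ∈ B, In c (a 0) (a 1) r ∨ In c (a 1) (a 2) r ∨ In c (a 2) (a 3) r := by
      intro r hr
      obtain ⟨j, j1, j2, hj⟩ := K.C.bW r hr
      have : j = 0 ∨ j = 1 ∨ j = 2 := by omega
      rcases this with rfl | rfl | rfl
      · exact Or.inl hj.In
      · exact Or.inr (Or.inl hj.In)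
      · exact Or.inr (Or.inr hj.In)
    refine ⟨?_, hall⟩
    classical
    have hsub : B ⊆ {b1, b2, p, q} ∪ B.filter (fun r => In c (a 2) (a 3) r) := by
      intro r hr
      rcases hall r hr with h | h | h
      · rcases K.v0.all r hr h with e | e <;> simp [e]
      · rcases v1.all r hr h with e | e <;> simp [e]
      · simp [hr, h]
    have hc := Finset.card_le_card hsub
    have hc2 := Finset.card_union_le {b1, b2, p, q} (B.filter (fun r => In c (a 2) (a 3) r))
    have hc3 : ({b1, b2, p, q} : Finset Pt).card ≤ 4 := Finset.card_le_four
    have hc4 := K.C.card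
    have : 1 < (B.filter (fun r => In c (a 2) (a 3) r)).card := by omega
    obtain ⟨x, hx, y, hy, hxy⟩ := Finset.one_lt_card.1 this
    simp only [Finset.mem_filter] at hx hy
    exact ⟨x, hx.1, y, hy.1, hxy, In.si K.C.hb w2 hx.1 hx.2, In.si K.C.hb w2 hy.1 hy.2⟩
  · push Not at hE
    have hk3 : k ≠ 2 := by
      rintro rfl
      exact hE b hbB hs.In
    have r3 : c.1 < (a 3).1 := K.C.rt 3 (by omega) (by omega)
    exact loc_E2 K.C.hb w0 w1 w2 r1 r2 r3 d0 d1 d3 (hh r3) K.v0 v1 hE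

lemma Conf.false1 (K : Conf x0 A B c a lo hi 1 b1 b2 m p q) : False := by
  classical
  have hc3 : ({b1, b2, p, q} : Finset Pt).card ≤ 4 := Finset.card_le_four
  have hc4 := K.C.card
  obtain ⟨b, hbB, hb⟩ := Finset.exists_mem_notMem_of_card_lt_card
    (s := ({b1, b2, p, q} : Finset Pt)) (t := B) (by omega)
  simp only [Finset.mem_insert, Finset.mem_singleton, not_or] at hb
  obtain ⟨n1, n2, n3, n4⟩ := hb
  obtain ⟨k, k1, k2, hs⟩ := K.C.bW b hbB
  have h0 : k ≠ 0 := by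
    rintro rfl
    rcases K.v0.all b hbB hs.In with e | e
    · exact n1 e
    · exact n2 e
  have h1 : k ≠ 1 := by
    rintro rfl
    rcases K.vd.all b hbB hs.In with e | e
    · exact n3 e
    · exact n4 e
  rcases lt_or_gt_of_ne h0 with h | h
  · refine K.mir.right1 (mu_mem_mir hbB) (k := 1 - k) (by omega) (by omega) ?_
    have := SI_mu hs
    rw [show (1 : ℤ) + 1 - (1 - k + 1) = k by ring, show (1 : ℤ) + 1 - (1 - k) = k + 1 by ring]
    exact this
  · exact K.right1 hbB (by omega) k2 hs

theorem Conf.false (K : Conf x0 A B c a lo hi d b1 b2 m p q) : False := by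
  have := K.hd
  rcases lt_trichotomy d 2 with h | h | h
  · obtain rfl : d = 1 := by omega
    exact K.false1
  · subst h; exact K.false2
  · exact K.false3 (by omega)

end conf


lemma cross2_ori (c p q : Pt) : cross2 (p - c) (q - c) = ori c p q := by
  simp only [cross2, ori, Prod.fst_sub, Prod.snd_sub]

lemma mem_wedge {c p q : Pt} (h : 0 < ori c q p) (r : Pt) : r ∈ Wedge c p q ↔ In c p q r := by
  have h1 := ori_sw c q p
  have h2 := ori_sw c r p
  rw [Wedge, cross2_ori, if_pos (by linarith)]
  simp only [Set.mem_ofPred_eq, cross2_ori]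
  constructor
  · rintro ⟨e1, e2⟩; exact ⟨by linarith, e2⟩
  · rintro ⟨e1, e2⟩; exact ⟨by linarith, e2⟩

/-- an interior point has points strictly on both sides of each line through it -/
lemma interior_neg {A : Set Pt} {c p : Pt} (hc : c ∈ interior (convexHull ℝ A)) (hp : p ≠ c) :
    ∃ x ∈ A, ori c p x < 0 := by
  by_contra hcon
  push Not at hcon
  have hcont : Continuous (fun t : ℝ => ((c.1 + t * (p.2 - c.2), c.2 - t * (p.1 - c.1)) : Pt)) := by
    fun_prop
  have hn : interior (convexHull ℝ A) ∈
      nhds ((c.1 + (0 : ℝ) * (p.2 - c.2), c.2 - (0 : ℝ) * (p.1 - c.1)) : Pt) := by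
    simpa using isOpen_interior.mem_nhds hc
  have hev := hcont.continuousAt.eventually hn
  have hev2 := (hev.filter_mono nhdsWithin_le_nhds).and
    (self_mem_nhdsWithin : Set.Ioi (0 : ℝ) ∈ nhdsWithin (0 : ℝ) (Set.Ioi 0))
  obtain ⟨t, ht, ht0⟩ := hev2.exists
  have ht0 : 0 < t := ht0
  have h := hull_half hcon (interior_subset ht)
  simp only [ori] at h
  have e : 0 ≤ -(t * ((p.1 - c.1) ^ 2 + (p.2 - c.2) ^ 2)) := by linarith [h]
  have hpos : 0 < (p.1 - c.1) ^ 2 + (p.2 - c.2) ^ 2 := by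
    by_contra h0
    have e1 : p.1 - c.1 = 0 := by nlinarith [sq_nonneg (p.1 - c.1), sq_nonneg (p.2 - c.2)]
    have e2 : p.2 - c.2 = 0 := by nlinarith [sq_nonneg (p.1 - c.1), sq_nonneg (p.2 - c.2)]
    exact hp (Prod.ext (by linarith) (by linarith))
  nlinarith [mul_pos ht0 hpos]

lemma interior_pos {A : Set Pt} {c p : Pt} (hc : c ∈ interior (convexHull ℝ A)) (hp : p ≠ c) :
    ∃ x ∈ A, 0 < ori c p x := by
  obtain ⟨x, hx, h⟩ := interior_neg (p := ((2 * c.1 - p.1, 2 * c.2 - p.2) : Pt)) hc (by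
    intro e
    apply hp
    have e1 := congrArg Prod.fst e
    have e2 := congrArg Prod.snd e
    simp only at e1 e2
    exact Prod.ext (by linarith) (by linarith))
  refine ⟨x, hx, ?_⟩
  simp only [ori] at h ⊢
  linarith

/-- a point of an open triangle is interior to the hull -/
lemma tri_interior {A : Set Pt} {u v w x : Pt} (hu : u ∈ A) (hv : v ∈ A) (hw : w ∈ A)
    (h1 : 0 < ori u v x) (h2 : 0 < ori v w x) (h3 : 0 < ori w u x) :
    x ∈ interior (convexHull ℝ A) := by
  rw [mem_interior]
  refine ⟨{y | 0 < ori u v y ∧ 0 < ori v w y ∧ 0 < ori w u y}, ?_, ?_, ⟨h1, h2, h3⟩⟩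
  · rintro y ⟨g1, g2, g3⟩
    have hs : ori u v y + ori v w y + ori w u y = ori u v w := by unfold ori; ring
    have hT : 0 < ori u v w := by linarith
    have hy : y = (ori v w y / ori u v w) • u + (ori w u y / ori u v w) • v +
        (ori u v y / ori u v w) • w := by
      ext
      · simp only [Prod.fst_add, Prod.smul_fst, smul_eq_mul]
        field_simp
        unfold ori; ring
      · simp only [Prod.snd_add, Prod.smul_snd, smul_eq_mul]
        field_simp
        unfold ori; ring
    rw [hy]
    have key := (convex_convexHull ℝ A).sum_mem (t := Finset.univ)
      (w := ![ori v w y / ori u v w, ori w u y / ori u v w, ori u v y / ori u v w])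
      (z := ![u, v, w]) ?_ ?_ ?_
    · simpa [Fin.sum_univ_three] using key
    · intro i _
      fin_cases i
      · exact (div_pos g2 hT).le
      · exact (div_pos g3 hT).le
      · exact (div_pos g1 hT).le
    · simp only [Fin.sum_univ_three, Matrix.cons_val_zero, Matrix.cons_val_one, Matrix.cons_val]
      field_simp
      linarith
    · intro i _
      fin_cases i
      · exact subset_convexHull ℝ A hu
      · exact subset_convexHull ℝ A hv
      · exact subset_convexHull ℝ A hw
  · have c1 : ∀ a b : Pt, Continuous (fun y => ori a b y) := by
      intro a b; unfold ori; fun_prop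
    exact (isOpen_lt continuous_const (c1 u v)).inter
      ((isOpen_lt continuous_const (c1 v w)).inter (isOpen_lt continuous_const (c1 w u)))

lemma ori_collinear {p q r : Pt} (hpq : p ≠ q) (h : ori p q r = 0) :
    Collinear ℝ ({p, q, r} : Set Pt) := by
  rw [collinear_iff_of_mem (p₀ := p) (by simp)]
  refine ⟨q - p, ?_⟩
  have hpos : (q.1 - p.1) ^ 2 + (q.2 - p.2) ^ 2 ≠ 0 := by
    intro h0
    have e1 : q.1 - p.1 = 0 := by nlinarith [sq_nonneg (q.1 - p.1), sq_nonneg (q.2 - p.2)]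
    have e2 : q.2 - p.2 = 0 := by nlinarith [sq_nonneg (q.1 - p.1), sq_nonneg (q.2 - p.2)]
    exact hpq (Prod.ext (by linarith) (by linarith))
  intro z hz
  simp only [Set.mem_insert_iff, Set.mem_singleton_iff] at hz
  rcases hz with rfl | rfl | rfl
  · exact ⟨0, by simp⟩
  · exact ⟨1, by simp⟩
  · refine ⟨((q.1 - p.1) * (z.1 - p.1) + (q.2 - p.2) * (z.2 - p.2)) /
      ((q.1 - p.1) ^ 2 + (q.2 - p.2) ^ 2), ?_⟩
    simp only [ori] at h
    ext
    · simp only [vadd_eq_add, Prod.fst_add, Prod.smul_fst, Prod.fst_sub, smul_eq_mul]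
      field_simp
      linear_combination (-(q.2 - p.2)) * h
    · simp only [vadd_eq_add, Prod.snd_add, Prod.smul_snd, Prod.snd_sub, smul_eq_mul]
      field_simp
      linear_combination (q.1 - p.1) * h

section star
variable {x0 : ℝ} {A B : Finset Pt} (S : StarSetup x0 A)

/-- cyclic labels indexed by the integers -/
def StarSetup.al (k : ℤ) : Pt := S.lbl (k % ((A.card - 1 : ℕ) : ℤ)).toNat

lemma StarSetup.al_nat {n : ℕ} (h : n ≤ A.card - 1) (hc : 5 ≤ A.card) : S.al n = S.lbl n := by
  unfold StarSetup.al
  rcases h.lt_or_eq with h | h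
  · rw [Int.emod_eq_of_lt (by omega) (by omega)]; simp
  · subst h
    have := S.lbl_periodic 0
    simp only [zero_add] at this
    simp [this]

lemma StarSetup.al_add (k : ℤ) : S.al (k + ((A.card - 1 : ℕ) : ℤ)) = S.al k := by
  unfold StarSetup.al; simp

lemma StarSetup.al_add_mul (k m : ℤ) : S.al (k + m * ((A.card - 1 : ℕ) : ℤ)) = S.al k := by
  unfold StarSetup.al; simp

lemma StarSetup.al_emod (hc : 5 ≤ A.card) (k : ℤ) :
    ∃ n : ℕ, n < A.card - 1 ∧ S.al k = S.lbl n ∧ S.al (k + 1) = S.lbl (n + 1) ∧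
      k % ((A.card - 1 : ℕ) : ℤ) = n := by
  have hN : (0 : ℤ) < ((A.card - 1 : ℕ) : ℤ) := by omega
  have h1 := Int.emod_nonneg k hN.ne'
  have h2 := Int.emod_lt_of_pos k hN
  have h3 := Int.emod_add_mul_ediv k ((A.card - 1 : ℕ) : ℤ)
  obtain ⟨n, hn⟩ := Int.eq_ofNat_of_zero_le h1
  have hn2 : n < A.card - 1 := by omega
  refine ⟨n, hn2, ?_, ?_, hn⟩
  · unfold StarSetup.al; rw [hn]; simp
  · rw [show k + 1 = ((n + 1 : ℕ) : ℤ) + (k / ((A.card - 1 : ℕ) : ℤ)) * ((A.card - 1 : ℕ) : ℤ) by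
      push_cast
      rw [hn] at h3
      linarith, S.al_add_mul, S.al_nat (by omega) hc]

lemma StarSetup.al_inj (hc : 5 ≤ A.card) {k k' : ℤ} (h : S.al k = S.al k') :
    ((A.card - 1 : ℕ) : ℤ) ∣ k' - k := by
  obtain ⟨n, hn, -, e2, e3⟩ := S.al_emod hc (k - 1)
  obtain ⟨n', hn', -, f2, f3⟩ := S.al_emod hc (k' - 1)
  rw [sub_add_cancel] at e2 f2
  obtain ⟨m, -, hm⟩ := S.lbl_bij (S.al k) (by rw [e2]; exact S.lbl_mem _)
  have g1 := hm (n + 1) ⟨Finset.mem_Icc.2 ⟨by omega, by omega⟩, e2.symm⟩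
  have g2 := hm (n' + 1) ⟨Finset.mem_Icc.2 ⟨by omega, by omega⟩, by rw [h, f2]⟩
  have : n = n' := by omega
  have e : (k - 1) ≡ (k' - 1) [ZMOD ((A.card - 1 : ℕ) : ℤ)] := by
    rw [Int.ModEq, e3, f3, this]
  have := e.dvd
  rwa [show k' - 1 - (k - 1) = k' - k by ring] at this

lemma StarSetup.al_ne (hc : 5 ≤ A.card) (k : ℤ) {m : ℤ} (h1 : 1 ≤ m) (h2 : m ≤ 3) :
    S.al k ≠ S.al (k + m) := by
  intro h
  have := S.al_inj hc h
  rw [show k + m - k = m by ring] at this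
  have := Int.le_of_dvd (by omega) this
  omega

lemma StarSetup.al_mem (k : ℤ) : S.al k ∈ A := Finset.mem_of_mem_erase (S.lbl_mem _)
lemma StarSetup.al_nec (k : ℤ) : S.al k ≠ S.aStar := Finset.ne_of_mem_erase (S.lbl_mem _)

lemma StarSetup.al_surj (hc : 5 ≤ A.card) {x : Pt} (hx : x ∈ A) (hne : x ≠ S.aStar) :
    ∃ k, S.al k = x := by
  obtain ⟨n, ⟨hn, e⟩, -⟩ := S.lbl_bij x (Finset.mem_erase.2 ⟨hne, hx⟩)
  rw [Finset.mem_Icc] at hn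
  exact ⟨n, by rw [S.al_nat hn.2 hc, e]⟩

lemma StarSetup.wd (hb : Base x0 A B) (hc : 5 ≤ A.card) (k : ℤ) :
    Wd A S.aStar (S.al k) (S.al (k + 1)) := by
  obtain ⟨n, hn, e1, e2, -⟩ := S.al_emod hc k
  have hcon := S.consec (n + 1) (Finset.mem_Icc.2 ⟨by omega, by omega⟩)
  rw [Nat.add_sub_cancel, ← e1, ← e2] at hcon
  have conv : 0 < ori S.aStar (S.al (k + 1)) (S.al k) := by
    have h0 := hb.gp S.aStar (inA S.aStar_mem) (S.al (k + 1)) (inA (S.al_mem _)) (S.al k)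
      (inA (S.al_mem _)) (S.al_nec _).symm (S.al_nec _).symm
      (S.al_ne hc k le_rfl (by norm_num)).symm
    by_contra hneg
    have hs := ori_sw S.aStar (S.al k) (S.al (k + 1))
    have hs' := ori_sw S.aStar (S.al (k + 1)) (S.al k)
    have hlt : 0 < ori S.aStar (S.al k) (S.al (k + 1)) := by
      rcases lt_or_gt_of_ne h0 with h | h
      · linarith
      · exact absurd h hneg
    obtain ⟨x, hx, hx2⟩ := interior_neg S.aStar_interior (S.al_nec k)
    have hmem : x ∈ Wedge S.aStar (S.al k) (S.al (k + 1)) := by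
      rw [Wedge, cross2_ori, if_neg (by linarith)]
      left
      rw [cross2_ori]; exact hx2.le
    have := hcon ⟨hx, hmem⟩
    simp only [Set.mem_insert_iff, Set.mem_singleton_iff] at this
    rcases this with rfl | rfl | rfl
    · rw [ori_self''] at hx2; exact lt_irrefl _ hx2
    · rw [ori_self'] at hx2; exact lt_irrefl _ hx2
    · linarith
  refine ⟨S.aStar_mem, S.al_mem _, S.al_mem _, conv, ?_⟩
  intro r hr hi
  have := hcon ⟨hr, (mem_wedge conv r).2 hi⟩
  simpa using this

lemma StarSetup.mem_W (hb : Base x0 A B) (hc : 5 ≤ A.card) {n : ℕ} (h1 : 1 ≤ n)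
    (h2 : n ≤ A.card - 1) (r : Pt) :
    r ∈ S.W n ↔ In S.aStar (S.al ((n : ℤ) - 1)) (S.al n) r := by
  have w := S.wd hb hc ((n : ℤ) - 1)
  rw [sub_add_cancel] at w
  rw [← mem_wedge w.conv, StarSetup.W]
  have e : S.al ((n : ℤ) - 1) = S.lbl (n - 1) := by
    rw [← S.al_nat (n := n - 1) (by omega) hc]
    congr 1
    omega
  rw [e, S.al_nat h2 hc]

lemma StarSetup.rt (hb : Base x0 A B) (hc : 5 ≤ A.card) (k : ℤ) (h0 : 0 < k) (ht : k < S.t) :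
    S.aStar.1 < (S.al k).1 := by
  obtain ⟨n, rfl⟩ := Int.eq_ofNat_of_zero_le h0.le
  have htN := S.t_le
  have hn1 : 1 ≤ n := by omega
  have hn2 : n + 1 ≤ S.t := by omega
  by_contra hcon
  push Not at hcon
  obtain ⟨z, hz, hz0⟩ := (S.inter_iff n (Finset.mem_Icc.2 ⟨hn1, by omega⟩)).2 (by omega)
  obtain ⟨z', hz', hz0'⟩ := (S.inter_iff (n + 1) (Finset.mem_Icc.2 ⟨by omega, by omega⟩)).2 hn2
  have hz0 : z.1 = x0 := hz0
  have hz0' : z'.1 = x0 := hz0'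
  have hzI := (S.mem_W hb hc hn1 (by omega) z).1 hz
  have w := S.wd hb hc ((n : ℤ) - 1)
  rw [sub_add_cancel] at w
  have hcx := hb.hA _ S.aStar_mem
  have key : (z.1 - S.aStar.1) * ori S.aStar (S.al n) (S.al ((n : ℤ) - 1)) =
      (S.al ((n : ℤ) - 1)).1 * ori S.aStar (S.al n) z - S.aStar.1 * ori S.aStar (S.al n) z
      + ((S.al n).1 - S.aStar.1) * ori S.aStar z (S.al ((n : ℤ) - 1)) := by
    unfold ori; ring
  have k1 : 0 < (z.1 - S.aStar.1) * ori S.aStar (S.al n) (S.al ((n : ℤ) - 1)) :=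
    mul_pos (by linarith) w.conv
  have k2 : ((S.al n).1 - S.aStar.1) * ori S.aStar z (S.al ((n : ℤ) - 1)) ≤ 0 :=
    mul_nonpos_of_nonpos_of_nonneg (by linarith) hzI.fst
  have k3 : 0 < ((S.al ((n : ℤ) - 1)).1 - S.aStar.1) * ori S.aStar (S.al n) z := by linarith
  have k4 : 0 < (S.al ((n : ℤ) - 1)).1 - S.aStar.1 := pos_of_mul_pos_left k3 hzI.snd
  set y : Pt := (x0, min z.2 z'.2 - 1) with hy
  have hyz : y.2 ≤ z.2 := by
    have := min_le_left z.2 z'.2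
    simp only [hy]; linarith
  have hyz' : y.2 < z'.2 := by
    have := min_le_right z.2 z'.2
    simp only [hy]; linarith
  have hyW : y ∈ S.W n := by
    rw [S.mem_W hb hc hn1 (by omega)]
    have hy1 : y.1 = z.1 := hz0.symm
    refine ⟨?_, ?_⟩
    · have e : ori S.aStar y (S.al ((n : ℤ) - 1)) = ori S.aStar z (S.al ((n : ℤ) - 1)) +
          (z.2 - y.2) * ((S.al ((n : ℤ) - 1)).1 - S.aStar.1) := by
        unfold ori; rw [hy1]; ring
      rw [e]
      exact add_nonneg hzI.fst (mul_nonneg (by linarith) k4.le)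
    · have e : ori S.aStar (S.al n) y = ori S.aStar (S.al n) z +
          (z.2 - y.2) * (S.aStar.1 - (S.al n).1) := by
        unfold ori; rw [hy1]; ring
      rw [e]
      exact add_nonneg hzI.snd (mul_nonneg (by linarith) (by linarith))
  have := S.ordered n (Finset.mem_Icc.2 ⟨hn1, by omega⟩) (n + 1)
    (Finset.mem_Icc.2 ⟨by omega, hn2⟩) (by omega) y ⟨hyW, rfl⟩ z' ⟨hz', hz0'⟩
  linarith

lemma sign_walk {f : ℤ → ℝ} (hf : ∀ k, f k ≠ 0) {k0 : ℤ} (h0 : 0 < f k0) (k1 : ℤ) (hk : k0 ≤ k1) :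
    f k1 < 0 → ∃ k, 0 < f k ∧ f (k + 1) < 0 := by
  induction k1, hk using Int.leInduction with
  | base => intro h; linarith
  | succ k hk ih =>
    intro h
    rcases lt_or_gt_of_ne (hf k) with h1 | h1
    · exact ih h1
    · exact ⟨k, h1, h⟩

lemma StarSetup.bW (hb : Base x0 A B) (hc : 5 ≤ A.card) {b : Pt} (hbB : b ∈ B) :
    ∃ k : ℤ, 0 ≤ k ∧ k < S.t ∧ SI S.aStar (S.al k) (S.al (k + 1)) b := by
  have hcx := hb.hA _ S.aStar_mem
  have hbx := hb.hB _ hbB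
  have hbc : b ≠ S.aStar := (hb.neAB S.aStar_mem hbB).symm
  have hf : ∀ k, ori S.aStar b (S.al k) ≠ 0 := fun k =>
    hb.gp _ (inA S.aStar_mem) _ (inB hbB) _ (inA (S.al_mem k)) hbc.symm (S.al_nec k).symm
      (hb.neAB (S.al_mem k) hbB).symm
  obtain ⟨x, hx, hxp⟩ := interior_pos S.aStar_interior hbc
  obtain ⟨y, hy, hyn⟩ := interior_neg S.aStar_interior hbc
  obtain ⟨k0, rfl⟩ := S.al_surj hc hx (by rintro rfl; simp [ori_self''] at hxp)
  obtain ⟨k1, rfl⟩ := S.al_surj hc hy (by rintro rfl; simp [ori_self''] at hyn)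
  rw [← S.al_add_mul k1 |k0 - k1|] at hyn
  obtain ⟨k, hk1, hk2⟩ := sign_walk hf hxp (k1 + |k0 - k1| * ((A.card - 1 : ℕ) : ℤ)) (by
    have h1 := le_abs_self (k0 - k1)
    have h2 := abs_nonneg (k0 - k1)
    have h3 : (1 : ℤ) ≤ ((A.card - 1 : ℕ) : ℤ) := by omega
    nlinarith) hyn
  obtain ⟨n, hn, e1, e2, -⟩ := S.al_emod hc k
  have e1' : S.al ((n : ℕ) : ℤ) = S.al k := by rw [S.al_nat (by omega) hc, e1]
  have e2' : S.al ((n : ℤ) + 1) = S.al (k + 1) := by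
    have := S.al_nat (n := n + 1) (by omega) hc
    push_cast at this
    rw [this, e2]
  have hs := ori_sw S.aStar b (S.al (k + 1))
  refine ⟨n, by omega, ?_, ?_⟩
  · set s : ℝ := (x0 - S.aStar.1) / (b.1 - S.aStar.1) with hsdef
    have hspos : 0 < s := div_pos (by linarith) (by linarith)
    set z : Pt := (S.aStar.1 + s * (b.1 - S.aStar.1), S.aStar.2 + s * (b.2 - S.aStar.2)) with hz
    have hz0 : z.1 = x0 := by
      simp only [hz, hsdef]
      rw [div_mul_cancel₀ _ (by linarith)]
      ring
    have hzW : z ∈ S.W (n + 1) := by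
      rw [S.mem_W hb hc (by omega) (by omega)]
      push_cast
      rw [add_sub_cancel_right, e1', e2']
      refine ⟨?_, ?_⟩
      · have e : ori S.aStar z (S.al k) = s * ori S.aStar b (S.al k) := by
          simp only [hz, ori]; ring
        rw [e]; positivity
      · have e : ori S.aStar (S.al (k + 1)) z = s * ori S.aStar (S.al (k + 1)) b := by
          simp only [hz, ori]; ring
        rw [e, hs]
        exact mul_nonneg hspos.le (by linarith)
    have := (S.inter_iff (n + 1) (Finset.mem_Icc.2 ⟨by omega, by omega⟩)).1 ⟨z, hzW, hz0⟩
    omega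
  · rw [e1', e2']
    exact ⟨hk1, by rw [hs]; linarith⟩

lemma StarSetup.ctx (hb : Base x0 A B) (hc : 5 ≤ A.card) (hB : 6 ≤ B.card) :
    Ctx x0 A B S.aStar S.al 0 S.t := by
  refine ⟨hb, hB, S.wd hb hc, fun k => S.al_ne hc k (by norm_num) (by norm_num),
    fun k => S.al_ne hc k (by norm_num) (by norm_num), S.rt hb hc, fun b h => S.bW hb hc h, ?_⟩
  intro k h1 h2 h3
  have w1 := S.wd hb hc k
  have w2 := S.wd hb hc (k + 1)
  rw [show k + 1 + 1 = k + 2 by ring] at w2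
  rcases hb.dich (inA (S.al_mem k)) (inA (S.al_mem (k + 2))) (inA (S.al_mem (k + 1)))
    (S.al_ne hc k (by norm_num) (by norm_num)) (S.al_ne hc k (by norm_num) (by norm_num))
    (by
      have := S.al_ne hc (k + 1) (m := 1) (by norm_num) (by norm_num)
      rw [show k + 1 + 1 = k + 2 by ring] at this
      exact this.symm) with h | h
  · exact h
  · exfalso
    have := S.aStar_rightmost _ (S.al_mem (k + 1)) (tri_interior (A := (↑A : Set Pt))
      (u := S.aStar) (v := S.al (k + 2)) (w := S.al k) S.aStar_mem (S.al_mem _) (S.al_mem _)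
      w2.conv h (by have := w1.conv; rwa [ori_cyc] at this))
    linarith

lemma StarSetup.W2_of (hb : Base x0 A B) (hc : 5 ≤ A.card) {n : ℕ} (h1 : 1 ≤ n)
    (h2 : n ≤ A.card - 1) (hw : S.w B n = 2) :
    ∃ b1 b2, W2 B S.aStar (S.al ((n : ℤ) - 1)) (S.al n) b1 b2 := by
  have w := S.wd hb hc ((n : ℤ) - 1)
  rw [sub_add_cancel] at w
  obtain ⟨u, v, huv, e⟩ := Set.ncard_eq_two.1 hw
  have hm : ∀ r, (r ∈ B ∧ In S.aStar (S.al ((n : ℤ) - 1)) (S.al n) r) ↔ r = u ∨ r = v := by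
    intro r
    have : r ∈ (↑B : Set Pt) ∩ S.W n ↔ r ∈ ({u, v} : Set Pt) := by rw [e]
    rw [← S.mem_W hb hc h1 h2]
    simpa using this
  have hu := (hm u).2 (Or.inl rfl)
  have hv := (hm v).2 (Or.inr rfl)
  have su := In.si hb w hu.1 hu.2
  have sv := In.si hb w hv.1 hv.2
  have h0 := hb.gp _ (inA S.aStar_mem) _ (inB hu.1) _ (inB hv.1) (hb.neAB S.aStar_mem hu.1)
    (hb.neAB S.aStar_mem hv.1) huv
  rcases lt_or_gt_of_ne h0 with h | h
  · refine ⟨u, v, hu.1, hv.1, su, sv, ?_, fun r hr hi => (hm r).1 ⟨hr, hi⟩⟩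
    rw [ori_sw]; linarith
  · exact ⟨v, u, hv.1, hu.1, sv, su, h, fun r hr hi => ((hm r).1 ⟨hr, hi⟩).symm⟩

lemma StarSetup.W1_of (hb : Base x0 A B) (hc : 5 ≤ A.card) {n : ℕ} (h1 : 1 ≤ n)
    (h2 : n ≤ A.card - 1) (hw : S.w B n = 1) :
    ∃ m, W1 B S.aStar (S.al ((n : ℤ) - 1)) (S.al n) m := by
  have w := S.wd hb hc ((n : ℤ) - 1)
  rw [sub_add_cancel] at w
  obtain ⟨u, e⟩ := Set.ncard_eq_one.1 hw
  have hm : ∀ r, (r ∈ B ∧ In S.aStar (S.al ((n : ℤ) - 1)) (S.al n) r) ↔ r = u := by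
    intro r
    have : r ∈ (↑B : Set Pt) ∩ S.W n ↔ r ∈ ({u} : Set Pt) := by rw [e]
    rw [← S.mem_W hb hc h1 h2]
    simpa using this
  have hu := (hm u).2 rfl
  exact ⟨u, hu.1, In.si hb w hu.1 hu.2, fun r hr hi => (hm r).1 ⟨hr, hi⟩⟩

end star

/-- **Lemma 7.** Let `P = A ∪ B` be an `ℓ`-divided set with `A` not in convex position,
`|A| ≥ 5` and `|B| ≥ 6`. Let `W_i, …, W_j` be consecutive `a*`-wedges with
`1 ≤ i < j ≤ t`, `w_i = 2 = w_j`, and `w_k = 1` for every `i < k < j`. Then there is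
an `ℓ`-divided 5-hole in `P`. -/
theorem two_ones_two_wedges
    (x0 : ℝ) (A B : Finset Pt)
    (hA : ∀ p ∈ A, p.1 < x0) (hB : ∀ p ∈ B, x0 < p.1)
    (hBne : B.Nonempty)
    (hgen : GenPos (↑(A ∪ B) : Set Pt))
    (hx : Set.InjOn Prod.fst (↑(A ∪ B) : Set Pt))
    (hAnc : ¬ ConvexPos (↑A : Set Pt))
    (S : StarSetup x0 A)
    (hAcard : 5 ≤ A.card) (hBcard : 6 ≤ B.card)
    (i j : ℕ) (hi : 1 ≤ i) (hij : i < j) (hjt : j ≤ S.t)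
    (hwi : S.w B i = 2) (hwj : S.w B j = 2)
    (hmid : ∀ k : ℕ, i < k → k < j → S.w B k = 1) :
    ∃ H : Finset Pt, DividedFiveHole A B H := by
  by_contra hno
  push Not at hno
  have hb : Base x0 A B := by
    refine ⟨hA, hB, ?_, ?_, hno⟩
    · intro p hp q hq r hr h1 h2 h3 h
      exact hgen p (Finset.mem_coe.2 hp) q (Finset.mem_coe.2 hq) r (Finset.mem_coe.2 hr) h1 h2 h3
        (ori_collinear h1 h)
    · intro p hp q hq h
      exact hx (Finset.mem_coe.2 hp) (Finset.mem_coe.2 hq) h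
  have htN := S.t_le
  obtain ⟨b1, b2, v0⟩ := S.W2_of hb hAcard hi (by omega) hwi
  obtain ⟨p, q, vd⟩ := S.W2_of hb hAcard (n := j) (by omega) (by omega) hwj
  have hm : ∀ k : ℤ, ∃ m, 0 < k → k < (j : ℤ) - i →
      W1 B S.aStar (S.al (k + ((i : ℤ) - 1))) (S.al (k + 1 + ((i : ℤ) - 1))) m := by
    intro k
    by_cases h : 0 < k ∧ k < (j : ℤ) - i
    · obtain ⟨n, rfl⟩ := Int.eq_ofNat_of_zero_le h.1.le
      obtain ⟨m, h1⟩ := S.W1_of hb hAcard (n := n + i) (by omega) (by omega)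
        (hmid (n + i) (by omega) (by omega))
      refine ⟨m, fun _ _ => ?_⟩
      push_cast at h1
      rw [show (n : ℤ) + ((i : ℤ) - 1) = n + i - 1 by ring,
        show (n : ℤ) + 1 + ((i : ℤ) - 1) = n + i by ring]
      exact h1
    · exact ⟨p, fun h1 h2 => absurd ⟨h1, h2⟩ h⟩
  choose m hm using hm
  have K : Conf x0 A B S.aStar (fun k => S.al (k + ((i : ℤ) - 1))) (0 - ((i : ℤ) - 1))
      (S.t - ((i : ℤ) - 1)) ((j : ℤ) - i) b1 b2 m p q := by
    refine ⟨(S.ctx hb hAcard hBcard).shift _, by omega, by omega, by omega, ?_, hm, ?_⟩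
    · rw [show (0 : ℤ) + ((i : ℤ) - 1) = i - 1 by ring, show (1 : ℤ) + ((i : ℤ) - 1) = i by ring]
      exact v0
    · rw [show (j : ℤ) - i + ((i : ℤ) - 1) = j - 1 by ring,
        show (j : ℤ) - i + 1 + ((i : ℤ) - 1) = j by ring]
      exact vd
  exact K.false

end
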